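/- Thermodynamic formalism under specification (Theorem B, main part): Let (X,d) be a compact metric space, T a forward expansive correspondence on X having the specification property, and φ : O₂(T) → ℝ a Bowen summable continuous function. Then the Variational Principle P(T,φ) = sup_{Q,μ} { h_μ(Q) + ∫_X ∫_{T(x₁)} φ(x₁,x₂) dQ_{x₁}(x₂) dμ(x₁) } holds (Q ranging over transition probability kernels on X supported by T, μ over Q-invariant Borel probability measures), and there exists an equilibrium state (μ_φ, Q) for T and φ. Moreover, the equilibrium state is unique in the following sense: the measure μ_φ is unique, and if (μ_φ,Q) and (μ_φ,Q′) are both equilibrium states, then for μ_φ-almost every x ∈ X one has Q_x(A) = Q′_x(A) for all Borel sets A ⊆ X. -/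

import Mathlib

open Filter MeasureTheory Set
open scoped Topology ENNReal Classical

namespace Corr

variable {X : Type*}

/-- `T` is a correspondence on `X`: each `T x` is a nonempty closed subset of `X`
and the graph `O₂(T)` is closed in `X × X`. -/
def IsCorrespondence [MetricSpace X] (T : X → Set X) : Prop :=
  (∀ x, (T x).Nonempty) ∧ (∀ x, IsClosed (T x)) ∧ IsClosed {p : X × X | p.2 ∈ T p.1}

/-- The graph `O₂(T) = {(x₁,x₂) : x₂ ∈ T x₁}`. -/
def graph2 (T : X → Set X) : Set (X × X) := {p | p.2 ∈ T p.1}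

/-- The orbit space `O_ω(T)` (0-indexed sequences). -/
def orbitSpace (T : X → Set X) : Set (ℕ → X) := {x | ∀ k, x (k + 1) ∈ T (x k)}

/-- `x : Fin (n+1) → X` is an element of `O_{n+1}(T)`. -/
def IsFinOrbit (T : X → Set X) {n : ℕ} (x : Fin (n + 1) → X) : Prop :=
  ∀ i : Fin n, x i.succ ∈ T (x i.castSucc)

/-- `O_{n+1}(T)` as a subset of `Fin (n+1) → X` (with the sup metric). -/
def finOrbits (T : X → Set X) (n : ℕ) : Set (Fin (n + 1) → X) := {x | IsFinOrbit T x}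

/-- The first `n` entries of `x : ℕ → X` form an orbit in `O_n(T)`. -/
def IsOrbitSeg (T : X → Set X) (n : ℕ) (x : ℕ → X) : Prop :=
  ∀ i : ℕ, i + 1 < n → x (i + 1) ∈ T (x i)

/-- The shift on sequences. -/
def shiftSeq : (ℕ → X) → ℕ → X := fun x k => x (k + 1)

/-- The shift `σ` on the orbit space `O_ω(T)`. -/
def shiftOrb (T : X → Set X) : ↥(orbitSpace T) → ↥(orbitSpace T) :=
  fun x => ⟨shiftSeq x.1, fun k => x.2 (k + 1)⟩

/-- The metric `d_ω` on sequences (`k`-th coordinate, `k ≥ 0`, has weight `2^{-(k+1)}`). -/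
noncomputable def dOmega [MetricSpace X] (x y : ℕ → X) : ℝ :=
  ∑' k : ℕ, (1 / 2 : ℝ) ^ (k + 1) * (dist (x k) (y k) / (1 + dist (x k) (y k)))

/-- `T` is forward expansive with expansive constant `ε`. -/
def IsFwdExpansiveWith [MetricSpace X] (T : X → Set X) (ε : ℝ) : Prop :=
  0 < ε ∧ ∀ x ∈ orbitSpace T, ∀ y ∈ orbitSpace T, x ≠ y → ∃ n : ℕ, ε < dist (x n) (y n)

/-- `T` is forward expansive. -/
def IsFwdExpansive [MetricSpace X] (T : X → Set X) : Prop :=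
  ∃ ε : ℝ, IsFwdExpansiveWith T ε

/-- Extension by `0` of a potential `φ : O₂(T) → ℝ` to `X × X`. -/
noncomputable def ext2 (T : X → Set X) (φ : ↥(graph2 T) → ℝ) : X × X → ℝ :=
  fun p => if h : p ∈ graph2 T then φ ⟨p, h⟩ else 0

/-- The Birkhoff sum `S_n φ` along an element of `X^{n+1}` (equal to the sum
`∑_{i=1}^n φ(x_i, x_{i+1})` on orbits in `O_{n+1}(T)`). -/
noncomputable def birkhoff (T : X → Set X) (φ : ↥(graph2 T) → ℝ) {n : ℕ}
    (x : Fin (n + 1) → X) : ℝ :=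
  ∑ i : Fin n, ext2 T φ (x i.castSucc, x i.succ)

/-- `E` is `ε`-separated: distinct points of `E` are at distance `≥ ε`. -/
def eSep {Y : Type*} [PseudoMetricSpace Y] (ε : ℝ) (E : Set Y) : Prop :=
  ∀ x ∈ E, ∀ y ∈ E, x ≠ y → ε ≤ dist x y

/-- `∑_{x ∈ E} exp (S_n φ (x))` for a set `E` of orbit segments. -/
noncomputable def orbSum (T : X → Set X) (φ : ↥(graph2 T) → ℝ) (n : ℕ)
    (E : Set (Fin (n + 1) → X)) : ℝ≥0∞ :=
  ∑' x : E, ENNReal.ofReal (Real.exp (birkhoff T φ (x : Fin (n + 1) → X)))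

/-- Logarithm `ℝ≥0∞ → EReal`, with `log 0 = ⊥` and `log ⊤ = ⊤`. -/
noncomputable def elog (x : ℝ≥0∞) : EReal :=
  if x = 0 then ⊥ else if x = ⊤ then ⊤ else ((Real.log x.toReal : ℝ) : EReal)

/-- `sup_E ∑_{x ∈ E} exp (S_n φ (x))` over `ε`-separated subsets `E` of `O_{n+1}(T)`. -/
noncomputable def sepSup [MetricSpace X] (T : X → Set X) (φ : ↥(graph2 T) → ℝ)
    (n : ℕ) (ε : ℝ) : ℝ≥0∞ :=
  ⨆ (E : Set (Fin (n + 1) → X)) (_ : E ⊆ finOrbits T n) (_ : eSep ε E), orbSum T φ n E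

/-- `inf_F ∑_{x ∈ F} exp (S_n φ (x))` over `ε`-spanning subsets `F` of `O_{n+1}(T)`. -/
noncomputable def spanInf [MetricSpace X] (T : X → Set X) (φ : ↥(graph2 T) → ℝ)
    (n : ℕ) (ε : ℝ) : ℝ≥0∞ :=
  ⨅ (E : Set (Fin (n + 1) → X)) (_ : E ⊆ finOrbits T n)
    (_ : ∀ y ∈ finOrbits T n, ∃ x ∈ E, dist x y < ε), orbSum T φ n E

/-- `limsup_n (1/n) log sup_E ∑_{x ∈ E} exp (S_n φ (x))` for a fixed `ε`. -/
noncomputable def pressSepEps [MetricSpace X] (T : X → Set X) (φ : ↥(graph2 T) → ℝ)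
    (ε : ℝ) : EReal :=
  Filter.limsup (fun n : ℕ => (((n : ℝ)⁻¹ : ℝ) : EReal) * elog (sepSup T φ n ε)) atTop

/-- The spanning-set analogue of `pressSepEps`. -/
noncomputable def pressSpanEps [MetricSpace X] (T : X → Set X) (φ : ↥(graph2 T) → ℝ)
    (ε : ℝ) : EReal :=
  Filter.limsup (fun n : ℕ => (((n : ℝ)⁻¹ : ℝ) : EReal) * elog (spanInf T φ n ε)) atTop

/-- The topological pressure `P(T,φ)` of a correspondence: the limit as `ε → 0⁺`
(equivalently, since `pressSepEps` is antitone in `ε`, the limsup) of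
`limsup_n (1/n) log sup_E ∑_{x∈E} exp (S_nφ(x))` over `ε`-separated sets `E ⊆ O_{n+1}(T)`. -/
noncomputable def pressure [MetricSpace X] (T : X → Set X) (φ : ↥(graph2 T) → ℝ) : EReal :=
  Filter.limsup (fun ε : ℝ => pressSepEps T φ ε) (𝓝[>] (0 : ℝ))

section MeasureTheoryDefs

variable [MeasurableSpace X]

/-- A transition probability kernel on `X`: a measurable assignment of probability
measures. -/
def IsTransKernel (Q : X → Measure X) : Prop :=
  Measurable Q ∧ ∀ x, IsProbabilityMeasure (Q x)

/-- The kernel `Q` is supported by the correspondence `T`. -/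
def SupportedBy (T : X → Set X) (Q : X → Measure X) : Prop :=
  ∀ x, Q x (T x) = 1

/-- `markovLaw μ Q n = μQ^{[n]}`, the law on `X^{n+1}` of the first `n+1` states of the
Markov chain with initial law `μ` and transition kernel `Q`. -/
noncomputable def markovLaw (μ : Measure X) (Q : X → Measure X) :
    (n : ℕ) → Measure (Fin (n + 1) → X)
  | 0 => μ.map fun x => fun _ : Fin 1 => x
  | n + 1 => (markovLaw μ Q n).bind fun x => (Q (x (Fin.last n))).map fun y => Fin.snoc x y

/-- `μQ^{[1]}` as a measure on `X × X`. -/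
noncomputable def step2 (μ : Measure X) (Q : X → Measure X) : Measure (X × X) :=
  μ.bind fun x => (Q x).map fun y => (x, y)

/-- `ν` is the law `μQ^ω` on `X^ℕ` of the full trajectory of the Markov chain with
initial law `μ` and transition kernel `Q`. -/
def IsTrajLaw (μ : Measure X) (Q : X → Measure X) (ν : Measure (ℕ → X)) : Prop :=
  IsProbabilityMeasure ν ∧
    ∀ n : ℕ, ν.map (fun x (i : Fin (n + 1)) => x i.val) = markovLaw μ Q n

end MeasureTheoryDefs

/-- The entropy `H_ν(𝒜)` of the finite measurable partition of `Y` given by the fibers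
of `p : Y → I`. -/
noncomputable def partEntropy {Y : Type*} [MeasurableSpace Y] (ν : Measure Y)
    {I : Type*} [Fintype I] (p : Y → I) : ℝ :=
  ∑ i : I, Real.negMulLog ((ν (p ⁻¹' {i})).toReal)

/-- The measure-theoretic entropy `h_μ(Q)` of a transition probability kernel:
`sup_𝒜 lim_n (1/n) H_{μQ^{[n-1]}}(𝒜ⁿ)` over finite measurable partitions `𝒜` of `X`. -/
noncomputable def kernelEntropy [MeasurableSpace X] (μ : Measure X) (Q : X → Measure X) :
    EReal :=
  ⨆ (m : ℕ) (p : X → Fin m) (_ : Measurable p),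
    ((Filter.limsup
        (fun n : ℕ => (n : ℝ)⁻¹ * partEntropy (markovLaw μ Q (n - 1)) fun x => p ∘ x)
        atTop : ℝ) : EReal)

/-- The Kolmogorov–Sinai entropy `h_ν(g)` of a measurable map `g`:
`sup_𝒫 lim_n (1/n) H_ν(⋁_{i<n} g^{-i}𝒫)` over finite measurable partitions `𝒫`. -/
noncomputable def ksEntropy {Y : Type*} [MeasurableSpace Y] (ν : Measure Y) (g : Y → Y) :
    EReal :=
  ⨆ (m : ℕ) (p : Y → Fin m) (_ : Measurable p),
    ((Filter.limsup
        (fun n : ℕ => (n : ℝ)⁻¹ * partEntropy ν fun y => fun i : Fin n => p (g^[i.val] y))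
        atTop : ℝ) : EReal)

/-- The energy term `∫_X ∫_{T(x)} φ(x,y) dQ_x(y) dμ(x)`. -/
noncomputable def energyInt [MeasurableSpace X] (T : X → Set X) (φ : ↥(graph2 T) → ℝ)
    (Q : X → Measure X) (μ : Measure X) : ℝ :=
  ∫ x, (∫ y in T x, ext2 T φ (x, y) ∂(Q x)) ∂μ

/-- `sup_{Q,μ} { h_μ(Q) + ∫∫ φ dQ dμ }` over transition probability kernels `Q`
supported by `T` and `Q`-invariant Borel probability measures `μ`. -/
noncomputable def varSup [MetricSpace X] [MeasurableSpace X] (T : X → Set X)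
    (φ : ↥(graph2 T) → ℝ) : EReal :=
  ⨆ (Q : X → Measure X) (_ : IsTransKernel Q) (_ : SupportedBy T Q) (μ : Measure X)
    (_ : IsProbabilityMeasure μ) (_ : μ.bind Q = μ),
    kernelEntropy μ Q + ((energyInt T φ Q μ : ℝ) : EReal)

/-- `(μ, Q)` is an equilibrium state for `T` and `φ`. -/
def IsEquilibrium [MetricSpace X] [MeasurableSpace X] (T : X → Set X) (φ : ↥(graph2 T) → ℝ)
    (μ : Measure X) (Q : X → Measure X) : Prop :=
  IsTransKernel Q ∧ SupportedBy T Q ∧ IsProbabilityMeasure μ ∧ μ.bind Q = μ ∧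
    pressure T φ = kernelEntropy μ Q + ((energyInt T φ Q μ : ℝ) : EReal)

/-- `H(ρ) = -∑_y ρ{y} log ρ{y}` if `ρ` is supported on a countable set, `∞` otherwise. -/
noncomputable def atomEntropy {Y : Type*} [MeasurableSpace Y] (ρ : Measure Y) : ℝ≥0∞ :=
  if ∃ A : Set Y, A.Countable ∧ MeasurableSet A ∧ ρ A = 1 then
    ∑' y : Y, ENNReal.ofReal (Real.negMulLog ((ρ {y}).toReal))
  else ⊤

/-- `R` is a backward conditional transition probability kernel of `ν` from `X₂` to `X₁`
supported on `M`. -/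
def IsBackwardCondKernel {X₁ X₂ : Type*} [MeasurableSpace X₁] [MeasurableSpace X₂]
    (ν : Measure (X₁ × X₂)) (M : Set (X₁ × X₂)) (R : X₂ → Measure X₁) : Prop :=
  Measurable R ∧ (∀ x, IsProbabilityMeasure (R x)) ∧
    (∀ x₂ ∈ Prod.snd '' M, R x₂ {x₁ | (x₁, x₂) ∈ M} = 1) ∧
    ∀ C : Set (X₁ × X₂), MeasurableSet C →
      ν C = ∫⁻ x₂, R x₂ {x₁ | (x₁, x₂) ∈ C} ∂(ν.map Prod.snd)

/-- `m(k) = ∑_{l<k} (m_l + p_l)`, the offsets in the specification property. -/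
def specShift {n : ℕ} (m p : Fin n → ℕ) (k : ℕ) : ℕ :=
  ∑ l : Fin n, if l.val < k then m l + p l else 0

/-- The specification property for correspondences. -/
def HasSpecification [MetricSpace X] (T : X → Set X) : Prop :=
  ∀ ε : ℝ, 0 < ε → ∃ M : ℕ, ∀ (n : ℕ) (m p : Fin n → ℕ) (x : Fin n → ℕ → X),
    (∀ j, 1 ≤ m j) → (∀ j, M < p j) → (∀ j, IsOrbitSeg T (m j) (x j)) →
    ∃ z ∈ orbitSpace T, ∀ j : Fin n, ∀ i < m j,
      dist (z (specShift m p j.val + i)) (x j i) < ε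

/-- `φ` is Bowen summable w.r.t. the expansive constant `ε`, i.e.
`sup_n K_{φ,T}(ε,n) < ∞`. -/
def BowenSummableWith [MetricSpace X] (T : X → Set X) (φ : ↥(graph2 T) → ℝ) (ε : ℝ) : Prop :=
  ∃ C : ℝ, ∀ (n : ℕ) (x y : Fin (n + 1) → X), IsFinOrbit T x → IsFinOrbit T y →
    (∀ k, dist (x k) (y k) < ε) → |birkhoff T φ x - birkhoff T φ y| ≤ C

/-- Forward image `T(A) = ⋃_{x ∈ A} T(x)`. -/
def corrImage (T : X → Set X) (A : Set X) : Set X := ⋃ x ∈ A, T x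

/-- Iterated forward images `Tⁿ(A)`. -/
def corrIter (T : X → Set X) : ℕ → Set X → Set X
  | 0, A => A
  | n + 1, A => corrImage T (corrIter T n A)

/-- Backward image `T^{-1}(A) = {y : A ∩ T(y) ≠ ∅}`. -/
def corrPre (T : X → Set X) (A : Set X) : Set X := {y | (A ∩ T y).Nonempty}

/-- Iterated backward images `T^{-n}(A)`. -/
def corrPreIter (T : X → Set X) : ℕ → Set X → Set X
  | 0, A => A
  | n + 1, A => corrPre T (corrPreIter T n A)

/-- `T` is an open correspondence. -/
def IsOpenCorr [MetricSpace X] (T : X → Set X) : Prop :=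
  ∀ U : Set X, IsOpen U → IsOpen (corrImage T U)

/-- `T` is strongly transitive: `⋃_{n ≥ 1} T^{-n}(x)` is dense for every `x`. -/
def StronglyTransitive [MetricSpace X] (T : X → Set X) : Prop :=
  ∀ x : X, Dense (⋃ n : ℕ, corrPreIter T (n + 1) {x})

/-- `T` is distance-expanding. -/
def DistanceExpanding [MetricSpace X] (T : X → Set X) : Prop :=
  ∃ lam : ℝ, 1 < lam ∧ ∃ η : ℝ, 0 < η ∧ ∃ n : ℕ, 1 ≤ n ∧
    ∀ x y : X, dist x y ≤ η →
      ∀ x' ∈ corrIter T n {x}, ∀ y' ∈ corrIter T n {y}, lam * dist x y ≤ dist x' y'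

/-- `T` is topologically exact. -/
def TopologicallyExact [MetricSpace X] (T : X → Set X) : Prop :=
  ∀ U : Set X, IsOpen U → U.Nonempty → ∃ N : ℕ, 1 ≤ N ∧ corrIter T N U = Set.univ

/-- `φ : O₂(T) → ℝ` is Hölder continuous w.r.t. the metric
`d₂((x₁,x₂),(y₁,y₂)) = max (d x₁ y₁) (d x₂ y₂)` (the product metric on `X × X`). -/
def HolderOn [MetricSpace X] (T : X → Set X) (φ : ↥(graph2 T) → ℝ) : Prop :=
  ∃ C : ℝ, 0 < C ∧ ∃ α : ℝ, 0 < α ∧ α ≤ 1 ∧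
    ∀ a b : ↥(graph2 T), |φ a - φ b| ≤ C * dist (a : X × X) (b : X × X) ^ α

/-- `O_{-n}(x)`: backward orbits of length `n+1` terminating at `x`. -/
def backOrbits (T : X → Set X) (n : ℕ) (x : X) : Set (Fin (n + 1) → X) :=
  {y | IsFinOrbit T y ∧ y (Fin.last n) = x}

/-- The lift `φ̃(x₁,x₂,…) = φ(x₁,x₂)` of a potential to the orbit space. -/
def liftPhi (T : X → Set X) (φ : ↥(graph2 T) → ℝ) : ↥(orbitSpace T) → ℝ :=
  fun x => φ ⟨(x.1 0, x.1 1), x.2 0⟩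

/-- The Ruelle operator `L_{φ̃}` for the shift on the orbit space:
`(L_{φ̃} Φ)(x) = ∑_{σ(y)=x} Φ(y) exp(φ̃(y))`. -/
noncomputable def ruelleL (T : X → Set X) (φ : ↥(graph2 T) → ℝ)
    (Φ : ↥(orbitSpace T) → ℝ) : ↥(orbitSpace T) → ℝ :=
  fun x => ∑ᶠ (y : ↥(orbitSpace T)) (_ : shiftOrb T y = x), Φ y * Real.exp (liftPhi T φ y)

/-- Classical topological pressure of a map `g : Y → Y` w.r.t. a potential `ψ` and an
explicit distance function `ρ`, via `(n,ε)`-separated sets. -/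
noncomputable def dynPressure {Y : Type*} (ρ : Y → Y → ℝ) (g : Y → Y) (ψ : Y → ℝ) : EReal :=
  Filter.limsup (fun ε : ℝ =>
    Filter.limsup (fun n : ℕ => (((n : ℝ)⁻¹ : ℝ) : EReal) * elog
      (⨆ (E : Set Y) (_ : ∀ x ∈ E, ∀ y ∈ E, x ≠ y → ∃ j < n, ε ≤ ρ (g^[j] x) (g^[j] y)),
        ∑' x : E, ENNReal.ofReal (Real.exp (∑ j ∈ Finset.range n, ψ (g^[j] (x : Y))))))
      atTop) (𝓝[>] (0 : ℝ))

end Corr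

namespace Corr

set_option linter.unusedSectionVars false

section FiniteEntropy

variable {Ω : Type*} [MeasurableSpace Ω]

/-- A map to a (finite) set all of whose fibres are measurable. -/
def FinMeas {G : Type*} (g : Ω → G) : Prop := ∀ x, MeasurableSet (g ⁻¹' {x})

namespace FinMeas

variable {G H : Type*} {g : Ω → G}

theorem measurableSet_preimage [Finite G] (hg : FinMeas g) (s : Set G) :
    MeasurableSet (g ⁻¹' s) := by
  have : g ⁻¹' s = ⋃ x ∈ s, g ⁻¹' {x} := by ext; simp
  rw [this]
  exact MeasurableSet.biUnion (Set.to_countable s) fun x _ => hg x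

theorem map [Finite G] (hg : FinMeas g) (F : G → H) : FinMeas fun y => F (g y) :=
  fun x => hg.measurableSet_preimage (F ⁻¹' {x})

theorem prodMk {h : Ω → H} (hg : FinMeas g) (hh : FinMeas h) :
    FinMeas fun y => (g y, h y) := by
  rintro ⟨a, b⟩
  have : (fun y => (g y, h y)) ⁻¹' {(a, b)} = g ⁻¹' {a} ∩ h ⁻¹' {b} := by
    ext; simp
  rw [this]
  exact (hg a).inter (hh b)

theorem pi {ι : Type*} [Countable ι] {u : ι → Ω → G} (hu : ∀ i, FinMeas (u i)) :
    FinMeas fun y i => u i y := by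
  intro x
  have : (fun y i => u i y) ⁻¹' {x} = ⋂ i, u i ⁻¹' {x i} := by
    ext; simp [funext_iff]
  rw [this]
  exact MeasurableSet.iInter fun i => hu i _

theorem comp_measurable {Ω' : Type*} [MeasurableSpace Ω'] {S : Ω' → Ω} (hg : FinMeas g)
    (hS : Measurable S) : FinMeas fun y => g (S y) :=
  fun x => hS (hg x)

theorem measurable_real [Finite G] (hg : FinMeas g) (F : G → ℝ) :
    Measurable fun y => F (g y) := by
  intro s _
  exact hg.measurableSet_preimage (F ⁻¹' s)

theorem integrable [Finite G] (hg : FinMeas g) (ν : Measure Ω) [IsFiniteMeasure ν] (F : G → ℝ) :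
    Integrable (fun y => F (g y)) ν := by
  obtain ⟨C, hC⟩ := (Set.finite_range fun x => ‖F x‖).bddAbove
  exact Integrable.of_bound (hg.measurable_real F).aestronglyMeasurable C
    (ae_of_all _ fun y => hC ⟨g y, rfl⟩)

theorem integral_eq_sum [Fintype G] (hg : FinMeas g) (ν : Measure Ω) [IsFiniteMeasure ν]
    (F : G → ℝ) : ∫ y, F (g y) ∂ν = ∑ x, (ν (g ⁻¹' {x})).toReal * F x := by
  have h1 : ∀ y, F (g y) = ∑ x, (g ⁻¹' {x}).indicator (fun _ => F x) y := by
    intro y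
    rw [Finset.sum_eq_single (g y)]
    · simp
    · intro b _ hb
      simp [Set.indicator, hb.symm]
    · simp
  simp_rw [h1]
  rw [integral_finsetSum]
  · refine Finset.sum_congr rfl fun x _ => ?_
    rw [integral_indicator_const _ (hg x)]
    simp [measureReal_def]
  · intro x _
    exact (integrable_const _).indicator (hg x)

end FinMeas

/-- The finite-valued map `g` has expected code length at most `c` for some
sub-probability vector on its values. -/
def HasCode (ν : Measure Ω) {G : Type*} [Fintype G] (g : Ω → G) (c : ℝ) : Prop :=
  ∃ q : G → ℝ, (∀ x, 0 ≤ q x) ∧ (∀ y, 0 < q (g y)) ∧ ∑ x, q x ≤ 1 ∧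
    ∫ y, -Real.log (q (g y)) ∂ν ≤ c

variable {ν : Measure Ω}
  {G H : Type*} [Fintype G] [Fintype H] {g : Ω → G} {h : Ω → H}

theorem HasCode.of_factorsThrough [IsProbabilityMeasure ν] {c : ℝ} (hg : FinMeas g)
    (hgh : Function.FactorsThrough h g) (hc : HasCode ν g c) : HasCode ν h c := by
  obtain ⟨q, hq0, hqpos, hq1, hqc⟩ := hc
  obtain ⟨y0⟩ : Nonempty Ω := nonempty_of_isProbabilityMeasure ν
  set e : G → H := Function.extend g h (fun _ => h y0) with he
  have hef : ∀ y, e (g y) = h y := fun y => hgh.extend_apply _ y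
  have hhm : FinMeas h := by
    have := hg.map e
    simpa only [hef] using this
  have hle : ∀ y, q (g y) ≤ ∑ x with e x = h y, q x := fun y =>
    Finset.single_le_sum (f := q) (fun x _ => hq0 x) (by simp [hef])
  refine ⟨fun i => ∑ x with e x = i, q x, fun i => Finset.sum_nonneg fun x _ => hq0 x,
    fun y => (hqpos y).trans_le (hle y), ?_, ?_⟩
  · exact (Finset.sum_fiberwise Finset.univ e q).le.trans hq1
  · refine le_trans (integral_mono (hhm.integrable ν fun i => -Real.log (∑ x with e x = i, q x))
      (hg.integrable ν fun x => -Real.log (q x)) fun y => ?_) hqc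
    exact neg_le_neg (Real.log_le_log (hqpos y) (hle y))

theorem HasCode.extend [IsProbabilityMeasure ν] {c c' : ℝ}
    (hg : FinMeas g) (hh : FinMeas h) (hc : HasCode ν g c)
    (τ : G → H → ℝ) (hτ0 : ∀ x i, 0 ≤ τ x i) (hτpos : ∀ y, 0 < τ (g y) (h y))
    (hτ1 : ∀ x, ∑ i, τ x i ≤ 1) (hτc : ∫ y, -Real.log (τ (g y) (h y)) ∂ν ≤ c') :
    HasCode ν (fun y => (g y, h y)) (c + c') := by
  obtain ⟨q, hq0, hqpos, hq1, hqc⟩ := hc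
  refine ⟨fun p => q p.1 * τ p.1 p.2, fun p => mul_nonneg (hq0 _) (hτ0 _ _),
    fun y => mul_pos (hqpos y) (hτpos y), ?_, ?_⟩
  · rw [Fintype.sum_prod_type]
    simp only [← Finset.mul_sum]
    refine le_trans (Finset.sum_le_sum fun x _ => ?_) hq1
    exact mul_le_of_le_one_right (hq0 x) (hτ1 x)
  · have : ∀ y, -Real.log (q (g y) * τ (g y) (h y))
        = -Real.log (q (g y)) + -Real.log (τ (g y) (h y)) := by
      intro y
      rw [Real.log_mul (hqpos y).ne' (hτpos y).ne']
      ring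
    simp only [this]
    rw [integral_add (hg.integrable ν fun x => -Real.log (q x))
      ((hg.prodMk hh).integrable ν fun p => -Real.log (τ p.1 p.2))]
    exact add_le_add hqc hτc

theorem HasCode.comp_measurePreserving {c : ℝ} (hg : FinMeas g) {S : Ω → Ω}
    (hS : MeasurePreserving S ν ν) (hc : HasCode ν g c) : HasCode ν (fun y => g (S y)) c := by
  obtain ⟨q, hq0, hqpos, hq1, hqc⟩ := hc
  refine ⟨q, hq0, fun y => hqpos _, hq1, ?_⟩
  have := integral_map (μ := ν) hS.measurable.aemeasurable
    (hg.measurable_real fun x => -Real.log (q x)).aestronglyMeasurable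
  rw [hS.map_eq] at this
  rw [← this]
  exact hqc

theorem HasCode.uniform [IsProbabilityMeasure ν] [Nonempty G] (g : Ω → G) :
    HasCode ν g (Real.log (Fintype.card G)) := by
  have hpos : (0 : ℝ) < (Fintype.card G : ℝ) := by exact_mod_cast Fintype.card_pos
  refine ⟨fun _ => (Fintype.card G : ℝ)⁻¹, fun _ => by positivity, fun _ => by positivity, ?_, ?_⟩
  · simp
  · simp [Real.log_inv]

theorem HasCode.mono {c c' : ℝ} (hc : HasCode ν g c) (h : c ≤ c') : HasCode ν g c' := by
  obtain ⟨q, hq0, hqpos, hq1, hqc⟩ := hc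
  exact ⟨q, hq0, hqpos, hq1, hqc.trans h⟩

/-- Gibbs' inequality. -/
theorem HasCode.partEntropy_le [IsProbabilityMeasure ν] {c : ℝ} (hg : FinMeas g)
    (hc : HasCode ν g c) :
    partEntropy ν g ≤ c := by
  obtain ⟨q, hq0, hqpos, hq1, hqc⟩ := hc
  refine le_trans ?_ hqc
  rw [hg.integral_eq_sum ν fun x => -Real.log (q x)]
  have hsum : ∑ x, (ν (g ⁻¹' {x})).toReal = 1 := by
    have := hg.integral_eq_sum ν fun _ => (1 : ℝ)
    simpa using this.symm
  have key : ∀ x, Real.negMulLog ((ν (g ⁻¹' {x})).toReal) ≤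
      (ν (g ⁻¹' {x})).toReal * -Real.log (q x) + (q x - (ν (g ⁻¹' {x})).toReal) := by
    intro x
    set p := (ν (g ⁻¹' {x})).toReal with hp
    have hp0 : 0 ≤ p := ENNReal.toReal_nonneg
    rcases hp0.eq_or_lt with h0 | h0
    · rw [← h0]; simpa using hq0 x
    · have hne : (g ⁻¹' {x}).Nonempty := by
        by_contra hne
        rw [Set.not_nonempty_iff_eq_empty] at hne
        rw [hp, hne] at h0
        simp at h0
      obtain ⟨y, hy⟩ := hne
      have hy : g y = x := hy
      have hqx : 0 < q x := hy ▸ hqpos y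
      have hl := Real.log_le_sub_one_of_pos (div_pos hqx h0)
      rw [Real.log_div hqx.ne' h0.ne'] at hl
      have h2 := mul_le_mul_of_nonneg_left hl hp0
      have h3 : p * (q x / p - 1) = q x - p := by field_simp
      rw [h3] at h2
      rw [Real.negMulLog]
      linarith
  unfold partEntropy
  refine (Finset.sum_le_sum fun x _ => key x).trans ?_
  rw [Finset.sum_add_distrib, Finset.sum_sub_distrib, hsum]
  linarith

theorem exists_hasCode_orbit [IsProbabilityMeasure ν] {A B : Type*} [Fintype A] [Fintype B]
    [Nonempty A]
    {S : Ω → Ω} (hS : MeasurePreserving S ν ν)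
    {u : Ω → A} {v : Ω → B} (hu : FinMeas u) (hv : FinMeas v)
    (ρ : B → A → ℝ) (hρ0 : ∀ b a, 0 ≤ ρ b a) (hρpos : ∀ y, 0 < ρ (v (S y)) (u y))
    (hρ1 : ∀ b, ∑ a, ρ b a ≤ 1) {c₁ : ℝ} (hρc : ∫ y, -Real.log (ρ (v (S y)) (u y)) ∂ν ≤ c₁)
    {r : ℕ} (κ : (Fin (r + 1) → A) → B → ℝ) (hκ0 : ∀ w b, 0 < κ w b)
    (hκ1 : ∀ w, ∑ b, κ w b ≤ 1) {c₂ : ℝ}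
    (hκc : ∫ y, -Real.log (κ (fun i => u (S^[i] y)) (v y)) ∂ν ≤ c₂) :
    ∃ C : ℝ, ∀ k : ℕ, HasCode ν (fun y => ((fun i : Fin (k + r + 1) => u (S^[i] y)),
      (fun i : Fin (k + 1) => v (S^[i] y)))) (k * (c₁ + c₂) + C) := by
  have hSi : ∀ i, Measurable (S^[i]) := fun i => hS.measurable.iterate i
  have hW : ∀ k l : ℕ, FinMeas (fun y => ((fun i : Fin k => u (S^[i] y)),
      (fun i : Fin l => v (S^[i] y)))) := fun k l =>
    (FinMeas.pi fun i => hu.comp_measurable (hSi _)).prodMk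
      (FinMeas.pi fun i => hv.comp_measurable (hSi _))
  have hU : ∀ k : ℕ, FinMeas (fun y => (fun i : Fin k => u (S^[i] y))) := fun k =>
    FinMeas.pi fun i => hu.comp_measurable (hSi _)
  refine ⟨Real.log (Fintype.card (Fin (r + 1) → A)) + c₂, fun k => ?_⟩
  induction k with
  | zero =>
    have h1 := (HasCode.uniform (ν := ν) (fun y => (fun i : Fin (r + 1) => u (S^[i] y)))).extend
      (hU _) hv κ (fun w b => (hκ0 w b).le) (fun y => hκ0 _ _) hκ1 hκc
    refine (h1.of_factorsThrough ((hU _).prodMk hv) ?_).mono (by simp)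
    intro y y' hyy
    simp only [Prod.mk.injEq, funext_iff] at hyy ⊢
    refine ⟨fun i => ?_, fun i => ?_⟩
    · exact hyy.1 ⟨i, by omega⟩
    · have : (i : ℕ) = 0 := by omega
      simp only [this]
      exact hyy.2
  | succ k ih =>
    have h1 := ih.comp_measurePreserving (hW _ _) hS
    have h2 := h1.extend ((hW _ _).comp_measurable hS.measurable) hu
      (fun w a => ρ (w.2 0) a) (fun w a => hρ0 _ _) (fun y => hρpos y) (fun w => hρ1 _) hρc
    have hW2 := ((hW (k + r + 1) (k + 1)).comp_measurable hS.measurable).prodMk hu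
    have h3 := h2.extend hW2 hv
      (fun w b => κ (Fin.cons w.2 (fun i : Fin r => w.1.1 ⟨i, by omega⟩)) b)
      (fun w b => (hκ0 _ _).le) (fun y => hκ0 _ _) (fun w => hκ1 _) (c' := c₂) (by
        refine le_of_eq_of_le ?_ hκc
        congr 1
        ext y
        congr 4
        ext i
        refine Fin.cases ?_ (fun j => ?_) i
        · rfl
        · simp)
    refine (h3.of_factorsThrough (hW2.prodMk hv) ?_).mono (by push_cast; linarith)
    intro y y' hyy
    simp only [Prod.mk.injEq, funext_iff] at hyy ⊢
    obtain ⟨⟨⟨h1, h2⟩, h3⟩, h4⟩ := hyy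
    refine ⟨fun i => ?_, fun i => ?_⟩
    · obtain ⟨i, hi⟩ := i
      cases i with
      | zero => exact h3
      | succ i => exact h1 ⟨i, by omega⟩
    · obtain ⟨i, hi⟩ := i
      cases i with
      | zero => exact h4
      | succ i => exact h2 ⟨i, by omega⟩

end FiniteEntropy

theorem shiftSeq_iterate {X : Type*} (n : ℕ) (x : ℕ → X) (i : ℕ) :
    (shiftSeq^[n] x) i = x (i + n) := by
  induction n generalizing i with
  | zero => rfl
  | succ n ih =>
    rw [Function.iterate_succ_apply', shiftSeq, ih]
    congr 1
    omega

theorem continuous_shiftSeq {X : Type*} [TopologicalSpace X] :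
    Continuous (shiftSeq : (ℕ → X) → ℕ → X) :=
  continuous_pi fun k => continuous_apply (k + 1)

section Generating

variable {X : Type*} [MetricSpace X] [CompactSpace X] [MeasurableSpace X] [BorelSpace X]
  {Y : Set (ℕ → X)} {ε : ℝ}

/-- Maps whose fibres are uniformly small in `Y` over a long time window approximate any finite
measurable partition. -/
theorem exists_approx_of_expansive (hYc : IsClosed Y)
    (hexp : ∀ x ∈ Y, ∀ y ∈ Y, (∀ i, dist (x i) (y i) ≤ ε) → x = y)
    (ν : Measure (ℕ → X)) [IsFiniteMeasure ν] (hνY : ν Yᶜ = 0)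
    {B : Type*} [Finite B] [Nonempty B] {v : (ℕ → X) → B} (hv : FinMeas v)
    {η : ℝ≥0∞} (hη : η ≠ 0) :
    ∃ R : ℕ, ∀ {A : Type*} (c : (ℕ → X) → A),
      (∀ y ∈ Y, ∀ y' ∈ Y, c y = c y' → ∀ i < R, dist (y i) (y' i) ≤ ε) →
      ∃ G : A → B, ν {y | v y ≠ G (c y)} ≤ η := by
  have := Fintype.ofFinite B
  have hcard : (Fintype.card B : ℝ≥0∞) ≠ 0 := by simp
  have h1 : ∀ b, ∃ K ⊆ v ⁻¹' {b}, IsClosed K ∧ ν (v ⁻¹' {b} \ K) < η / Fintype.card B :=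
    fun b => (hv b).exists_isClosed_sdiff_lt (measure_ne_top _ _)
      (ENNReal.div_pos hη (ENNReal.natCast_ne_top _)).ne'
  choose K hKv hKc hKν using h1
  have h2 : ∀ b b', ∃ R : ℕ, b ≠ b' → ∀ y ∈ K b ∩ Y, ∀ y' ∈ K b' ∩ Y,
      ¬ ∀ i < R, dist (y i) (y' i) ≤ ε := by
    intro b b'
    by_contra! hcon
    set D : ℕ → Set ((ℕ → X) × (ℕ → X)) := fun R =>
      ((K b ∩ Y) ×ˢ (K b' ∩ Y)) ∩ ⋂ i : Fin R, {p | dist (p.1 i) (p.2 i) ≤ ε} with hD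
    have hDc : ∀ R, IsClosed (D R) := fun R =>
      (((hKc b).inter hYc).prod ((hKc b').inter hYc)).inter
        (isClosed_iInter fun i => isClosed_le (by fun_prop) continuous_const)
    have hne : (⋂ R, D R).Nonempty := by
      refine IsCompact.nonempty_iInter_of_sequence_nonempty_isCompact_isClosed D ?_ ?_
        (hDc 0).isCompact hDc
      · intro R p hp
        refine ⟨hp.1, ?_⟩
        simp only [mem_iInter] at hp ⊢
        have := hp.2
        simp only [mem_iInter] at this
        exact fun i => this ⟨i, by omega⟩
      · intro R
        obtain ⟨hbb, y, hy, y', hy', h⟩ := hcon R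
        refine ⟨(y, y'), ⟨hy, hy'⟩, ?_⟩
        simp only [mem_iInter]
        exact fun i => h i i.2
    obtain ⟨p, hp⟩ := hne
    rw [mem_iInter] at hp
    have hp0 := (hp 0).1
    have heq : p.1 = p.2 := by
      refine hexp _ hp0.1.2 _ hp0.2.2 fun i => ?_
      have := (hp (i + 1)).2
      simp only [mem_iInter] at this
      exact this ⟨i, by omega⟩
    have e1 : v p.1 = b := hKv b hp0.1.1
    have e2 : v p.2 = b' := hKv b' hp0.2.1
    exact (hcon 0).1 (by rw [← e1, ← e2, heq])
  choose R hR using h2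
  refine ⟨Finset.univ.sup fun p : B × B => R p.1 p.2, fun {A} c hc => ?_⟩
  set G : A → B := fun a => if h : ∃ y, (∃ b, y ∈ K b ∩ Y) ∧ c y = a then v h.choose
    else Classical.arbitrary B with hG
  refine ⟨G, ?_⟩
  have hgood : ∀ b, ∀ y ∈ K b ∩ Y, v y = G (c y) := by
    intro b y hy
    have h : ∃ y', (∃ b, y' ∈ K b ∩ Y) ∧ c y' = c y := ⟨y, ⟨b, hy⟩, rfl⟩
    have hGe : G (c y) = v h.choose := by simp only [hG]; rw [dif_pos h]
    rw [hGe]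
    obtain ⟨⟨b', hb'⟩, hcy⟩ := h.choose_spec
    have e1 : v y = b := hKv b hy.1
    have e2 : v h.choose = b' := hKv b' hb'.1
    rw [e1, e2]
    by_contra hbb
    refine hR b b' hbb y hy _ hb' fun i hi => ?_
    refine hc y hy.2 _ hb'.2 hcy.symm i (hi.trans_le ?_)
    exact Finset.le_sup (f := fun p : B × B => R p.1 p.2) (Finset.mem_univ (b, b'))
  have hsub : {y | v y ≠ G (c y)} ⊆ Yᶜ ∪ ⋃ b, (v ⁻¹' {b} \ K b) := by
    intro y hy
    by_cases hyY : y ∈ Y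
    · right
      rw [mem_iUnion]
      exact ⟨v y, rfl, fun hyK => hy (hgood _ y ⟨hyK, hyY⟩)⟩
    · exact Or.inl hyY
  calc ν {y | v y ≠ G (c y)} ≤ ν (Yᶜ ∪ ⋃ b, (v ⁻¹' {b} \ K b)) := measure_mono hsub
    _ ≤ ν Yᶜ + ν (⋃ b, (v ⁻¹' {b} \ K b)) := measure_union_le _ _
    _ ≤ 0 + ∑ b, ν (v ⁻¹' {b} \ K b) := by
        rw [hνY]; gcongr; exact measure_iUnion_fintype_le _ _
    _ ≤ 0 + ∑ b : B, η / Fintype.card B := by gcongr with b; exact (hKν b).le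
    _ = η := by
        rw [zero_add, Finset.sum_const, Finset.card_univ, nsmul_eq_mul]
        exact ENNReal.mul_div_cancel hcard (ENNReal.natCast_ne_top _)

theorem exists_partEntropy_le_of_generating (hYc : IsClosed Y)
    (hYs : ∀ y ∈ Y, shiftSeq y ∈ Y)
    (hexp : ∀ x ∈ Y, ∀ y ∈ Y, (∀ i, dist (x i) (y i) ≤ ε) → x = y)
    (ν : Measure (ℕ → X)) [IsProbabilityMeasure ν] (hνY : ν Yᶜ = 0)
    {n : ℕ} (hn : 1 ≤ n) (hS : MeasurePreserving (shiftSeq^[n]) ν ν)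
    {A B : Type*} [Fintype A] [Fintype B]
    {u : (ℕ → X) → A} (hu : FinMeas u) {v : (ℕ → X) → B} (hv : FinMeas v)
    (hue : ∀ y ∈ Y, ∀ y' ∈ Y, u y = u y' → ∀ i < n, dist (y i) (y' i) ≤ ε)
    (ρ : B → A → ℝ) (hρ0 : ∀ b a, 0 ≤ ρ b a)
    (hρpos : ∀ y, 0 < ρ (v (shiftSeq^[n] y)) (u y))
    (hρ1 : ∀ b, ∑ a, ρ b a ≤ 1) {η : ℝ} (hη : 0 < η) :
    ∃ C : ℝ, ∀ (k : ℕ) {F : Type} [Fintype F] (f : (ℕ → X) → F),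
      (∀ y y', (∀ i ≤ k, u ((shiftSeq^[n])^[i] y) = u ((shiftSeq^[n])^[i] y')) →
        (∀ i ≤ k, v ((shiftSeq^[n])^[i] y) = v ((shiftSeq^[n])^[i] y')) → f y = f y') →
      partEntropy ν f ≤ k * (∫ y, -Real.log (ρ (v (shiftSeq^[n] y)) (u y)) ∂ν + η) + C := by
  obtain ⟨y0⟩ : Nonempty (ℕ → X) := nonempty_of_isProbabilityMeasure ν
  have : Nonempty A := ⟨u y0⟩
  have : Nonempty B := ⟨v y0⟩
  set S : (ℕ → X) → ℕ → X := shiftSeq^[n] with hSdef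
  set θ : ℝ := 1 - Real.exp (-(η / 2)) with hθ
  have hexp1 : Real.exp (-(η / 2)) < 1 := by
    rw [Real.exp_lt_one_iff]; linarith
  have hθ0 : 0 < θ := by rw [hθ]; linarith
  have hθ1 : 0 < 1 - θ := by rw [hθ]; simpa using Real.exp_pos _
  have hlogθ : -Real.log (1 - θ) = η / 2 := by
    rw [hθ]; simp
  have hcard : (0 : ℝ) < Fintype.card B := by exact_mod_cast Fintype.card_pos
  set L : ℝ := |Real.log (θ / Fintype.card B)| with hL
  set δ : ℝ := η / 2 / (L + 1) with hδ
  have hL0 : 0 ≤ L := abs_nonneg _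
  have hδ0 : 0 < δ := by positivity
  obtain ⟨R, hR⟩ := exists_approx_of_expansive hYc hexp ν hνY hv
    (η := ENNReal.ofReal δ) (by simpa using hδ0)
  have hSi : ∀ i, Measurable (S^[i]) := fun i => hS.measurable.iterate i
  have hSY : ∀ i y, y ∈ Y → S^[i] y ∈ Y := by
    intro i y hy
    rw [hSdef, ← Function.iterate_mul]
    generalize n * i = j
    induction j with
    | zero => exact hy
    | succ j ih => rw [Function.iterate_succ_apply']; exact hYs _ ih
  have hSa : ∀ i y j, (S^[i] y) j = y (j + n * i) := by
    intro i y j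
    rw [hSdef, ← Function.iterate_mul, shiftSeq_iterate]
  obtain ⟨G, hG⟩ := hR (fun y => (fun i : Fin (R + 1) => u (S^[i] y))) (by
    intro y hy y' hy' hyy i hi
    have hq : i / n < R + 1 := lt_of_le_of_lt (Nat.div_le_self _ _) (by omega)
    have h1 := congrFun hyy ⟨i / n, hq⟩
    have h2 := hue _ (hSY (i / n) y hy) _ (hSY (i / n) y' hy') h1 (i % n) (Nat.mod_lt _ (by omega))
    rw [hSa, hSa, Nat.mod_add_div] at h2
    exact h2)
  have huw : FinMeas (fun y => (fun i : Fin (R + 1) => u (S^[i] y))) :=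
    FinMeas.pi fun i => hu.comp_measurable (hSi _)
  set κ : (Fin (R + 1) → A) → B → ℝ := fun w b =>
    θ / Fintype.card B + if b = G w then 1 - θ else 0 with hκ
  have hκ0 : ∀ w b, 0 < κ w b := by
    intro w b
    have : 0 < θ / Fintype.card B := by positivity
    simp only [hκ]
    split_ifs <;> linarith
  have hκ1 : ∀ w, ∑ b, κ w b ≤ 1 := by
    intro w
    simp only [hκ, Finset.sum_add_distrib, Finset.sum_const, Finset.card_univ, nsmul_eq_mul,
      Finset.sum_ite_eq', Finset.mem_univ, if_true]
    field_simp
    linarith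
  set bad : Set (ℕ → X) := {y | v y ≠ G (fun i : Fin (R + 1) => u (S^[i] y))} with hbad
  have hbadm : MeasurableSet bad :=
    (huw.prodMk hv).measurableSet_preimage {p | p.2 ≠ G p.1}
  have hκc : ∫ y, -Real.log (κ (fun i => u (S^[i] y)) (v y)) ∂ν ≤ η := by
    have hpt : ∀ y, -Real.log (κ (fun i => u (S^[i] y)) (v y)) ≤
        η / 2 + bad.indicator (fun _ => L) y := by
      intro y
      by_cases hy : y ∈ bad
      · rw [Set.indicator_of_mem hy]
        have h1 : κ (fun i => u (S^[i] y)) (v y) = θ / Fintype.card B := by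
          simp only [hκ]; rw [if_neg hy, add_zero]
        rw [h1]
        have := neg_le_abs (Real.log (θ / Fintype.card B))
        linarith
      · rw [Set.indicator_of_notMem hy]
        have hy' : v y = G (fun i : Fin (R + 1) => u (S^[i] y)) := by
          by_contra h; exact hy h
        have h1 : 1 - θ ≤ κ (fun i => u (S^[i] y)) (v y) := by
          simp only [hκ]; rw [if_pos hy']
          have : 0 < θ / Fintype.card B := by positivity
          linarith
        have := Real.log_le_log hθ1 h1
        linarith
    have hInt : Integrable (fun y => η / 2 + bad.indicator (fun _ => L) y) ν :=
      (integrable_const _).add ((integrable_const _).indicator hbadm)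
    refine (integral_mono ((huw.prodMk hv).integrable ν fun p => -Real.log (κ p.1 p.2))
      hInt hpt).trans ?_
    rw [integral_add (integrable_const _) ((integrable_const _).indicator hbadm),
      integral_indicator_const _ hbadm]
    have hb : ν.real bad ≤ δ := by
      rw [measureReal_def]
      exact ENNReal.toReal_le_of_le_ofReal hδ0.le hG
    have : δ * L ≤ η / 2 := by
      rw [hδ, div_mul_eq_mul_div, div_le_iff₀ (by linarith)]
      nlinarith
    have h2 : ν.real bad * L ≤ δ * L := mul_le_mul_of_nonneg_right hb hL0
    simp only [integral_const, probReal_univ, smul_eq_mul, one_mul]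
    linarith
  obtain ⟨C, hC⟩ := exists_hasCode_orbit hS hu hv ρ hρ0 hρpos hρ1 le_rfl κ hκ0 hκ1 hκc
  refine ⟨C, fun k F _ f hf => ?_⟩
  have hW : FinMeas (fun y => ((fun i : Fin (k + R + 1) => u (S^[i] y)),
      (fun i : Fin (k + 1) => v (S^[i] y)))) :=
    (FinMeas.pi fun i => hu.comp_measurable (hSi _)).prodMk
      (FinMeas.pi fun i => hv.comp_measurable (hSi _))
  have hfac : Function.FactorsThrough f (fun y => ((fun i : Fin (k + R + 1) => u (S^[i] y)),
      (fun i : Fin (k + 1) => v (S^[i] y)))) := by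
    intro y y' hyy
    simp only [Prod.mk.injEq, funext_iff] at hyy
    exact hf y y' (fun i hi => hyy.1 ⟨i, by omega⟩) (fun i hi => hyy.2 ⟨i, by omega⟩)
  have hfm : FinMeas f := by
    have := hW.map (Function.extend (fun y => ((fun i : Fin (k + R + 1) => u (S^[i] y)),
      (fun i : Fin (k + 1) => v (S^[i] y)))) f fun _ => f y0)
    simpa only [hfac.extend_apply] using this
  exact ((hC k).of_factorsThrough hW hfac).partEntropy_le hfm

end Generating

section Counting

variable {X : Type*}

theorem shift_iterate_mem {Y : Set (ℕ → X)} (h : ∀ y ∈ Y, shiftSeq y ∈ Y) (n : ℕ) {y : ℕ → X}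
    (hy : y ∈ Y) : shiftSeq^[n] y ∈ Y := by
  induction n with
  | zero => exact hy
  | succ n ih => rw [Function.iterate_succ_apply']; exact h _ ih

/-- The Birkhoff sum of a two-coordinate potential along a sequence. -/
noncomputable def seqSum (f : X × X → ℝ) (n : ℕ) (x : ℕ → X) : ℝ :=
  ∑ i ∈ Finset.range n, f (x i, x (i + 1))

theorem seqSum_add (f : X × X → ℝ) (n k : ℕ) (x : ℕ → X) :
    seqSum f (n + k) x = seqSum f n x + seqSum f k (shiftSeq^[n] x) := by
  simp only [seqSum, Finset.sum_range_add, shiftSeq_iterate]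
  congr 1
  refine Finset.sum_congr rfl fun i _ => ?_
  rw [show n + i = i + n by omega, show i + n + 1 = i + 1 + n by omega]

theorem abs_seqSum_le {f : X × X → ℝ} {B : ℝ} (hB : ∀ p, |f p| ≤ B) (n : ℕ) (x : ℕ → X) :
    |seqSum f n x| ≤ n * B := by
  refine (Finset.abs_sum_le_sum_abs _ _).trans ?_
  refine (Finset.sum_le_sum fun i _ => hB _).trans ?_
  simp

/-- `∑_{x ∈ E} exp (S_n f (x))`. -/
noncomputable def expSum (f : X × X → ℝ) (n : ℕ) (E : Finset (ℕ → X)) : ℝ :=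
  ∑ x ∈ E, Real.exp (seqSum f n x)

theorem expSum_nonneg (f : X × X → ℝ) (n : ℕ) (E : Finset (ℕ → X)) : 0 ≤ expSum f n E :=
  Finset.sum_nonneg fun _ _ => (Real.exp_pos _).le

theorem expSum_pos (f : X × X → ℝ) (n : ℕ) {E : Finset (ℕ → X)} (hE : E.Nonempty) :
    0 < expSum f n E := Finset.sum_pos (fun _ _ => Real.exp_pos _) hE

theorem sum_le_mul_sum_of_card_fiber_le {α β : Type*} [DecidableEq β] {E : Finset α} {F : Finset β}
    {K : ℕ}
    (g : α → β) (hg : ∀ x ∈ E, g x ∈ F) (hK : ∀ y ∈ F, (E.filter fun x => g x = y).card ≤ K)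
    {a : α → ℝ} {b : β → ℝ} (hb : ∀ y, 0 ≤ b y) (hab : ∀ x ∈ E, a x ≤ b (g x)) :
    ∑ x ∈ E, a x ≤ K * ∑ y ∈ F, b y := by
  rw [← Finset.sum_fiberwise_of_maps_to hg, Finset.mul_sum]
  refine Finset.sum_le_sum fun y hy => ?_
  calc ∑ x ∈ E with g x = y, a x ≤ ∑ x ∈ E with g x = y, b y := by
        refine Finset.sum_le_sum fun x hx => ?_
        rw [Finset.mem_filter] at hx
        have := hab x hx.1
        rwa [hx.2] at this
    _ = (E.filter fun x => g x = y).card * b y := by simp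
    _ ≤ K * b y := mul_le_mul_of_nonneg_right (by exact_mod_cast hK y hy) (hb y)

theorem exists_rate_of_quasi_multiplicative {Z : ℕ → ℝ} (hZ : ∀ n, 0 < Z n)
    {K K' : ℝ} (hK : 0 < K) (hK' : 0 < K') (h1 : ∀ n k, Z (n + k) ≤ K * (Z n * Z k))
    (h2 : ∀ n k, Z n * Z k ≤ K' * Z (n + k)) :
    ∃ P : ℝ, ∀ n : ℕ, Real.exp (n * P) ≤ K * Z n ∧ Z n ≤ K' * Real.exp (n * P) := by
  set z : ℕ → ℝ := fun n => Real.log (Z n) with hz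
  have l1 : ∀ n k, z (n + k) ≤ Real.log K + (z n + z k) := fun n k => by
    have := Real.log_le_log (hZ _) (h1 n k)
    rwa [Real.log_mul hK.ne' (mul_pos (hZ n) (hZ k)).ne', Real.log_mul (hZ n).ne' (hZ k).ne']
      at this
  have l2 : ∀ n k, z n + z k ≤ Real.log K' + z (n + k) := fun n k => by
    have := Real.log_le_log (mul_pos (hZ n) (hZ k)) (h2 n k)
    rwa [Real.log_mul hK'.ne' (hZ _).ne', Real.log_mul (hZ n).ne' (hZ k).ne'] at this
  have sa : Subadditive fun n => z n + Real.log K := fun n k => by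
    have := l1 n k
    linarith
  have sc : Subadditive fun n => Real.log K' - z n := fun n k => by
    have := l2 n k
    linarith
  have up : ∀ n : ℕ, z n ≤ z 0 + n * (Real.log K + z 1) := by
    intro n
    induction n with
    | zero => simp
    | succ n ih =>
      have := l1 n 1
      push_cast
      linarith
  have low : ∀ n : ℕ, z 0 + n * (z 1 - Real.log K') ≤ z n := by
    intro n
    induction n with
    | zero => simp
    | succ n ih =>
      have := l2 n 1
      push_cast
      linarith
  have bdd : ∀ (w : ℕ → ℝ) (a b : ℝ), (∀ n : ℕ, a + n * b ≤ w n) →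
      BddBelow (range fun n : ℕ => w n / n) := by
    intro w a b hw
    refine ⟨-(|a| + |b|), ?_⟩
    rintro _ ⟨n, rfl⟩
    have ha := neg_abs_le a
    have hb := neg_abs_le b
    have ha' := abs_nonneg a
    have hb' := abs_nonneg b
    rcases Nat.eq_zero_or_pos n with rfl | hn
    · simp only [Nat.cast_zero, div_zero]
      linarith
    · have hn' : (1 : ℝ) ≤ n := by exact_mod_cast hn
      simp only
      rw [le_div_iff₀ (by linarith)]
      have := hw n
      nlinarith
  have ba := bdd (fun n => z n + Real.log K) (z 0 + Real.log K) (z 1 - Real.log K') fun n => by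
    have := low n
    linarith
  have bc := bdd (fun n => Real.log K' - z n) (Real.log K' - z 0) (-(Real.log K + z 1)) fun n => by
    have := up n
    linarith
  have ta := sa.tendsto_lim ba
  have tc := sc.tendsto_lim bc
  have hsum : sa.lim + sc.lim = 0 := by
    refine tendsto_nhds_unique (ta.add tc) ?_
    have : Tendsto (fun n : ℕ => (Real.log K + Real.log K') / (n : ℝ)) atTop (𝓝 0) :=
      tendsto_const_div_atTop_nhds_zero_nat _
    refine this.congr fun n => ?_
    rw [← add_div]
    congr 1
    ring
  refine ⟨sa.lim, fun n => ?_⟩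
  have key : n * sa.lim ≤ z n + Real.log K ∧ z n ≤ Real.log K' + n * sa.lim := by
    rcases Nat.eq_zero_or_pos n with rfl | hn
    · have e1 := l1 0 0
      have e2 := l2 0 0
      simp only [Nat.cast_zero, zero_mul, add_zero] at e1 e2 ⊢
      constructor <;> linarith
    · have hn' : (0 : ℝ) < n := by exact_mod_cast hn
      have e1 := sa.lim_le_div ba hn.ne'
      have e2 := sc.lim_le_div bc hn.ne'
      rw [le_div_iff₀ hn'] at e1 e2
      rw [← eq_neg_iff_add_eq_zero] at hsum
      constructor
      · linarith
      · have : sc.lim = -sa.lim := by linarith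
        rw [this] at e2
        linarith
  constructor
  · rw [← Real.exp_log (mul_pos hK (hZ n)), Real.exp_le_exp, Real.log_mul hK.ne' (hZ n).ne']
    linarith [key.1]
  · rw [← Real.exp_log (hZ n), ← Real.exp_log hK', ← Real.exp_add, Real.exp_le_exp]
    exact key.2

variable [MetricSpace X]

/-- The sequences `x` and `y` stay `s`-close on `[0,n]`. -/
def CloseUpTo (n : ℕ) (s : ℝ) (x y : ℕ → X) : Prop := ∀ i ≤ n, dist (x i) (y i) < s

namespace CloseUpTo

variable {n k : ℕ} {s t : ℝ} {x y z : ℕ → X}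

theorem symm (h : CloseUpTo n s x y) : CloseUpTo n s y x := fun i hi => by
  rw [dist_comm]; exact h i hi

theorem trans (h : CloseUpTo n s x y) (h' : CloseUpTo n t y z) : CloseUpTo n (s + t) x z :=
  fun i hi => (dist_triangle _ (y i) _).trans_lt (add_lt_add (h i hi) (h' i hi))

theorem mono (h : CloseUpTo n s x y) (hst : s ≤ t) : CloseUpTo n t x y :=
  fun i hi => (h i hi).trans_le hst

theorem refl (n : ℕ) (hs : 0 < s) (x : ℕ → X) : CloseUpTo n s x x := fun i _ => by
  rw [dist_self]; exact hs

end CloseUpTo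

/-- A closed shift-invariant set `Y` of sequences, with a two-coordinate potential `f`, that is
expansive with constant `ε`, has specification for three orbit segments, and on which `f` has
bounded distortion. -/
structure SpecSystem (Y : Set (ℕ → X)) (f : X × X → ℝ) (ε : ℝ) : Prop where
  pos : 0 < ε
  isClosed : IsClosed Y
  nonempty : Y.Nonempty
  shift_mem : ∀ y ∈ Y, shiftSeq y ∈ Y
  bounded : ∃ B, ∀ p, |f p| ≤ B
  expansive : ∀ x ∈ Y, ∀ y ∈ Y, (∀ i, dist (x i) (y i) ≤ ε) → x = y
  distortion : ∃ C, ∀ n, ∀ x ∈ Y, ∀ y ∈ Y, CloseUpTo n ε x y →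
    |seqSum f n x - seqSum f n y| ≤ C
  glue : ∀ τ > 0, ∃ L : ℕ, ∀ n k l, ∀ x ∈ Y, ∀ y ∈ Y, ∀ w ∈ Y, ∃ z ∈ Y,
    CloseUpTo n τ z x ∧ CloseUpTo k τ (shiftSeq^[n + L] z) y ∧
      CloseUpTo l τ (shiftSeq^[n + L + k + L] z) w

/-- `E` is a finite `(n,s)`-separated subset of `Y`. -/
def IsSepIn (Y : Set (ℕ → X)) (n : ℕ) (s : ℝ) (E : Finset (ℕ → X)) : Prop :=
  ↑E ⊆ Y ∧ ∀ x ∈ E, ∀ y ∈ E, CloseUpTo n s x y → x = y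

/-- `E` is a finite `(n,s)`-spanning subset of `Y`. -/
def IsSpanIn (Y : Set (ℕ → X)) (n : ℕ) (s : ℝ) (E : Finset (ℕ → X)) : Prop :=
  ↑E ⊆ Y ∧ ∀ y ∈ Y, ∃ x ∈ E, CloseUpTo n s x y

/-- Gluing three orbit segments, with control of the Birkhoff sums. -/
theorem SpecSystem.exists_glue_map {Y : Set (ℕ → X)} {f : X × X → ℝ} {ε : ℝ}
    (h : SpecSystem Y f ε) {τ : ℝ} (hτ : 0 < τ) (hτε : τ ≤ ε) :
    ∃ (L : ℕ) (K : ℝ), 0 < K ∧ ∀ n k l, ∀ x ∈ Y, ∀ y ∈ Y, ∀ w ∈ Y, ∃ z ∈ Y,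
      CloseUpTo n τ z x ∧ CloseUpTo k τ (shiftSeq^[n + L] z) y ∧
      CloseUpTo l τ (shiftSeq^[n + L + k + L] z) w ∧
      ∀ e ∈ Y, CloseUpTo (n + L + k + L + l) (ε / 2) e z →
        Real.exp (seqSum f n x) * Real.exp (seqSum f k y) * Real.exp (seqSum f l w)
          ≤ K * Real.exp (seqSum f (n + L + k + L + l) e) := by
  obtain ⟨L, hL⟩ := h.glue τ hτ
  obtain ⟨B, hB⟩ := h.bounded
  obtain ⟨C, hC⟩ := h.distortion
  have hε := h.pos
  refine ⟨L, Real.exp (4 * C + 2 * L * B), by positivity, fun n k l x hx y hy w hw => ?_⟩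
  obtain ⟨z, hz, h1, h2, h3⟩ := hL n k l x hx y hy w hw
  refine ⟨z, hz, h1, h2, h3, fun e he hez => ?_⟩
  have e1 := hC n z hz x hx (h1.mono hτε)
  have e2 := hC k _ (shift_iterate_mem h.shift_mem _ hz) y hy (h2.mono hτε)
  have e3 := hC l _ (shift_iterate_mem h.shift_mem _ hz) w hw (h3.mono hτε)
  have e4 := hC _ e he z hz (hez.mono (by linarith))
  have e5 := abs_seqSum_le hB L (shiftSeq^[n] z)
  have e6 := abs_seqSum_le hB L (shiftSeq^[n + L + k] z)
  rw [← Real.exp_add, ← Real.exp_add, ← Real.exp_add, Real.exp_le_exp]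
  have e7 := seqSum_add f (n + L + k + L) l z
  have e8 := seqSum_add f (n + L + k) L z
  have e9 := seqSum_add f (n + L) k z
  have e10 := seqSum_add f n L z
  rw [abs_le] at e1 e2 e3 e4 e5 e6
  linarith

variable [CompactSpace X]

theorem exists_finite_code (X : Type*) [MetricSpace X] [CompactSpace X] {s : ℝ} (hs : 0 < s) :
    ∃ (K : ℕ) (c : X → Fin K), ∀ x y, c x = c y → dist x y < s := by
  obtain ⟨t, ht, hcov⟩ := Metric.totallyBounded_iff.1 (isCompact_univ (X := X)).totallyBounded
    (s / 2) (half_pos hs)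
  have := ht.fintype
  have h : ∀ x : X, ∃ y : t, dist x y < s / 2 := by
    intro x
    have := hcov (mem_univ x)
    simp only [mem_iUnion] at this
    obtain ⟨y, hy, hxy⟩ := this
    exact ⟨⟨y, hy⟩, hxy⟩
  choose c hc using h
  refine ⟨Fintype.card t, fun x => Fintype.equivFin t (c x), fun x y hxy => ?_⟩
  have h1 := (Fintype.equivFin t).injective hxy
  have h2 := hc x
  have h3 := hc y
  rw [← h1] at h3
  have := dist_triangle_right x y (c x : X)
  linarith

namespace SpecSystem

variable {Y : Set (ℕ → X)} {f : X × X → ℝ} {ε : ℝ}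

theorem exists_uniform_expansive (h : SpecSystem Y f ε) {s : ℝ} (hs : 0 < s) :
    ∃ N : ℕ, ∀ x ∈ Y, ∀ y ∈ Y, (∀ i ≤ N, dist (x i) (y i) ≤ ε) → dist (x 0) (y 0) < s := by
  by_contra! hcon
  set D : ℕ → Set ((ℕ → X) × (ℕ → X)) := fun R =>
    ((Y ×ˢ Y) ∩ {p | s ≤ dist (p.1 0) (p.2 0)}) ∩
      ⋂ i : Fin (R + 1), {p | dist (p.1 i) (p.2 i) ≤ ε} with hD
  have hDc : ∀ R, IsClosed (D R) := fun R =>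
    ((h.isClosed.prod h.isClosed).inter (isClosed_le continuous_const (by fun_prop))).inter
      (isClosed_iInter fun i => isClosed_le (by fun_prop) continuous_const)
  have hne : (⋂ R, D R).Nonempty := by
    refine IsCompact.nonempty_iInter_of_sequence_nonempty_isCompact_isClosed D ?_ ?_
      (hDc 0).isCompact hDc
    · intro R p hp
      refine ⟨hp.1, ?_⟩
      have := hp.2
      simp only [mem_iInter] at this ⊢
      exact fun i => this ⟨i, by omega⟩
    · intro R
      obtain ⟨x, hx, y, hy, hxy, hs⟩ := hcon R
      refine ⟨(x, y), ⟨⟨hx, hy⟩, hs⟩, ?_⟩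
      simp only [mem_iInter]
      exact fun i => hxy i (by omega)
  obtain ⟨p, hp⟩ := hne
  rw [mem_iInter] at hp
  have hp0 := (hp 0).1
  have heq : p.1 = p.2 := by
    refine h.expansive _ hp0.1.1 _ hp0.1.2 fun i => ?_
    have := (hp i).2
    simp only [mem_iInter] at this
    exact this ⟨i, by omega⟩
  have h2 : s ≤ dist (p.1 0) (p.2 0) := hp0.2
  rw [heq, dist_self] at h2
  linarith

/-- Separated sets inside a Bowen ball of radius `ε` have bounded cardinality. -/
theorem exists_card_le (h : SpecSystem Y f ε) {s : ℝ} (hs : 0 < s) :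
    ∃ K : ℕ, ∀ n, ∀ E, IsSepIn Y n s E →
      (∀ x ∈ E, ∀ y ∈ E, ∀ i ≤ n, dist (x i) (y i) ≤ ε) → E.card ≤ K := by
  obtain ⟨N, hN⟩ := h.exists_uniform_expansive hs
  obtain ⟨K, c, hc⟩ := exists_finite_code X hs
  refine ⟨Fintype.card (Fin N → Fin K), fun n E hE hclose => ?_⟩
  refine Finset.card_le_card_of_injOn (t := Finset.univ)
    (fun x (j : Fin N) => c (x (n - j))) (fun _ _ => Finset.mem_univ _) ?_
  intro x hx y hy hxy
  refine hE.2 x hx y hy fun i hi => ?_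
  by_cases hiN : i + N ≤ n
  · have := hN _ (shift_iterate_mem h.shift_mem i (hE.1 hx)) _
      (shift_iterate_mem h.shift_mem i (hE.1 hy)) (fun j hj => by
        rw [shiftSeq_iterate, shiftSeq_iterate]
        exact hclose x hx y hy _ (by omega))
    simpa [shiftSeq_iterate] using this
  · have h1 := congrFun hxy ⟨n - i, by omega⟩
    simp only [show n - (n - i) = i by omega] at h1
    exact hc _ _ h1

theorem exists_maximal_sep (hne : Y.Nonempty) (n : ℕ) {s : ℝ} (hs : 0 < s) :
    ∃ E, IsSepIn Y n s E ∧ IsSpanIn Y n s E ∧ E.Nonempty := by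
  obtain ⟨K, c, hc⟩ := exists_finite_code X hs
  have hcard : ∀ E, IsSepIn Y n s E → E.card ≤ Fintype.card (Fin (n + 1) → Fin K) := by
    intro E hE
    refine Finset.card_le_card_of_injOn (t := Finset.univ)
      (fun x (j : Fin (n + 1)) => c (x j)) (fun _ _ => Finset.mem_univ _) ?_
    intro x hx y hy hxy
    exact hE.2 x hx y hy fun i hi => hc _ _ (congrFun hxy ⟨i, by omega⟩)
  have hex : ∃ m, ∃ E, IsSepIn Y n s E ∧ E.card = m := ⟨0, ∅, by simp [IsSepIn], rfl⟩
  have hfind := Nat.findGreatest_spec (P := fun m => ∃ E, IsSepIn Y n s E ∧ E.card = m)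
    (n := Fintype.card (Fin (n + 1) → Fin K)) (Nat.zero_le _) ⟨∅, by simp [IsSepIn], rfl⟩
  obtain ⟨E, hE, hEc⟩ := hfind
  have hspan : IsSpanIn Y n s E := by
    refine ⟨hE.1, fun y hy => ?_⟩
    by_contra! hcon
    have hyE : y ∉ E := fun hyE => hcon y hyE (.refl n hs y)
    have hins : IsSepIn Y n s (insert y E) := by
      refine ⟨by rw [Finset.coe_insert]; exact Set.insert_subset hy hE.1, ?_⟩
      intro a ha b hb hab
      rw [Finset.mem_insert] at ha hb
      rcases ha with rfl | ha <;> rcases hb with rfl | hb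
      · rfl
      · exact absurd hab.symm (hcon b hb)
      · exact absurd hab (hcon a ha)
      · exact hE.2 a ha b hb hab
    have h1 := Nat.le_findGreatest (P := fun m => ∃ E, IsSepIn Y n s E ∧ E.card = m)
      (hcard _ hins) ⟨_, hins, rfl⟩
    rw [← hEc, Finset.card_insert_of_notMem hyE] at h1
    omega
  obtain ⟨y, hy⟩ := hne
  obtain ⟨x, hx, -⟩ := hspan.2 y hy
  exact ⟨E, hE, hspan, x, hx⟩

/-- A maximal `(n,ε/2)`-separated set. -/
noncomputable def base (h : SpecSystem Y f ε) (n : ℕ) : Finset (ℕ → X) :=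
  (exists_maximal_sep h.nonempty n (half_pos h.pos)).choose

theorem base_sep (h : SpecSystem Y f ε) (n : ℕ) : IsSepIn Y n (ε / 2) (h.base n) :=
  (exists_maximal_sep h.nonempty n (half_pos h.pos)).choose_spec.1

theorem base_span (h : SpecSystem Y f ε) (n : ℕ) : IsSpanIn Y n (ε / 2) (h.base n) :=
  (exists_maximal_sep h.nonempty n (half_pos h.pos)).choose_spec.2.1

/-- The partition function at scale `ε/2`. -/
noncomputable def pf (h : SpecSystem Y f ε) (n : ℕ) : ℝ := expSum f n (h.base n)

theorem pf_pos (h : SpecSystem Y f ε) (n : ℕ) : 0 < h.pf n :=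
  expSum_pos f n (exists_maximal_sep h.nonempty n (half_pos h.pos)).choose_spec.2.2

theorem exists_expSum_split_le (h : SpecSystem Y f ε) {s : ℝ} (hs : 0 < s) :
    ∃ K : ℝ, 0 < K ∧ ∀ j n k, ∀ E F : Finset (ℕ → X), IsSepIn Y (j + n + k) s E → ↑F ⊆ Y →
      (∀ e ∈ E, ∃ x ∈ F, CloseUpTo n (ε / 2) x (shiftSeq^[j] e)) →
      expSum f (j + n + k) E ≤ K * (h.pf j * expSum f n F * h.pf k) := by
  obtain ⟨K, hK⟩ := h.exists_card_le hs
  obtain ⟨C, hC⟩ := h.distortion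
  refine ⟨(K + 1) * Real.exp (3 * C), by positivity, fun j n k E F hE hF hEF => ?_⟩
  have hε := h.pos
  have hmem : ∀ e ∈ E, ∀ i, shiftSeq^[i] e ∈ Y := fun e he i =>
    shift_iterate_mem h.shift_mem i (hE.1 he)
  have hg : ∀ e, ∃ p : (ℕ → X) × (ℕ → X) × (ℕ → X), e ∈ E →
      p ∈ h.base j ×ˢ F ×ˢ h.base k ∧ CloseUpTo j (ε / 2) p.1 e ∧
      CloseUpTo n (ε / 2) p.2.1 (shiftSeq^[j] e) ∧
      CloseUpTo k (ε / 2) p.2.2 (shiftSeq^[j + n] e) := by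
    intro e
    by_cases he : e ∈ E
    · obtain ⟨a, ha, ha'⟩ := (h.base_span j).2 e (hE.1 he)
      obtain ⟨b, hb, hb'⟩ := hEF e he
      obtain ⟨c, hc, hc'⟩ := (h.base_span k).2 _ (hmem e he (j + n))
      exact ⟨(a, b, c), fun _ => ⟨by simp [ha, hb, hc], ha', hb', hc'⟩⟩
    · exact ⟨(e, e, e), fun h => absurd h he⟩
  choose g hg using hg
  have key := sum_le_mul_sum_of_card_fiber_le (E := E) (F := h.base j ×ˢ F ×ˢ h.base k)
    (K := K) g (fun e he => (hg e he).1) ?_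
    (a := fun e => Real.exp (seqSum f (j + n + k) e))
    (b := fun p => Real.exp (3 * C) *
      (Real.exp (seqSum f j p.1) * (Real.exp (seqSum f n p.2.1) * Real.exp (seqSum f k p.2.2))))
    (fun p => by positivity) ?_
  · refine key.trans ?_
    rw [← Finset.mul_sum, Finset.sum_product]
    simp only [Finset.sum_product, ← Finset.mul_sum, ← Finset.sum_mul]
    have h0 : 0 ≤ Real.exp (3 * C) * (h.pf j * (expSum f n F * h.pf k)) :=
      mul_nonneg (Real.exp_pos _).le (mul_nonneg (h.pf_pos j).le
        (mul_nonneg (expSum_nonneg _ _ _) (h.pf_pos k).le))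
    calc (K : ℝ) * (Real.exp (3 * C) * (h.pf j * (expSum f n F * h.pf k)))
        ≤ (K + 1) * (Real.exp (3 * C) * (h.pf j * (expSum f n F * h.pf k))) :=
          mul_le_mul_of_nonneg_right (by linarith) h0
      _ = _ := by ring
  · intro p hp
    refine hK (j + n + k) _ ⟨fun e he => hE.1 (Finset.mem_filter.1 he).1, fun x hx y hy hxy =>
      hE.2 x (Finset.mem_filter.1 hx).1 y (Finset.mem_filter.1 hy).1 hxy⟩ ?_
    intro x hx y hy i hi
    rw [Finset.mem_filter] at hx hy
    obtain ⟨-, hx1, hx2, hx3⟩ := hg x hx.1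
    obtain ⟨-, hy1, hy2, hy3⟩ := hg y hy.1
    rw [hx.2] at hx1 hx2 hx3
    rw [hy.2] at hy1 hy2 hy3
    rcases le_or_gt i j with hij | hij
    · have := (hx1.symm.trans hy1) i hij
      linarith
    rcases le_or_gt i (j + n) with hij2 | hij2
    · have := (hx2.symm.trans hy2) (i - j) (by omega)
      simp only [shiftSeq_iterate, Nat.sub_add_cancel hij.le] at this
      linarith
    · have := (hx3.symm.trans hy3) (i - (j + n)) (by omega)
      simp only [shiftSeq_iterate, Nat.sub_add_cancel hij2.le] at this
      linarith
  · intro e he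
    obtain ⟨hp, h1, h2, h3⟩ := hg e he
    simp only [Finset.mem_product] at hp
    have e1 := hC j _ ((h.base_sep j).1 hp.1) e (hE.1 he) (h1.mono (by linarith))
    have e2 := hC n _ (hF hp.2.1) _ (hmem e he j) (h2.mono (by linarith))
    have e3 := hC k _ ((h.base_sep k).1 hp.2.2) _ (hmem e he (j + n)) (h3.mono (by linarith))
    rw [abs_le] at e1 e2 e3
    rw [seqSum_add, seqSum_add, ← Real.exp_add, ← Real.exp_add, ← Real.exp_add,
      Real.exp_le_exp]
    linarith

theorem exists_expSum_le_span (h : SpecSystem Y f ε) {s : ℝ} (hs : 0 < s) :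
    ∃ K : ℝ, 0 < K ∧ ∀ n, ∀ E F, IsSepIn Y n s E → IsSpanIn Y n (ε / 2) F →
      expSum f n E ≤ K * expSum f n F := by
  obtain ⟨K, hK0, hK⟩ := h.exists_expSum_split_le hs
  have hp := h.pf_pos 0
  refine ⟨K * (h.pf 0 * h.pf 0), by positivity, fun n E F hE hF => ?_⟩
  have := hK 0 n 0 E F (by simpa using hE) hF.1 (fun e he => by simpa using hF.2 e (hE.1 he))
  simp only [zero_add, add_zero] at this
  linarith

theorem exists_pf_mul_le (h : SpecSystem Y f ε) :
    ∃ K : ℝ, 0 < K ∧ ∀ n k, h.pf n * h.pf k ≤ K * h.pf (n + k) := by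
  have hε := h.pos
  obtain ⟨L, K, hK0, hK⟩ := h.exists_glue_map (τ := ε / 8) (by positivity) (by linarith)
  obtain ⟨K1, hK10, hK1⟩ := h.exists_expSum_le_span (s := ε / 4) (by positivity)
  obtain ⟨K2, hK20, hK2⟩ := h.exists_expSum_split_le (s := ε / 2) (by positivity)
  obtain ⟨y0, hy0⟩ := h.nonempty
  have p0 := h.pf_pos 0
  have pL := h.pf_pos (L + L)
  refine ⟨K * K1 * K2 * h.pf 0 * h.pf (L + L), by positivity, fun n k => ?_⟩
  have hz : ∀ p : (ℕ → X) × (ℕ → X), ∃ z, p.1 ∈ Y → p.2 ∈ Y → z ∈ Y ∧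
      CloseUpTo n (ε / 8) z p.1 ∧ CloseUpTo k (ε / 8) (shiftSeq^[n + L] z) p.2 ∧
      Real.exp (seqSum f n p.1) * Real.exp (seqSum f k p.2)
          ≤ K * Real.exp (seqSum f (n + L + k + L) z) := by
    intro p
    by_cases hp : p.1 ∈ Y ∧ p.2 ∈ Y
    · obtain ⟨z, hz, h1, h2, -, h4⟩ := hK n k 0 p.1 hp.1 p.2 hp.2 y0 hy0
      refine ⟨z, fun _ _ => ⟨hz, h1, h2, ?_⟩⟩
      have := h4 z hz (.refl _ (half_pos hε) z)
      simpa [seqSum] using this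
    · exact ⟨y0, fun h1 h2 => absurd ⟨h1, h2⟩ hp⟩
  choose z hz using hz
  set E := (h.base n ×ˢ h.base k).image z with hE
  have hmem : ∀ p ∈ h.base n ×ˢ h.base k, p.1 ∈ Y ∧ p.2 ∈ Y := fun p hp => by
    rw [Finset.mem_product] at hp
    exact ⟨(h.base_sep n).1 hp.1, (h.base_sep k).1 hp.2⟩
  have hinj : ∀ p ∈ h.base n ×ˢ h.base k, ∀ q ∈ h.base n ×ˢ h.base k,
      CloseUpTo (n + L + k + L) (ε / 4) (z p) (z q) → p = q := by
    intro p hp q hq hpq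
    obtain ⟨-, p1, p2, -⟩ := hz p (hmem p hp).1 (hmem p hp).2
    obtain ⟨-, q1, q2, -⟩ := hz q (hmem q hq).1 (hmem q hq).2
    rw [Finset.mem_product] at hp hq
    refine Prod.ext ((h.base_sep n).2 _ hp.1 _ hq.1 fun i hi => ?_)
      ((h.base_sep k).2 _ hp.2 _ hq.2 fun i hi => ?_)
    · have e1 := dist_triangle4 (p.1 i) (z p i) (z q i) (q.1 i)
      have e2 := p1 i hi
      have e3 := q1 i hi
      have e4 := hpq i (by omega)
      rw [dist_comm] at e2
      linarith
    · have e1 := dist_triangle4 (p.2 i) (z p (i + (n + L))) (z q (i + (n + L))) (q.2 i)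
      have e2 := p2 i hi
      have e3 := q2 i hi
      have e4 := hpq (i + (n + L)) (by omega)
      rw [shiftSeq_iterate] at e2 e3
      rw [dist_comm] at e2
      linarith
  have hEsep : IsSepIn Y (n + L + k + L) (ε / 4) E := by
    refine ⟨fun a ha => ?_, fun a ha b hb hab => ?_⟩
    · obtain ⟨p, hp, rfl⟩ := Finset.mem_image.1 (Finset.mem_coe.1 ha)
      exact (hz p (hmem p hp).1 (hmem p hp).2).1
    · obtain ⟨p, hp, rfl⟩ := Finset.mem_image.1 ha
      obtain ⟨q, hq, rfl⟩ := Finset.mem_image.1 hb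
      rw [hinj p hp q hq hab]
  have hzinj : Set.InjOn z (h.base n ×ˢ h.base k : Finset _) := fun p hp q hq hpq =>
    hinj p hp q hq (by rw [hpq]; exact .refl _ (by positivity) _)
  have h1 : h.pf n * h.pf k ≤ K * expSum f (n + L + k + L) E := by
    rw [expSum, hE, Finset.sum_image hzinj, Finset.mul_sum, pf, pf, expSum, expSum,
      Finset.sum_mul_sum, ← Finset.sum_product']
    exact Finset.sum_le_sum fun p hp => (hz p (hmem p hp).1 (hmem p hp).2).2.2.2
  have h2 := hK1 _ _ _ hEsep (h.base_span _)
  have h3 := hK2 0 (n + k) (L + L) (h.base (n + L + k + L)) (h.base (n + k))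
    (by rw [show 0 + (n + k) + (L + L) = n + L + k + L by omega]; exact h.base_sep _)
    (h.base_sep _).1 (fun e he => (h.base_span _).2 _ ((h.base_sep _).1 he))
  rw [show 0 + (n + k) + (L + L) = n + L + k + L by omega] at h3
  calc h.pf n * h.pf k ≤ K * expSum f (n + L + k + L) E := h1
    _ ≤ K * (K1 * (K2 * (h.pf 0 * h.pf (n + k) * h.pf (L + L)))) := by
        gcongr
        exact h2.trans (by gcongr; exact h3)
    _ = _ := by ring

theorem exists_pf_add_le (h : SpecSystem Y f ε) :
    ∃ K : ℝ, 0 < K ∧ ∀ n k, h.pf (n + k) ≤ K * (h.pf n * h.pf k) := by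
  have hε := h.pos
  obtain ⟨K, hK0, hK⟩ := h.exists_expSum_split_le (s := ε / 2) (by positivity)
  have p0 := h.pf_pos 0
  refine ⟨K * h.pf 0, by positivity, fun n k => ?_⟩
  have := hK 0 n k (h.base (n + k)) (h.base n)
    (by rw [zero_add]; exact h.base_sep _)
    (h.base_sep _).1 (fun e he => (h.base_span _).2 _ ((h.base_sep _).1 he))
  rw [zero_add] at this
  calc h.pf (n + k) ≤ K * (h.pf 0 * h.pf n * h.pf k) := this
    _ = _ := by ring

theorem exists_count (h : SpecSystem Y f ε) :
    ∃ P : ℝ, ∃ K : ℝ, 0 < K ∧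
      ∀ n : ℕ, Real.exp (n * P) ≤ K * h.pf n ∧ h.pf n ≤ K * Real.exp (n * P) := by
  obtain ⟨K, hK, h1⟩ := h.exists_pf_add_le
  obtain ⟨K', hK', h2⟩ := h.exists_pf_mul_le
  obtain ⟨P, hP⟩ := exists_rate_of_quasi_multiplicative h.pf_pos hK hK' h1 h2
  refine ⟨P, max K K', lt_max_of_lt_left hK, fun n => ⟨?_, ?_⟩⟩
  · exact (hP n).1.trans (mul_le_mul_of_nonneg_right (le_max_left _ _) (h.pf_pos n).le)
  · exact (hP n).2.trans (mul_le_mul_of_nonneg_right (le_max_right _ _) (Real.exp_pos _).le)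

/-- The exponential growth rate of the partition functions. -/
noncomputable def rate (h : SpecSystem Y f ε) : ℝ := h.exists_count.choose

theorem exists_pf_bounds (h : SpecSystem Y f ε) :
    ∃ K : ℝ, 0 < K ∧
      ∀ n : ℕ, Real.exp (n * h.rate) ≤ K * h.pf n ∧ h.pf n ≤ K * Real.exp (n * h.rate) :=
  h.exists_count.choose_spec

theorem exists_sep_le (h : SpecSystem Y f ε) {s : ℝ} (hs : 0 < s) :
    ∃ K : ℝ, 0 < K ∧ ∀ n E, IsSepIn Y n s E → expSum f n E ≤ K * Real.exp (n * h.rate) := by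
  obtain ⟨K, hK, h1⟩ := h.exists_pf_bounds
  obtain ⟨K', hK', h2⟩ := h.exists_expSum_le_span hs
  refine ⟨K' * K, by positivity, fun n E hE => (h2 n E _ hE (h.base_span n)).trans ?_⟩
  rw [mul_assoc]
  exact mul_le_mul_of_nonneg_left (h1 n).2 hK'.le

theorem exists_le_span (h : SpecSystem Y f ε) :
    ∃ K : ℝ, 0 < K ∧ ∀ n E, IsSpanIn Y n (ε / 2) E → Real.exp (n * h.rate) ≤ K * expSum f n E := by
  obtain ⟨K, hK, h1⟩ := h.exists_pf_bounds
  obtain ⟨K', hK', h2⟩ := h.exists_expSum_le_span (half_pos h.pos)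
  refine ⟨K * K', by positivity, fun n E hE => (h1 n).1.trans ?_⟩
  rw [mul_assoc]
  exact mul_le_mul_of_nonneg_left (h2 n _ E (h.base_sep n) hE) hK.le

end SpecSystem

end Counting

section WeakLimit

variable {Ω : Type*} [TopologicalSpace Ω] [MeasurableSpace Ω] [BorelSpace Ω]

/-- Sequences of probability measures on a compact space converge along some ultrafilter. -/
theorem exists_ultrafilter_tendsto [T2Space Ω] [CompactSpace Ω]
    (m : ℕ → ProbabilityMeasure Ω) :
    ∃ (𝒰 : Ultrafilter ℕ) (μ : ProbabilityMeasure Ω), (𝒰 : Filter ℕ) ≤ atTop ∧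
      Tendsto m 𝒰 (𝓝 μ) := by
  obtain ⟨μ, -, hμ⟩ := isCompact_univ.ultrafilter_le_nhds ((hyperfilter ℕ).map m) (by simp)
  exact ⟨hyperfilter ℕ, μ, Nat.hyperfilter_le_atTop, hμ⟩

variable [HasOuterApproxClosed Ω] {m : ℕ → ProbabilityMeasure Ω} {μ : ProbabilityMeasure Ω}
  {l : Filter ℕ} [NeBot l]

theorem le_measure_closed_of_tendsto (hm : Tendsto m l (𝓝 μ)) {F : Set Ω} (hF : IsClosed F)
    {c : ℝ≥0∞} (hc : ∀ᶠ N in l, c ≤ (m N : Measure Ω) F) : c ≤ (μ : Measure Ω) F :=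
  (le_limsup_of_frequently_le hc.frequently).trans
    (ProbabilityMeasure.limsup_measure_closed_le_of_tendsto hm hF)

theorem measure_open_le_of_tendsto (hm : Tendsto m l (𝓝 μ)) {U : Set Ω} (hU : IsOpen U)
    {c : ℝ≥0∞} (hc : ∀ᶠ N in l, (m N : Measure Ω) U ≤ c) : (μ : Measure Ω) U ≤ c :=
  (ProbabilityMeasure.le_liminf_measure_open_of_tendsto hm hU).trans
    (liminf_le_of_frequently_le hc.frequently)

end WeakLimit

section Gibbs

variable {X : Type*} [MetricSpace X]

theorem isOpen_closeUpTo (n j : ℕ) (s : ℝ) (x : ℕ → X) :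
    IsOpen {y : ℕ → X | CloseUpTo n s x (shiftSeq^[j] y)} := by
  have : {y : ℕ → X | CloseUpTo n s x (shiftSeq^[j] y)}
      = ⋂ i : Fin (n + 1), {y | dist (x i) (y (i + j)) < s} := by
    ext y
    simp only [CloseUpTo, shiftSeq_iterate, mem_ofPred_eq, mem_iInter]
    exact ⟨fun h i => h i (by omega), fun h i hi => h ⟨i, by omega⟩⟩
  rw [this]
  exact isOpen_iInter_of_finite fun i => isOpen_lt (by fun_prop) continuous_const

/-- Two-block closed Bowen balls. -/
def twoBlock (n L k : ℕ) (s : ℝ) (x y : ℕ → X) : Set (ℕ → X) :=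
  {z | (∀ i ≤ n, dist (x i) (z i) ≤ s) ∧ ∀ i ≤ k, dist (y i) ((shiftSeq^[n + L] z) i) ≤ s}

theorem isClosed_twoBlock (n L k : ℕ) (s : ℝ) (x y : ℕ → X) :
    IsClosed (twoBlock n L k s x y) := by
  have : twoBlock n L k s x y = (⋂ i : Fin (n + 1), {z | dist (x i) (z i) ≤ s}) ∩
      ⋂ i : Fin (k + 1), {z | dist (y i) (z (i + (n + L))) ≤ s} := by
    ext z
    simp only [twoBlock, shiftSeq_iterate, mem_ofPred_eq, mem_inter_iff, mem_iInter]
    exact ⟨fun h => ⟨fun i => h.1 i (by omega), fun i => h.2 i (by omega)⟩,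
      fun h => ⟨fun i hi => h.1 ⟨i, by omega⟩, fun i hi => h.2 ⟨i, by omega⟩⟩⟩
  rw [this]
  exact (isClosed_iInter fun i => isClosed_le (by fun_prop) continuous_const).inter
    (isClosed_iInter fun i => isClosed_le (by fun_prop) continuous_const)

variable [MeasurableSpace X]

/-- The normalized weighted counting measure on a finite set of sequences. -/
noncomputable def weightedCount (f : X × X → ℝ) (n : ℕ) (E : Finset (ℕ → X)) :
    Measure (ℕ → X) :=
  ∑ e ∈ E, ENNReal.ofReal (Real.exp (seqSum f n e) / expSum f n E) • Measure.dirac e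

theorem weightedCount_apply (f : X × X → ℝ) (n : ℕ) (E : Finset (ℕ → X)) {A : Set (ℕ → X)}
    [DecidablePred (· ∈ A)] (hA : MeasurableSet A) :
    weightedCount f n E A = ENNReal.ofReal (expSum f n (E.filter (· ∈ A)) / expSum f n E) := by
  have h1 : expSum f n (E.filter (· ∈ A)) = ∑ e ∈ E.filter (· ∈ A), Real.exp (seqSum f n e) := rfl
  rw [weightedCount, Measure.finsetSum_apply, h1, Finset.sum_div,
    ENNReal.ofReal_sum_of_nonneg fun _ _ => div_nonneg (Real.exp_pos _).le (expSum_nonneg f n E),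
    Finset.sum_filter]
  refine Finset.sum_congr rfl fun e _ => ?_
  by_cases he : e ∈ A <;> simp [Measure.dirac_apply' _ hA, he]

theorem isProbabilityMeasure_weightedCount (f : X × X → ℝ) (n : ℕ) {E : Finset (ℕ → X)}
    (hE : E.Nonempty) : IsProbabilityMeasure (weightedCount f n E) := by
  constructor
  rw [weightedCount_apply f n E MeasurableSet.univ]
  simp [div_self (expSum_pos f n hE).ne']

variable [CompactSpace X] [BorelSpace X] {Y : Set (ℕ → X)} {f : X × X → ℝ} {ε : ℝ}

namespace SpecSystem

/-- Existence of a measure with the upper Gibbs bound at all times and a two-block lower Gibbs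
bound. -/
theorem exists_gibbs (h : SpecSystem Y f ε) :
    ∃ m : Measure (ℕ → X), IsProbabilityMeasure m ∧ m Yᶜ = 0 ∧
      (∃ K : ℝ, 0 < K ∧ ∀ j n, ∀ x ∈ Y, m {y | CloseUpTo n (ε / 2) x (shiftSeq^[j] y)}
        ≤ ENNReal.ofReal (K * Real.exp (seqSum f n x - n * h.rate))) ∧
      ∃ (L : ℕ) (K : ℝ), 0 < K ∧ ∀ n k, ∀ x ∈ Y, ∀ y ∈ Y,
        ENNReal.ofReal (K * (Real.exp (seqSum f n x - n * h.rate) *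
          Real.exp (seqSum f k y - k * h.rate))) ≤ m (twoBlock n L k (ε / 8) x y) := by
  have hε := h.pos
  have hE : ∀ n, ∃ E, IsSepIn Y n (ε / 16) E ∧ IsSpanIn Y n (ε / 16) E ∧ E.Nonempty :=
    fun n => exists_maximal_sep h.nonempty n (by positivity)
  choose E hEsep hEspan hEne using hE
  have hspan2 : ∀ n, IsSpanIn Y n (ε / 2) (E n) := fun n => ⟨(hEspan n).1, fun y hy => by
    obtain ⟨x, hx, hxy⟩ := (hEspan n).2 y hy
    exact ⟨x, hx, hxy.mono (by linarith)⟩⟩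
  obtain ⟨K1, hK1, hlow⟩ := h.exists_le_span
  obtain ⟨K2, hK2, hup⟩ := h.exists_sep_le (s := ε / 16) (by positivity)
  obtain ⟨K3, hK3, hpf⟩ := h.exists_pf_bounds
  obtain ⟨K4, hK4, hsplit⟩ := h.exists_expSum_split_le (s := ε / 16) (by positivity)
  obtain ⟨L, K5, hK5, hglue⟩ := h.exists_glue_map (τ := ε / 32) (by positivity) (by linarith)
  set mm : ℕ → ProbabilityMeasure (ℕ → X) := fun n =>
    ⟨weightedCount f n (E n), isProbabilityMeasure_weightedCount f n (hEne n)⟩ with hmm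
  obtain ⟨𝒰, m, h𝒰, hm⟩ := exists_ultrafilter_tendsto mm
  refine ⟨m, inferInstance, ?_, ⟨K1 * (K4 * (K3 * K3)), by positivity, ?_⟩, L,
    (K5 * K1 * K2 * Real.exp (2 * L * h.rate))⁻¹, by positivity, ?_⟩
  · refine le_antisymm (measure_open_le_of_tendsto hm h.isClosed.isOpen_compl
      (Eventually.of_forall fun N => ?_)) zero_le
    rw [hmm]
    simp only [ProbabilityMeasure.coe_mk]
    rw [weightedCount_apply _ _ _ h.isClosed.measurableSet.compl, Finset.filter_false_of_mem]
    · simp [expSum]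
    · intro x hx
      simpa using (hEsep N).1 hx
  · intro j n x hx
    have ho := isOpen_closeUpTo n j (ε / 2) x
    refine measure_open_le_of_tendsto hm ho
      (h𝒰 ((eventually_ge_atTop (j + n)).mono fun N hN => ?_))
    rw [hmm]
    simp only [ProbabilityMeasure.coe_mk]
    rw [weightedCount_apply _ _ _ ho.measurableSet]
    refine ENNReal.ofReal_le_ofReal ?_
    rw [div_le_iff₀ (expSum_pos f N (hEne N))]
    obtain ⟨k, rfl⟩ := Nat.exists_eq_add_of_le hN
    have h1 := hsplit j n k ((E (j + n + k)).filter
      (· ∈ {y : ℕ → X | CloseUpTo n (ε / 2) x (shiftSeq^[j] y)})) {x}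
      ⟨fun e he => (hEsep _).1 (Finset.mem_filter.1 he).1, fun a ha b hb =>
        (hEsep _).2 a (Finset.mem_filter.1 ha).1 b (Finset.mem_filter.1 hb).1⟩
      (by simpa using hx) (fun e he => ⟨x, by simp, (Finset.mem_filter.1 he).2⟩)
    have h2 := (hpf j).2
    have h3 := (hpf k).2
    have h4 := hlow _ _ (hspan2 (j + n + k))
    have h5 : expSum f n {x} = Real.exp (seqSum f n x) := by simp [expSum]
    rw [h5] at h1
    have e1 : Real.exp (((j + n + k : ℕ) : ℝ) * h.rate)
        = Real.exp (j * h.rate) * Real.exp (n * h.rate) * Real.exp (k * h.rate) := by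
      rw [← Real.exp_add, ← Real.exp_add]
      congr 1
      push_cast
      ring
    have pj := h.pf_pos j
    have pk := h.pf_pos k
    calc _ ≤ _ := h1
      _ ≤ K4 * (K3 * Real.exp (j * h.rate) * Real.exp (seqSum f n x)
          * (K3 * Real.exp (k * h.rate))) := by gcongr
      _ = (K4 * (K3 * K3)) * Real.exp (seqSum f n x - n * h.rate) *
          Real.exp (((j + n + k : ℕ) : ℝ) * h.rate) := by
          rw [e1, Real.exp_sub]
          field_simp
      _ ≤ (K4 * (K3 * K3)) * Real.exp (seqSum f n x - n * h.rate) *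
          (K1 * expSum f (j + n + k) (E (j + n + k))) := by gcongr
      _ = _ := by ring
  · intro n k x hx y hy
    have hc := isClosed_twoBlock n L k (ε / 8) x y
    refine le_measure_closed_of_tendsto hm hc
      (h𝒰 ((eventually_ge_atTop (n + L + k + L)).mono fun N hN => ?_))
    rw [hmm]
    simp only [ProbabilityMeasure.coe_mk]
    rw [weightedCount_apply _ _ _ hc.measurableSet]
    refine ENNReal.ofReal_le_ofReal ?_
    rw [le_div_iff₀ (expSum_pos f N (hEne N))]
    obtain ⟨l, rfl⟩ := Nat.exists_eq_add_of_le hN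
    obtain ⟨F, hFsep, hFspan, -⟩ := exists_maximal_sep h.nonempty l (s := 3 * (ε / 16))
      (by positivity)
    have hF2 : IsSpanIn Y l (ε / 2) F := ⟨hFspan.1, fun y hy => by
      obtain ⟨x, hx, hxy⟩ := hFspan.2 y hy
      exact ⟨x, hx, hxy.mono (by linarith)⟩⟩
    have hFl := hlow l F hF2
    set N := n + L + k + L + l with hNdef
    have hw : ∀ w, ∃ e, w ∈ F → e ∈ E N ∧ e ∈ twoBlock n L k (ε / 8) x y ∧
        CloseUpTo l (3 * (ε / 32)) (shiftSeq^[n + L + k + L] e) w ∧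
        Real.exp (seqSum f n x) * Real.exp (seqSum f k y) * Real.exp (seqSum f l w)
          ≤ K5 * Real.exp (seqSum f N e) := by
      intro w
      by_cases hw : w ∈ F
      · obtain ⟨z, hz, h1, h2, h3, h4⟩ := hglue n k l x hx y hy w (hFsep.1 hw)
        obtain ⟨e, he, hez⟩ := (hEspan N).2 z hz
        refine ⟨e, fun _ => ⟨he, ⟨fun i hi => ?_, fun i hi => ?_⟩, fun i hi => ?_,
          h4 e ((hEsep N).1 he) (hez.mono (by linarith))⟩⟩
        · have a1 := h1 i hi
          have a2 := hez i (by omega)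
          have a3 := dist_triangle_left (x i) (e i) (z i)
          rw [dist_comm] at a2
          linarith
        · have a1 := h2 i hi
          have a2 := hez (i + (n + L)) (by omega)
          rw [shiftSeq_iterate] at a1 ⊢
          have a3 := dist_triangle_left (y i) (e (i + (n + L))) (z (i + (n + L)))
          rw [dist_comm] at a2
          linarith
        · have a1 := h3 i hi
          have a2 := hez (i + (n + L + k + L)) (by omega)
          rw [shiftSeq_iterate] at a1 ⊢
          have a3 := dist_triangle (e (i + (n + L + k + L))) (z (i + (n + L + k + L))) (w i)
          linarith
      · exact ⟨w, fun h => absurd h hw⟩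
    choose e he using hw
    have hinj : ∀ w ∈ F, ∀ w' ∈ F, e w = e w' → w = w' := by
      intro w hw w' hw' hww
      have a1 := (he w hw).2.2.1
      have a2 := (he w' hw').2.2.1
      rw [← hww] at a2
      exact hFsep.2 w hw w' hw' ((a1.symm.trans a2).mono (by linarith))
    have hsum : Real.exp (seqSum f n x) * Real.exp (seqSum f k y) * expSum f l F
        ≤ K5 * expSum f N ((E N).filter (· ∈ twoBlock n L k (ε / 8) x y)) := by
      have h1 : Real.exp (seqSum f n x) * Real.exp (seqSum f k y) * expSum f l F
          ≤ K5 * expSum f N (F.image e) := by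
        rw [expSum, expSum, Finset.sum_image hinj, Finset.mul_sum, Finset.mul_sum]
        exact Finset.sum_le_sum fun w hw => (he w hw).2.2.2
      refine h1.trans (mul_le_mul_of_nonneg_left ?_ hK5.le)
      refine Finset.sum_le_sum_of_subset_of_nonneg ?_ fun _ _ _ => (Real.exp_pos _).le
      intro a ha
      obtain ⟨w, hw, rfl⟩ := Finset.mem_image.1 ha
      exact Finset.mem_filter.2 ⟨(he w hw).1, (he w hw).2.1⟩
    have e1 : Real.exp ((N : ℝ) * h.rate) = Real.exp (n * h.rate) * Real.exp (k * h.rate) *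
        Real.exp (l * h.rate) * Real.exp (2 * L * h.rate) := by
      rw [← Real.exp_add, ← Real.exp_add, ← Real.exp_add]
      congr 1
      rw [hNdef]
      push_cast
      ring
    have h6 := hup N (E N) (hEsep N)
    calc _ ≤ (K5 * K1 * K2 * Real.exp (2 * L * h.rate))⁻¹ *
          (Real.exp (seqSum f n x - n * h.rate) * Real.exp (seqSum f k y - k * h.rate)) *
          (K2 * Real.exp (N * h.rate)) := by gcongr
      _ = (K5 * K1)⁻¹ * (Real.exp (seqSum f n x) * Real.exp (seqSum f k y) *
          Real.exp (l * h.rate)) := by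
          rw [e1, Real.exp_sub, Real.exp_sub]
          field_simp
      _ ≤ (K5 * K1)⁻¹ * (Real.exp (seqSum f n x) * Real.exp (seqSum f k y) *
          (K1 * expSum f l F)) := by gcongr
      _ = K5⁻¹ * (Real.exp (seqSum f n x) * Real.exp (seqSum f k y) * expSum f l F) := by
          field_simp
      _ ≤ K5⁻¹ * (K5 * expSum f N ((E N).filter (· ∈ twoBlock n L k (ε / 8) x y))) := by
          gcongr
      _ = _ := by field_simp

end SpecSystem

end Gibbs

section Cells

/-- Disjoint sets `V i` contained in the members of a finite cover `U i` can be enlarged to a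
measurable partition subordinate to the cover. -/
theorem exists_finMeas_between {Ω : Type*} [MeasurableSpace Ω] {N : ℕ} (hN : 0 < N)
    {U V : Fin N → Set Ω} (hU : ∀ i, MeasurableSet (U i)) (hV : ∀ i, MeasurableSet (V i))
    (hVU : ∀ i, V i ⊆ U i) (hdisj : ∀ i j, ∀ y ∈ V i, y ∈ V j → i = j) :
    ∃ b : Ω → Fin N, FinMeas b ∧ (∀ y ∈ ⋃ i, U i, y ∈ U (b y)) ∧ ∀ i, ∀ y ∈ V i, b y = i := by
  set p : Ω → ℕ → Prop := fun y j => if h : j < N then y ∈ V ⟨j, h⟩ else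
    if h : j - N < N then y ∈ U ⟨j - N, h⟩ else True with hp
  have hex : ∀ y, ∃ j, p y j := fun y => ⟨N + N, by simp [hp]⟩
  have hm : ∀ j, MeasurableSet {y | p y j} := by
    intro j
    by_cases h1 : j < N
    · simpa [hp, h1] using hV _
    · by_cases h2 : j - N < N
      · simpa [hp, h1, h2] using hU _
      · simp [hp, h1, h2]
  have hfind : Measurable fun y => Nat.find (hex y) := measurable_find hex hm
  set F : ℕ → Fin N := fun j => if h : j < N then ⟨j, h⟩ else
    if h : j - N < N then ⟨j - N, h⟩ else ⟨0, hN⟩ with hF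
  refine ⟨fun y => F (Nat.find (hex y)), fun i => ?_, fun y hy => ?_, fun i y hy => ?_⟩
  · exact hfind (MeasurableSpace.measurableSet_top (s := F ⁻¹' {i}))
  · have h := Nat.find_spec (hex y)
    set j := Nat.find (hex y) with hj
    by_cases h1 : j < N
    · simp only [hp, h1, dif_pos] at h
      have hFj : F j = ⟨j, h1⟩ := dif_pos h1
      change y ∈ U (F j)
      rw [hFj]
      exact hVU _ h
    · by_cases h2 : j - N < N
      · simp only [hp, h1, h2, dif_pos, dif_neg, not_false_eq_true] at h
        have hFj : F j = ⟨j - N, h2⟩ :=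
            by simp only [hF, h1, h2, dif_pos, dif_neg, not_false_eq_true]
        change y ∈ U (F j)
        rw [hFj]
        exact h
      · rw [mem_iUnion] at hy
        obtain ⟨i, hi⟩ := hy
        have : Nat.find (hex y) ≤ N + i := Nat.find_le (by simp [hp, hi])
        omega
  · have h := Nat.find_spec (hex y)
    have hle : Nat.find (hex y) ≤ i := Nat.find_le (by simp [hp, hy])
    set j := Nat.find (hex y) with hj
    have h1 : j < N := by omega
    simp only [hp, h1, dif_pos] at h
    have hFj : F j = ⟨j, h1⟩ := dif_pos h1
    change F j = i
    rw [hFj]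
    exact hdisj _ _ y h hy

variable {X : Type*} [MetricSpace X] [CompactSpace X] [MeasurableSpace X] [BorelSpace X]
  {Y : Set (ℕ → X)} {f : X × X → ℝ} {ε P : ℝ}

theorem SpecSystem.exists_cells (h : SpecSystem Y f ε) (n : ℕ) :
    ∃ (N : ℕ) (c : Fin N → ℕ → X) (b : (ℕ → X) → Fin N), FinMeas b ∧ (∀ i, c i ∈ Y) ∧
      (∀ y ∈ Y, CloseUpTo n (ε / 2) (c (b y)) y) ∧
      ∀ i y, (∀ j ≤ n, dist (c i j) (y j) ≤ ε / 8) → b y = i := by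
  have hε := h.pos
  obtain ⟨E, hE, hEs, hne⟩ := exists_maximal_sep h.nonempty n (s := 3 * ε / 8) (by positivity)
  set c : Fin E.card → ℕ → X := fun i => (E.equivFin.symm i : ℕ → X) with hc
  have hcE : ∀ i, c i ∈ E := fun i => (E.equivFin.symm i).2
  have hV : ∀ i, MeasurableSet {y : ℕ → X | ∀ j ≤ n, dist (c i j) (y j) ≤ ε / 8} := fun i => by
    have : {y : ℕ → X | ∀ j ≤ n, dist (c i j) (y j) ≤ ε / 8}
        = ⋂ j, ⋂ (_ : j ≤ n), {y | dist (c i j) (y j) ≤ ε / 8} := by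
      ext y
      simp
    rw [this]
    exact (isClosed_iInter fun j => isClosed_iInter fun _ =>
      isClosed_le (by fun_prop) continuous_const).measurableSet
  have hdisj : ∀ i i', ∀ y ∈ {y : ℕ → X | ∀ j ≤ n, dist (c i j) (y j) ≤ ε / 8},
      y ∈ {y : ℕ → X | ∀ j ≤ n, dist (c i' j) (y j) ≤ ε / 8} → i = i' := fun i i' y hy hy' => by
    have : c i = c i' := hE.2 _ (hcE i) _ (hcE i') fun j hj => by
      have h1 := hy j hj
      have h2 := hy' j hj
      have h3 := dist_triangle_right (c i j) (c i' j) (y j)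
      linarith
    exact E.equivFin.symm.injective (Subtype.ext this)
  obtain ⟨b, hb, hbU, hbV⟩ := exists_finMeas_between (Finset.card_pos.2 hne)
    (U := fun i => {y | CloseUpTo n (3 * ε / 8) (c i) (shiftSeq^[0] y)})
    (fun i => (isOpen_closeUpTo n 0 _ _).measurableSet) hV
    (fun i y hy j hj => (hy j hj).trans_lt (by linarith)) hdisj
  refine ⟨E.card, c, b, hb, fun i => hE.1 (hcE i), fun y hy => ?_, fun i y hy => hbV i y hy⟩
  refine CloseUpTo.mono (hbU y ?_) (by linarith)
  obtain ⟨x, hx, hxy⟩ := hEs.2 y hy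
  refine mem_iUnion.2 ⟨E.equivFin ⟨x, hx⟩, ?_⟩
  simpa [hc] using hxy

/-- A Gibbs measure for `Y`, `f` together with finite partitions comparable to Bowen balls. -/
structure GibbsCells (Y : Set (ℕ → X)) (f : X × X → ℝ) (ε P : ℝ) where
  /-- the measure -/
  m : Measure (ℕ → X)
  isProb : IsProbabilityMeasure m
  supp : m Yᶜ = 0
  /-- the number of cells at time `n` -/
  card : ℕ → ℕ
  /-- the cell map at time `n` -/
  cell : ∀ n, (ℕ → X) → Fin (card n)
  /-- the centers of the cells -/
  center : ∀ n, Fin (card n) → ℕ → X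
  finMeas : ∀ n, FinMeas (cell n)
  center_mem : ∀ n i, center n i ∈ Y
  close : ∀ n, ∀ y ∈ Y, CloseUpTo n (ε / 2) (center n (cell n y)) y
  /-- the constant in the Gibbs bounds -/
  K : ℝ
  K_pos : 0 < K
  ball_le : ∀ j n, ∀ x ∈ Y, m {y | CloseUpTo n (ε / 2) x (shiftSeq^[j] y)}
    ≤ ENNReal.ofReal (K * Real.exp (seqSum f n x - n * P))
  /-- the gap between blocks -/
  L : ℕ
  le_cell : ∀ n k i j, Real.exp (seqSum f n (center n i) - n * P) *
    Real.exp (seqSum f k (center k j) - k * P) ≤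
      K * m.real (cell n ⁻¹' {i} ∩ {y | cell k (shiftSeq^[n + L] y) = j})

theorem SpecSystem.nonempty_gibbsCells (h : SpecSystem Y f ε) :
    Nonempty (GibbsCells Y f ε h.rate) := by
  obtain ⟨m, hm, hsupp, ⟨K, hK, hup⟩, L, K', hK', hlow⟩ := h.exists_gibbs
  choose N c b hb hcY hclose hin using h.exists_cells
  refine ⟨⟨m, hm, hsupp, N, b, c, hb, hcY, hclose, max K K'⁻¹, lt_max_of_lt_left hK,
    fun j n x hx => (hup j n x hx).trans (ENNReal.ofReal_le_ofReal ?_), L, fun n k i j => ?_⟩⟩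
  · exact mul_le_mul_of_nonneg_right (le_max_left _ _) (Real.exp_pos _).le
  · have h1 := hlow n k (c n i) (hcY n i) (c k j) (hcY k j)
    have h2 : m (twoBlock n L k (ε / 8) (c n i) (c k j))
        ≤ m (b n ⁻¹' {i} ∩ {y | b k (shiftSeq^[n + L] y) = j}) :=
      measure_mono fun y hy => ⟨hin n i y hy.1, hin k j _ hy.2⟩
    have h3 := (ENNReal.ofReal_le_iff_le_toReal (measure_ne_top _ _)).1 (h1.trans h2)
    rw [← measureReal_def] at h3
    have h4 : ∀ t a : ℝ, K' * t ≤ a → t ≤ K'⁻¹ * a := fun t a hta => by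
      rw [inv_mul_eq_div, le_div_iff₀ hK', mul_comm]
      exact hta
    exact (h4 _ _ h3).trans (mul_le_mul_of_nonneg_right (le_max_right _ _) measureReal_nonneg)

namespace GibbsCells

variable (g : GibbsCells Y f ε P)

instance : IsProbabilityMeasure g.m := g.isProb

/-- The Gibbs weight of a cell. -/
noncomputable def weight (n : ℕ) (i : Fin (g.card n)) : ℝ :=
  Real.exp (seqSum f n (g.center n i) - n * P)

theorem weight_pos (n : ℕ) (i : Fin (g.card n)) : 0 < g.weight n i := Real.exp_pos _

theorem real_cell_le (n : ℕ) (i : Fin (g.card n)) :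
    g.m.real (g.cell n ⁻¹' {i}) ≤ g.K * g.weight n i := by
  have h1 : g.m (g.cell n ⁻¹' {i}) ≤ ENNReal.ofReal (g.K * g.weight n i) := by
    refine le_trans (measure_mono (t := {y | CloseUpTo n (ε / 2) (g.center n i) (shiftSeq^[0] y)}
      ∪ Yᶜ) fun y hy => ?_) ((measure_union_le _ _).trans ?_)
    · by_cases hyY : y ∈ Y
      · left
        have := g.close n y hyY
        rw [show g.cell n y = i from hy] at this
        exact this
      · exact Or.inr hyY
    · rw [g.supp, add_zero]
      exact g.ball_le 0 n _ (g.center_mem n i)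
  exact ENNReal.toReal_le_of_le_ofReal (mul_nonneg g.K_pos.le (g.weight_pos n i).le) h1

theorem real_preimage_eq_sum (n : ℕ) (I : Finset (Fin (g.card n))) :
    g.m.real (g.cell n ⁻¹' I) = ∑ i ∈ I, g.m.real (g.cell n ⁻¹' {i}) := by
  rw [← measureReal_biUnion_finset]
  · congr 1
    ext y
    simp
  · intro i _ j _ hij
    refine Set.disjoint_left.2 fun y hy hy' => hij ?_
    rw [← show g.cell n y = i from hy, ← show g.cell n y = j from hy']
  · exact fun i _ => g.finMeas n i

theorem sum_weight_mul_le (n k : ℕ) (I : Finset (Fin (g.card n))) (J : Finset (Fin (g.card k))) :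
    (∑ i ∈ I, g.weight n i) * ∑ j ∈ J, g.weight k j ≤
      g.K * g.m.real (g.cell n ⁻¹' I ∩ {y | g.cell k (shiftSeq^[n + g.L] y) ∈ J}) := by
  have hfm : FinMeas fun y => (g.cell n y, g.cell k (shiftSeq^[n + g.L] y)) :=
    (g.finMeas n).prodMk ((g.finMeas k).comp_measurable
      (continuous_shiftSeq.iterate _).measurable)
  have : g.m.real (g.cell n ⁻¹' I ∩ {y | g.cell k (shiftSeq^[n + g.L] y) ∈ J})
      = ∑ p ∈ I ×ˢ J, g.m.real (g.cell n ⁻¹' {p.1} ∩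
        {y | g.cell k (shiftSeq^[n + g.L] y) = p.2}) := by
    rw [← measureReal_biUnion_finset]
    · congr 1
      ext y
      simp
    · rintro ⟨i, j⟩ _ ⟨i', j'⟩ _ hij
      refine Set.disjoint_left.2 fun y hy hy' => hij ?_
      have h1 : g.cell n y = i := hy.1
      have h2 : g.cell n y = i' := hy'.1
      have h3 : g.cell k (shiftSeq^[n + g.L] y) = j := hy.2
      have h4 : g.cell k (shiftSeq^[n + g.L] y) = j' := hy'.2
      rw [← h1, ← h2, ← h3, ← h4]
    · rintro ⟨i, j⟩ _
      have := hfm (i, j)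
      convert this using 1
      ext y
      simp
  rw [this, Finset.sum_mul_sum, ← Finset.sum_product', Finset.mul_sum]
  exact Finset.sum_le_sum fun p _ => g.le_cell n k p.1 p.2

theorem sum_weight_le (n : ℕ) : ∑ i, g.weight n i ≤ g.K := by
  have h0 : Nonempty (Fin (g.card 0)) := by
    obtain ⟨y⟩ : Nonempty (ℕ → X) := nonempty_of_isProbabilityMeasure g.m
    exact ⟨g.cell 0 y⟩
  obtain ⟨j⟩ := h0
  have h1 := g.sum_weight_mul_le n 0 Finset.univ {j}
  rw [Finset.sum_singleton, weight] at h1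
  simp only [seqSum, Finset.range_zero, Finset.sum_empty, Nat.cast_zero, zero_mul, sub_zero,
    Real.exp_zero, mul_one] at h1
  exact h1.trans (mul_le_of_le_one_right g.K_pos.le measureReal_le_one)

/-- Measurable sets are approximated by unions of cells. -/
theorem exists_cell_approx (h : SpecSystem Y f ε) (ν : Measure (ℕ → X)) [IsFiniteMeasure ν]
    (hν : ν Yᶜ = 0) {D : Set (ℕ → X)} (hD : MeasurableSet D) {η : ℝ} (hη : 0 < η) :
    ∃ R, ∀ n, R ≤ n → ∃ I : Finset (Fin (g.card n)),
      ν.real {y | ¬(y ∈ D ↔ g.cell n y ∈ I)} ≤ η := by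
  have hv : FinMeas fun y => decide (y ∈ D) := fun b => by
    cases b
    · convert hD.compl using 1
      ext y
      simp
    · convert hD using 1
      ext y
      simp
  obtain ⟨R, hR⟩ := exists_approx_of_expansive h.isClosed h.expansive ν hν hv
    (η := ENNReal.ofReal η) (by simpa using hη)
  refine ⟨R, fun n hn => ?_⟩
  obtain ⟨G, hG⟩ := hR (g.cell n) fun y hy y' hy' hyy i hi => by
    have h1 := g.close n y hy i (by omega)
    have h2 := g.close n y' hy' i (by omega)
    rw [hyy] at h1
    have h3 := dist_triangle_left (y i) (y' i) (g.center n (g.cell n y') i)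
    linarith
  refine ⟨Finset.univ.filter fun i => G i = true, ENNReal.toReal_le_of_le_ofReal hη.le ?_⟩
  convert hG using 2
  ext y
  by_cases hy : y ∈ D <;> simp [hy]

theorem measurableSet_cell_preimage (n : ℕ) (I : Finset (Fin (g.card n))) :
    MeasurableSet (g.cell n ⁻¹' I) := (g.finMeas n).measurableSet_preimage _

/-- Mixing lower bound between cell unions and Borel sets. -/
theorem mixing (h : SpecSystem Y f ε) (n : ℕ) (I : Finset (Fin (g.card n))) {D : Set (ℕ → X)}
    (hD : MeasurableSet D) :
    g.m.real (g.cell n ⁻¹' I) * g.m.real D ≤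
      g.K ^ 3 * g.m.real (g.cell n ⁻¹' I ∩ shiftSeq^[n + g.L] ⁻¹' D) := by
  have hKpos := g.K_pos
  set S : (ℕ → X) → ℕ → X := shiftSeq^[n + g.L] with hS
  have hSm : Measurable S := (continuous_shiftSeq.iterate _).measurable
  have hSY : g.m (S ⁻¹' Yᶜ) = 0 :=
    measure_mono_null (fun y hy hyY => hy (shift_iterate_mem h.shift_mem _ hyY)) g.supp
  have key : ∀ η > 0, g.m.real (g.cell n ⁻¹' I) * g.m.real D ≤
      g.K ^ 3 * g.m.real (g.cell n ⁻¹' I ∩ S ⁻¹' D) + (1 + g.K ^ 3) * η := by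
    intro η hη
    obtain ⟨R, hR⟩ := g.exists_cell_approx h (g.m + g.m.map S)
      (by rw [Measure.add_apply, Measure.map_apply hSm h.isClosed.measurableSet.compl, g.supp,
        hSY, add_zero]) hD hη
    obtain ⟨J, hJ⟩ := hR R le_rfl
    set Z := {y | ¬(y ∈ D ↔ g.cell R y ∈ J)} with hZ
    have hJm := g.measurableSet_cell_preimage R J
    have hZm : MeasurableSet Z := by
      have : Z = symmDiff D (g.cell R ⁻¹' J) := by
        ext y
        simp only [hZ, mem_ofPred_eq, mem_symmDiff, mem_preimage, Finset.mem_coe]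
        tauto
      rw [this]
      exact hD.symmDiff hJm
    have hsum : g.m.real Z + g.m.real (S ⁻¹' Z) ≤ η := by
      rw [← map_measureReal_apply hSm hZm, ← measureReal_add_apply]
      exact hJ
    have h1 : g.m.real D ≤ g.m.real (g.cell R ⁻¹' J) + η := by
      refine le_trans (measureReal_mono (s₂ := g.cell R ⁻¹' J ∪ Z) fun y hy => ?_)
        ((measureReal_union_le _ _).trans ?_)
      · by_cases hyJ : g.cell R y ∈ J
        · exact Or.inl hyJ
        · exact Or.inr fun hh => hyJ (hh.1 hy)
      · have := measureReal_nonneg (μ := g.m) (s := S ⁻¹' Z)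
        linarith
    have h2 : g.m.real (g.cell n ⁻¹' I ∩ {y | g.cell R (S y) ∈ J}) ≤
        g.m.real (g.cell n ⁻¹' I ∩ S ⁻¹' D) + η := by
      refine le_trans (measureReal_mono (s₂ := (g.cell n ⁻¹' I ∩ S ⁻¹' D) ∪ S ⁻¹' Z)
        fun y hy => ?_) ((measureReal_union_le _ _).trans ?_)
      · by_cases hyD : S y ∈ D
        · exact Or.inl ⟨hy.1, hyD⟩
        · exact Or.inr fun hh => hyD (hh.2 hy.2)
      · have := measureReal_nonneg (μ := g.m) (s := Z)
        linarith
    have h3 := g.sum_weight_mul_le n R I J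
    have h4 : ∀ (k : ℕ) (A : Finset (Fin (g.card k))),
        g.m.real (g.cell k ⁻¹' A) ≤ g.K * ∑ i ∈ A, g.weight k i := fun k A => by
      rw [g.real_preimage_eq_sum, Finset.mul_sum]
      exact Finset.sum_le_sum fun i _ => g.real_cell_le k i
    have h5 : g.m.real (g.cell n ⁻¹' I) * g.m.real (g.cell R ⁻¹' J) ≤
        g.K ^ 3 * g.m.real (g.cell n ⁻¹' I ∩ {y | g.cell R (S y) ∈ J}) := by
      calc _ ≤ (g.K * ∑ i ∈ I, g.weight n i) * (g.K * ∑ j ∈ J, g.weight R j) :=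
            mul_le_mul (h4 n I) (h4 R J) measureReal_nonneg
              (measureReal_nonneg.trans (h4 n I))
        _ = g.K ^ 2 * ((∑ i ∈ I, g.weight n i) * ∑ j ∈ J, g.weight R j) := by ring
        _ ≤ g.K ^ 2 * (g.K * g.m.real (g.cell n ⁻¹' I ∩ {y | g.cell R (S y) ∈ J})) := by
            gcongr
        _ = _ := by ring
    have hI1 : g.m.real (g.cell n ⁻¹' I) ≤ 1 := measureReal_le_one
    have hI0 : 0 ≤ g.m.real (g.cell n ⁻¹' I) := measureReal_nonneg
    calc _ ≤ g.m.real (g.cell n ⁻¹' I) * (g.m.real (g.cell R ⁻¹' J) + η) := by gcongr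
      _ ≤ g.m.real (g.cell n ⁻¹' I) * g.m.real (g.cell R ⁻¹' J) + η := by nlinarith
      _ ≤ g.K ^ 3 * (g.m.real (g.cell n ⁻¹' I ∩ S ⁻¹' D) + η) + η := by
          have := mul_le_mul_of_nonneg_left h2 (pow_nonneg hKpos.le 3)
          linarith
      _ = _ := by ring
  refine le_of_forall_pos_le_add fun δ hδ => ?_
  have hK3 : 0 < 1 + g.K ^ 3 := by positivity
  have := key (δ / (1 + g.K ^ 3)) (by positivity)
  rwa [mul_div_cancel₀ _ hK3.ne'] at this

/-- Zero–one law: invariant Borel sets have measure zero or one. -/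
theorem zero_or_one (h : SpecSystem Y f ε) {A : Set (ℕ → X)} (hA : MeasurableSet A)
    (hinv : shiftSeq ⁻¹' A = A) : g.m A = 0 ∨ g.m Aᶜ = 0 := by
  have hKpos := g.K_pos
  have hit : ∀ n, shiftSeq^[n] ⁻¹' A = A := fun n => by
    induction n with
    | zero => rfl
    | succ n ih => rw [Function.iterate_succ, preimage_comp, ih, hinv]
  have key : ∀ η > 0, g.m.real Aᶜ * g.m.real A ≤ (1 + g.K ^ 3) * η := by
    intro η hη
    obtain ⟨R, hR⟩ := g.exists_cell_approx h g.m g.supp hA.compl hη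
    obtain ⟨I, hI⟩ := hR R le_rfl
    have h1 := g.mixing h R I hA
    rw [hit] at h1
    have h2 : g.m.real (g.cell R ⁻¹' I ∩ A) ≤ η := by
      refine (measureReal_mono fun y hy => ?_).trans hI
      exact fun hh => hh.2 hy.1 hy.2
    have h3 : g.m.real Aᶜ ≤ g.m.real (g.cell R ⁻¹' I) + η := by
      refine (measureReal_mono (s₂ := g.cell R ⁻¹' I ∪ {y | ¬(y ∈ Aᶜ ↔ g.cell R y ∈ I)})
        fun y hy => ?_).trans ((measureReal_union_le _ _).trans (by linarith))
      by_cases hyI : g.cell R y ∈ I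
      · exact Or.inl hyI
      · exact Or.inr fun hh => hyI (hh.1 hy)
    have h4 : g.m.real A ≤ 1 := measureReal_le_one
    have h5 : 0 ≤ g.m.real A := measureReal_nonneg
    have h6 := mul_le_mul_of_nonneg_left h2 (pow_nonneg hKpos.le 3)
    have h7 := mul_le_mul_of_nonneg_right h3 h5
    nlinarith
  have h0 : g.m.real Aᶜ * g.m.real A ≤ 0 := by
    refine le_of_forall_pos_le_add fun δ hδ => ?_
    have hK3 : 0 < 1 + g.K ^ 3 := by positivity
    have := key (δ / (1 + g.K ^ 3)) (by positivity)
    rwa [mul_div_cancel₀ _ hK3.ne', ← zero_add δ] at this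
  have h1 : g.m.real Aᶜ * g.m.real A = 0 :=
    le_antisymm h0 (mul_nonneg measureReal_nonneg measureReal_nonneg)
  rcases mul_eq_zero.1 h1 with h2 | h2
  · exact Or.inr ((measureReal_eq_zero_iff).1 h2)
  · exact Or.inl ((measureReal_eq_zero_iff).1 h2)

end GibbsCells

end Cells

section UpperBound

variable {X : Type*}

/-- The finite word of symbols of the first `N` letters of a sequence. -/
def word {B : Type*} (p : X → B) (N : ℕ) (y : ℕ → X) : Fin N → B := fun i => p (y i)

theorem measurable_seqSum [MeasurableSpace X] {f : X × X → ℝ} (hf : Measurable f) (n : ℕ) :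
    Measurable (seqSum f n) := by
  unfold seqSum
  fun_prop

theorem integral_seqSum [MeasurableSpace X] {f : X × X → ℝ} (hf : Measurable f) {B : ℝ}
    (hB : ∀ p, |f p| ≤ B) {ν : Measure (ℕ → X)} [IsProbabilityMeasure ν]
    (hν : MeasurePreserving shiftSeq ν ν) (n : ℕ) :
    ∫ y, seqSum f n y ∂ν = n * ∫ y, f (y 0, y 1) ∂ν := by
  have hInt : ∀ i : ℕ, Integrable (fun y : ℕ → X => f (y i, y (i + 1))) ν := fun i =>
    Integrable.of_bound (hf.comp (by fun_prop)).aestronglyMeasurable B (ae_of_all _ fun y => hB _)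
  have hi : ∀ i : ℕ, ∫ y, f (y i, y (i + 1)) ∂ν = ∫ y, f (y 0, y 1) ∂ν := fun i => by
    have hm : AEStronglyMeasurable (fun y : ℕ → X => f (y 0, y 1)) (ν.map shiftSeq^[i]) :=
      (hf.comp (by fun_prop)).aestronglyMeasurable
    have h1 := integral_map (hν.iterate i).measurable.aemeasurable hm
    rw [(hν.iterate i).map_eq] at h1
    rw [h1]
    simp only [shiftSeq_iterate, zero_add, add_comm 1]
  simp only [seqSum]
  rw [integral_finsetSum _ fun i _ => hInt i]
  simp [hi]

variable [MetricSpace X] [CompactSpace X] [MeasurableSpace X] [BorelSpace X]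
  {Y : Set (ℕ → X)} {f : X × X → ℝ} {ε P : ℝ}

namespace GibbsCells

variable (g : GibbsCells Y f ε P)

theorem sum_weight_le_real (n : ℕ) (I : Finset (Fin (g.card n))) :
    ∑ i ∈ I, g.weight n i ≤ g.K * g.m.real (g.cell n ⁻¹' I) := by
  obtain ⟨y⟩ : Nonempty (ℕ → X) := nonempty_of_isProbabilityMeasure g.m
  have h1 := g.sum_weight_mul_le n 0 I {g.cell 0 y}
  rw [Finset.sum_singleton, weight] at h1
  simp only [seqSum, Finset.range_zero, Finset.sum_empty, Nat.cast_zero, zero_mul, sub_zero,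
    Real.exp_zero, mul_one] at h1
  exact h1.trans (mul_le_mul_of_nonneg_left (measureReal_mono inter_subset_left) g.K_pos.le)

/-- Upper bound for the entropy of words in terms of the Gibbs cells. -/
theorem exists_partEntropy_word_le (h : SpecSystem Y f ε) (hf : Measurable f) :
    ∃ C' : ℝ, ∀ (ν : Measure (ℕ → X)) [IsProbabilityMeasure ν], MeasurePreserving shiftSeq ν ν →
      ν Yᶜ = 0 → ∀ n, 1 ≤ n → ∀ (I : Finset (Fin (g.card n))) (Θ : ℝ), 0 < Θ →
      g.m.real (g.cell n ⁻¹' I) ≤ Θ → ∀ {B : Type} [Fintype B] (p : X → B), FinMeas p →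
      ∀ η > 0, ∃ C, ∀ N, partEntropy ν (word p N) ≤
        N * ((C' + ν.real (g.cell n ⁻¹' I) * Real.log Θ) / n + P - ∫ y, f (y 0, y 1) ∂ν + η)
          + C := by
  obtain ⟨Bf, hBf⟩ := h.bounded
  obtain ⟨C0, hC0⟩ := h.distortion
  have hK := g.K_pos
  have hε := h.pos
  refine ⟨C0 + Real.log (2 * g.K), fun ν _ hν hνY n hn I Θ hΘ hI B _ p hp η hη => ?_⟩
  have hn0 : (0 : ℝ) < n := by exact_mod_cast hn
  set ρ : Fin (g.card n) → ℝ := fun i =>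
    g.weight n i * (2 * g.K)⁻¹ * if i ∈ I then Θ⁻¹ else 1 with hρ
  have hρpos : ∀ i, 0 < ρ i := fun i => by
    have := g.weight_pos n i
    simp only [hρ]
    split_ifs <;> positivity
  have hρ1 : ∑ i, ρ i ≤ 1 := by
    have e1 : ∀ i, ρ i ≤ (2 * g.K)⁻¹ * g.weight n i +
        (2 * g.K)⁻¹ * Θ⁻¹ * if i ∈ I then g.weight n i else 0 := fun i => by
      have := g.weight_pos n i
      have h2 : 0 < (2 * g.K)⁻¹ := by positivity
      simp only [hρ]
      split_ifs
      · nlinarith [mul_pos h2 this]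
      · linarith
    refine (Finset.sum_le_sum fun i _ => e1 i).trans ?_
    rw [Finset.sum_add_distrib, ← Finset.mul_sum, ← Finset.mul_sum, Finset.sum_ite_mem,
      Finset.univ_inter]
    have e2 := g.sum_weight_le n
    have e3 : ∑ i ∈ I, g.weight n i ≤ g.K * Θ :=
      (g.sum_weight_le_real n I).trans (mul_le_mul_of_nonneg_left hI hK.le)
    calc _ ≤ (2 * g.K)⁻¹ * g.K + (2 * g.K)⁻¹ * Θ⁻¹ * (g.K * Θ) := by gcongr
      _ = 1 := by field_simp; norm_num
  obtain ⟨C, hC⟩ := exists_partEntropy_le_of_generating h.isClosed h.shift_mem h.expansive ν hνY hn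
    (hν.iterate n) (g.finMeas n) (v := word p n)
    (FinMeas.pi fun i => hp.comp_measurable (measurable_pi_apply (i : ℕ)))
    (fun y hy y' hy' hyy i hi => by
      have h1 := g.close n y hy i (by omega)
      have h2 := g.close n y' hy' i (by omega)
      rw [hyy] at h1
      have h3 := dist_triangle_left (y i) (y' i) (g.center n (g.cell n y') i)
      linarith) (fun _ => ρ) (fun _ i => (hρpos i).le) (fun y => hρpos _) (fun _ => hρ1) hη
  set A := ∫ y, -Real.log (ρ (g.cell n y)) ∂ν with hA
  have hAle : A ≤ C0 + Real.log (2 * g.K) + ν.real (g.cell n ⁻¹' I) * Real.log Θ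
      + n * (P - ∫ y, f (y 0, y 1) ∂ν) := by
    have hae : ∀ᵐ y ∂ν, y ∈ Y := measure_eq_zero_iff_ae_notMem.1 hνY |>.mono fun y hy => by
      simpa using hy
    have hs : Integrable (seqSum f n) ν := Integrable.of_bound
      (measurable_seqSum hf n).aestronglyMeasurable (n * Bf)
      (ae_of_all _ fun y => abs_seqSum_le hBf n y)
    have hCI := g.measurableSet_cell_preimage n I
    have hind : Integrable ((g.cell n ⁻¹' I).indicator fun _ => Real.log Θ) ν :=
      (integrable_const _).indicator hCI
    have hsub : Integrable (fun y => C0 + Real.log (2 * g.K) + n * P - seqSum f n y) ν :=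
      (integrable_const _).sub hs
    have hle : ∀ᵐ y ∂ν, -Real.log (ρ (g.cell n y)) ≤ (C0 + Real.log (2 * g.K) + n * P
        - seqSum f n y) + (g.cell n ⁻¹' I).indicator (fun _ => Real.log Θ) y := by
      filter_upwards [hae] with y hy
      have h1 : |seqSum f n (g.center n (g.cell n y)) - seqSum f n y| ≤ C0 :=
        hC0 n _ (g.center_mem n _) y hy ((g.close n y hy).mono (by linarith))
      have h2 : -Real.log (ρ (g.cell n y)) = -(seqSum f n (g.center n (g.cell n y)) - n * P) +
          Real.log (2 * g.K) + (g.cell n ⁻¹' I).indicator (fun _ => Real.log Θ) y := by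
        have hw := (g.weight_pos n (g.cell n y)).ne'
        have hK2 : (2 * g.K)⁻¹ ≠ 0 := by positivity
        simp only [hρ]
        by_cases hyI : g.cell n y ∈ I
        · rw [if_pos hyI, indicator_of_mem (by exact hyI), Real.log_mul (by positivity)
            (by positivity), Real.log_mul hw hK2, weight, Real.log_exp, Real.log_inv, Real.log_inv]
          ring
        · rw [if_neg hyI, indicator_of_notMem (by exact hyI), mul_one, Real.log_mul hw hK2, weight,
            Real.log_exp, Real.log_inv]
          ring
      have h3 := abs_le.1 h1
      linarith
    calc A ≤ ∫ y, ((C0 + Real.log (2 * g.K) + n * P - seqSum f n y) +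
          (g.cell n ⁻¹' I).indicator (fun _ => Real.log Θ) y) ∂ν :=
          integral_mono_ae ((g.finMeas n).integrable ν fun i => -Real.log (ρ i))
            (hsub.add hind) hle
      _ = _ := by
          rw [integral_add hsub hind,
            integral_sub (integrable_const _) hs, integral_seqSum hf hBf hν,
            integral_indicator_const _ hCI]
          simp
          ring
  have hlin : ∀ N : ℕ, |((N / n : ℕ) : ℝ) - N / n| ≤ 1 := fun N => by
    rw [abs_le]
    have e1 : ((N / n : ℕ) : ℝ) ≤ N / n := Nat.cast_div_le
    have e2 : (N : ℝ) / n ≤ (N / n : ℕ) + 1 := by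
      rw [div_le_iff₀ hn0]
      have := Nat.lt_div_mul_add hn (a := N)
      have h3 : N ≤ (N / n + 1) * n := by rw [add_mul, one_mul]; exact this.le
      exact_mod_cast h3
    constructor <;> linarith
  refine ⟨|A + η| + C, fun N => ?_⟩
  have h1 := hC (N / n) (word p N) fun y y' _ hvv => by
    funext i
    have hi := i.2
    have hq : (i : ℕ) / n ≤ N / n := Nat.div_le_div_right hi.le
    have h2 := congrFun (hvv _ hq) ⟨i % n, Nat.mod_lt _ hn⟩
    simp only [word, ← Function.iterate_mul, shiftSeq_iterate, Nat.mod_add_div] at h2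
    exact h2
  refine h1.trans ?_
  have h3 : ((N / n : ℕ) : ℝ) * (A + η) ≤ N / n * (A + η) + |A + η| := by
    have := abs_le.1 (hlin N)
    have h4 := le_abs_self ((((N / n : ℕ) : ℝ) - N / n) * (A + η))
    rw [abs_mul] at h4
    have h5 := mul_le_of_le_one_left (abs_nonneg (A + η)) (hlin N)
    linarith
  have h6 : (N : ℝ) / n * (A + η) ≤ N * ((C0 + Real.log (2 * g.K) +
      ν.real (g.cell n ⁻¹' I) * Real.log Θ) / n + P - ∫ y, f (y 0, y 1) ∂ν + η) := by
    rw [div_mul_eq_mul_div, mul_div_assoc]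
    refine mul_le_mul_of_nonneg_left ?_ (Nat.cast_nonneg _)
    have h7 : η / n ≤ η := div_le_self hη.le (by exact_mod_cast hn)
    have h8 : A / n ≤ (C0 + Real.log (2 * g.K) +
      ν.real (g.cell n ⁻¹' I) * Real.log Θ) / n + (P - ∫ y, f (y 0, y 1) ∂ν) := by
      rw [div_add' _ _ _ hn0.ne', div_le_div_iff_of_pos_right hn0]
      linarith
    rw [add_div]
    linarith
  linarith

/-- Measures whose word entropies attain the pressure are absolutely continuous with respect to
the Gibbs measure. -/
theorem absolutelyContinuous_of_frequently (h : SpecSystem Y f ε) (hf : Measurable f)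
    (ν : Measure (ℕ → X)) [IsProbabilityMeasure ν] (hν : MeasurePreserving shiftSeq ν ν)
    (hνY : ν Yᶜ = 0)
    (heq : ∀ η > 0, ∃ (k : ℕ) (p : X → Fin k), FinMeas p ∧ ∃ᶠ N : ℕ in atTop,
      N * (P - ∫ y, f (y 0, y 1) ∂ν - η) ≤ partEntropy ν (word p N)) : ν ≪ g.m := by
  obtain ⟨C', hC'⟩ := g.exists_partEntropy_word_le h hf
  have key : ∀ n, 1 ≤ n → ∀ (I : Finset (Fin (g.card n))) (Θ : ℝ), 0 < Θ →
      g.m.real (g.cell n ⁻¹' I) ≤ Θ → 0 ≤ C' + ν.real (g.cell n ⁻¹' I) * Real.log Θ := by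
    intro n hn I Θ hΘ hI
    have hn0 : (0 : ℝ) < n := by exact_mod_cast hn
    by_contra hneg
    push Not at hneg
    set b := C' + ν.real (g.cell n ⁻¹' I) * Real.log Θ with hb
    have hη : 0 < -(b / n) / 4 := by
      have := div_neg_of_neg_of_pos hneg hn0
      linarith
    set η := -(b / n) / 4 with hηd
    obtain ⟨k, p, hp, hfreq⟩ := heq η hη
    obtain ⟨C, hC⟩ := hC' ν hν hνY n hn I Θ hΘ hI p hp η hη
    have hev : ∀ᶠ N : ℕ in atTop, C < N * η := by
      have := tendsto_natCast_atTop_atTop (R := ℝ) |>.atTop_mul_const hη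
      exact this.eventually_gt_atTop C
    obtain ⟨N, hN1, hN2⟩ := (hfreq.and_eventually hev).exists
    have h1 := hC N
    have h2 : b / n = -4 * η := by rw [hηd]; ring
    rw [← hb, h2] at h1
    nlinarith
  refine Measure.AbsolutelyContinuous.mk fun A hA hmA => ?_
  by_contra hνA
  have ha : 0 < ν.real A := ENNReal.toReal_pos hνA (measure_ne_top _ _)
  set a := ν.real A with had
  have small : ∀ δ, 0 < δ → δ ≤ a / 2 → δ ≤ 1 → 0 ≤ C' + a / 2 * Real.log δ := by
    intro δ hδ hδa hδ1
    obtain ⟨R, hR⟩ := g.exists_cell_approx h (g.m + ν) (by simp [g.supp, hνY]) hA hδ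
    obtain ⟨I, hI⟩ := hR (R + 1) (by omega)
    rw [measureReal_add_apply] at hI
    set Z := {y | ¬(y ∈ A ↔ g.cell (R + 1) y ∈ I)} with hZ
    have hZm : 0 ≤ g.m.real Z := measureReal_nonneg
    have hZν : 0 ≤ ν.real Z := measureReal_nonneg
    have h1 : g.m.real (g.cell (R + 1) ⁻¹' I) ≤ δ := by
      refine (measureReal_mono (s₂ := A ∪ Z) fun y hy => ?_).trans
        ((measureReal_union_le _ _).trans ?_)
      · by_cases hyA : y ∈ A
        · exact Or.inl hyA
        · exact Or.inr fun hh => hyA (hh.2 hy)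
      · rw [measureReal_def, hmA, ENNReal.toReal_zero, zero_add]
        linarith
    have h2 : a ≤ ν.real (g.cell (R + 1) ⁻¹' I) + δ := by
      refine (measureReal_mono (s₂ := g.cell (R + 1) ⁻¹' I ∪ Z) fun y hy => ?_).trans
        ((measureReal_union_le _ _).trans (by linarith))
      by_cases hyI : g.cell (R + 1) y ∈ I
      · exact Or.inl hyI
      · exact Or.inr fun hh => hyI (hh.1 hy)
    have h3 := key (R + 1) (by omega) I δ hδ h1
    have h4 : Real.log δ ≤ 0 := Real.log_nonpos hδ.le hδ1
    nlinarith
  have hC'0 : 0 ≤ |C'| := abs_nonneg _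
  have ht : 0 < 2 * (|C'| + 1) / a := by positivity
  have h5 := small (min (min (a / 2) 1) (Real.exp (-(2 * (|C'| + 1) / a)))) (by positivity)
    ((min_le_left _ _).trans (min_le_left _ _)) ((min_le_left _ _).trans (min_le_right _ _))
  have h6 : Real.log (min (min (a / 2) 1) (Real.exp (-(2 * (|C'| + 1) / a))))
      ≤ -(2 * (|C'| + 1) / a) := by
    rw [← Real.log_exp (-(2 * (|C'| + 1) / a))]
    exact Real.log_le_log (by positivity) ((min_le_right _ _).trans (by rw [Real.log_exp]))
  have h7 : a / 2 * -(2 * (|C'| + 1) / a) = -(|C'| + 1) := by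
    field_simp
  have h8 := mul_le_mul_of_nonneg_left h6 (half_pos ha).le
  have h9 := le_abs_self C'
  linarith

/-- There is at most one invariant measure absolutely continuous with respect to the Gibbs
measure. -/
theorem eq_of_absolutelyContinuous (h : SpecSystem Y f ε) {ν₁ ν₂ : Measure (ℕ → X)}
    [IsProbabilityMeasure ν₁] [IsProbabilityMeasure ν₂] (h₁ : MeasurePreserving shiftSeq ν₁ ν₁)
    (h₂ : MeasurePreserving shiftSeq ν₂ ν₂) (hac₁ : ν₁ ≪ g.m) (hac₂ : ν₂ ≪ g.m) : ν₁ = ν₂ := by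
  set κ : Measure (ℕ → X) := ν₁ + ν₂ with hκ
  have hinv : MeasurePreserving shiftSeq κ κ := by
    refine ⟨h₁.measurable, ?_⟩
    rw [hκ, Measure.map_add _ _ h₁.measurable, h₁.map_eq, h₂.map_eq]
  have herg : Ergodic shiftSeq κ := by
    refine ⟨hinv, ⟨fun A hA hAinv => ?_⟩⟩
    rw [eventuallyConst_set]
    have hac : κ ≪ g.m := by
      intro A hA
      simp [hκ, hac₁ hA, hac₂ hA]
    rcases g.zero_or_one h hA hAinv with h0 | h0
    · exact Or.inr (measure_eq_zero_iff_ae_notMem.1 (hac h0))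
    · exact Or.inl ((measure_eq_zero_iff_ae_notMem.1 (hac h0)).mono fun y hy => by simpa using hy)
  obtain ⟨c₁, hc₁⟩ := herg.eq_smul_of_absolutelyContinuous h₁
    (Measure.AbsolutelyContinuous.rfl.add_right _)
  obtain ⟨c₂, hc₂⟩ := herg.eq_smul_of_absolutelyContinuous h₂
    (by rw [hκ, add_comm]; exact Measure.AbsolutelyContinuous.rfl.add_right _)
  have e1 : (1 : ℝ≥0∞) = c₁ * κ univ := by
    rw [← measure_univ (μ := ν₁), hc₁]
    simp
  have e2 : (1 : ℝ≥0∞) = c₂ * κ univ := by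
    rw [← measure_univ (μ := ν₂), hc₂]
    simp
  have hκu : κ univ = 2 := by
    simp [hκ, one_add_one_eq_two]
  rw [hκu] at e1 e2
  have : c₁ = c₂ := (ENNReal.mul_left_inj (by norm_num) (by norm_num)).1 (e1.symm.trans e2)
  rw [hc₁, hc₂, this]

end GibbsCells

end UpperBound

section Invariant

variable {X : Type*} [MetricSpace X] [CompactSpace X] [MeasurableSpace X] [BorelSpace X]
  {Y : Set (ℕ → X)} {f : X × X → ℝ} {ε P : ℝ}

/-- A finite Borel partition into sets of small diameter. -/
theorem exists_finMeas_code [Nonempty X] {s : ℝ} (hs : 0 < s) :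
    ∃ (K : ℕ) (c : X → Fin K), FinMeas c ∧ ∀ x y, c x = c y → dist x y < s := by
  obtain ⟨t, -, htf, hcov⟩ := (isCompact_univ (X := X)).finite_cover_balls (half_pos hs)
  have hne : htf.toFinset.Nonempty := by
    by_contra hcon
    rw [Finset.not_nonempty_iff_eq_empty, Finite.toFinset_eq_empty] at hcon
    obtain ⟨x⟩ := ‹Nonempty X›
    have := hcov (mem_univ x)
    simp [hcon] at this
  set c : Fin htf.toFinset.card → X := fun i => htf.toFinset.equivFin.symm i with hc
  obtain ⟨b, hb, hbU, -⟩ := exists_finMeas_between (Finset.card_pos.2 hne)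
    (U := fun i => Metric.ball (c i) (s / 2)) (V := fun _ => ∅)
    (fun i => Metric.isOpen_ball.measurableSet) (fun _ => MeasurableSet.empty)
    (fun _ => empty_subset _) (fun _ _ _ h => h.elim)
  have hmem : ∀ x, x ∈ Metric.ball (c (b x)) (s / 2) := fun x => by
    refine hbU x ?_
    obtain ⟨y, hy, hxy⟩ := mem_iUnion₂.1 (hcov (mem_univ x))
    refine mem_iUnion.2 ⟨htf.toFinset.equivFin ⟨y, htf.mem_toFinset.2 hy⟩, ?_⟩
    simpa [hc] using hxy
  refine ⟨_, b, hb, fun x y hxy => ?_⟩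
  have h1 := hmem x
  have h2 := hmem y
  rw [hxy, Metric.mem_ball] at h1
  rw [Metric.mem_ball] at h2
  have h3 := dist_triangle_right x y (c (b y))
  linarith

/-- Averages of the shifted measures. -/
noncomputable def avgMeasure (m : Measure (ℕ → X)) (n : ℕ) : Measure (ℕ → X) :=
  ((n + 1 : ℕ) : ℝ≥0∞)⁻¹ • ∑ j ∈ Finset.range (n + 1), m.map (shiftSeq^[j])

theorem measurable_iterate_shift (j : ℕ) : Measurable (shiftSeq^[j] : (ℕ → X) → ℕ → X) :=
  (continuous_shiftSeq.iterate _).measurable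

theorem avgMeasure_apply (m : Measure (ℕ → X)) (n : ℕ) {A : Set (ℕ → X)} (hA : MeasurableSet A) :
    avgMeasure m n A = ((n + 1 : ℕ) : ℝ≥0∞)⁻¹ *
      ∑ j ∈ Finset.range (n + 1), m {y | shiftSeq^[j] y ∈ A} := by
  rw [avgMeasure, Measure.smul_apply, Measure.finsetSum_apply, smul_eq_mul]
  congr 1
  exact Finset.sum_congr rfl fun j _ => Measure.map_apply (measurable_iterate_shift j) hA

theorem inv_mul_sum_const (n : ℕ) (c : ℝ≥0∞) :
    ((n + 1 : ℕ) : ℝ≥0∞)⁻¹ * ∑ _j ∈ Finset.range (n + 1), c = c := by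
  rw [Finset.sum_const, Finset.card_range, nsmul_eq_mul, ← mul_assoc,
    ENNReal.inv_mul_cancel (by simp) (ENNReal.natCast_ne_top _), one_mul]

instance (m : Measure (ℕ → X)) [IsProbabilityMeasure m] (n : ℕ) :
    IsProbabilityMeasure (avgMeasure m n) :=
  ⟨by rw [avgMeasure_apply m n MeasurableSet.univ]; simpa using inv_mul_sum_const n 1⟩

theorem integral_avgMeasure (m : Measure (ℕ → X)) [IsProbabilityMeasure m] (n : ℕ)
    {F : (ℕ → X) → ℝ} (hF : Continuous F) {B : ℝ} (hB : ∀ y, |F y| ≤ B) :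
    ∫ y, F y ∂(avgMeasure m n) =
      ((n : ℝ) + 1)⁻¹ * ∑ j ∈ Finset.range (n + 1), ∫ y, F (shiftSeq^[j] y) ∂m := by
  have hInt : ∀ j ∈ Finset.range (n + 1), Integrable F (m.map (shiftSeq^[j])) := fun j _ => by
    have : IsProbabilityMeasure (m.map (shiftSeq^[j])) :=
      Measure.isProbabilityMeasure_map (measurable_iterate_shift j).aemeasurable
    exact Integrable.of_bound hF.aestronglyMeasurable B (ae_of_all _ hB)
  rw [avgMeasure, integral_smul_measure, integral_finsetSum_measure hInt]
  have e1 : (((n + 1 : ℕ) : ℝ≥0∞)⁻¹).toReal = ((n : ℝ) + 1)⁻¹ := by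
    rw [ENNReal.toReal_inv, ENNReal.toReal_natCast]
    push_cast
    rfl
  rw [e1, smul_eq_mul]
  congr 1
  exact Finset.sum_congr rfl fun j _ =>
    integral_map (measurable_iterate_shift j).aemeasurable hF.aestronglyMeasurable

/-- An invariant measure satisfying the upper Gibbs bound. -/
theorem GibbsCells.exists_invariant (g : GibbsCells Y f ε P) (h : SpecSystem Y f ε) :
    ∃ μ : Measure (ℕ → X), IsProbabilityMeasure μ ∧ MeasurePreserving shiftSeq μ μ ∧ μ Yᶜ = 0 ∧
      ∀ n, ∀ x ∈ Y, μ {y | CloseUpTo n (ε / 2) x y} ≤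
        ENNReal.ofReal (g.K * Real.exp (seqSum f n x - n * P)) := by
  obtain ⟨𝒰, μ, h𝒰, hμ⟩ := exists_ultrafilter_tendsto fun n =>
    (⟨avgMeasure g.m n, inferInstance⟩ : ProbabilityMeasure (ℕ → X))
  have hYm : MeasurableSet Y := h.isClosed.measurableSet
  refine ⟨μ, inferInstance, ⟨continuous_shiftSeq.measurable, ?_⟩, ?_, fun n x hx => ?_⟩
  · have : IsProbabilityMeasure ((μ : Measure (ℕ → X)).map shiftSeq) :=
      Measure.isProbabilityMeasure_map continuous_shiftSeq.measurable.aemeasurable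
    refine ext_of_forall_integral_eq_of_IsFiniteMeasure fun F => ?_
    rw [integral_map continuous_shiftSeq.measurable.aemeasurable
      F.continuous.aestronglyMeasurable]
    have hB : ∀ y, |F y| ≤ ‖F‖ := fun y => F.norm_coe_le_norm y
    have t1 := ProbabilityMeasure.tendsto_iff_forall_integral_tendsto.1 hμ F
    have t2 := ProbabilityMeasure.tendsto_iff_forall_integral_tendsto.1 hμ
      (F.compContinuous ⟨_, continuous_shiftSeq⟩)
    have t3 : Tendsto (fun n : ℕ => 2 * ‖F‖ / ((n : ℝ) + 1)) 𝒰 (𝓝 0) :=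
      ((tendsto_const_nhds.div_atTop (tendsto_atTop_add_const_right _ _
        tendsto_natCast_atTop_atTop))).mono_left h𝒰
    refine sub_eq_zero.1 (tendsto_nhds_unique (t2.sub t1) (squeeze_zero_norm (fun n => ?_) t3))
    change ‖∫ y, F (shiftSeq y) ∂(avgMeasure g.m n) - ∫ y, F y ∂(avgMeasure g.m n)‖ ≤ _
    rw [integral_avgMeasure g.m n F.continuous hB, integral_avgMeasure g.m n
      (F := fun y => F (shiftSeq y)) (F.continuous.comp continuous_shiftSeq) fun y => hB _, ← mul_sub,
      ← Finset.sum_sub_distrib]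
    have e2 : ∀ j : ℕ, ∫ y, F (shiftSeq (shiftSeq^[j] y)) ∂g.m
        = ∫ y, F (shiftSeq^[j + 1] y) ∂g.m := fun j => by
      simp only [Function.iterate_succ_apply']
    have hb : ∀ j : ℕ, |∫ y, F (shiftSeq^[j] y) ∂g.m| ≤ ‖F‖ := fun j => by
      have := norm_integral_le_of_norm_le_const (μ := g.m) (f := fun y => F (shiftSeq^[j] y))
        (ae_of_all _ fun y => hB (shiftSeq^[j] y))
      simpa using this
    simp only [e2]
    rw [Finset.sum_range_sub (fun j => ∫ y, F (shiftSeq^[j] y) ∂g.m), norm_mul, div_eq_inv_mul]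
    have hn : (0 : ℝ) < (n : ℝ) + 1 := by positivity
    rw [Real.norm_of_nonneg (inv_nonneg.2 hn.le)]
    refine mul_le_mul_of_nonneg_left ?_ (inv_nonneg.2 hn.le)
    refine (norm_sub_le _ _).trans ?_
    have := add_le_add (hb (n + 1)) (hb 0)
    rw [Real.norm_eq_abs, Real.norm_eq_abs]
    linarith
  · rw [prob_compl_eq_zero_iff hYm]
    refine le_antisymm prob_le_one (le_measure_closed_of_tendsto hμ h.isClosed
      (Eventually.of_forall fun n => ?_))
    change 1 ≤ avgMeasure g.m n Y
    rw [avgMeasure_apply _ _ hYm]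
    refine (inv_mul_sum_const n 1).symm.le.trans ?_
    gcongr with j
    rw [← (prob_compl_eq_zero_iff hYm).1 g.supp]
    exact measure_mono fun y hy => shift_iterate_mem h.shift_mem j hy
  · refine measure_open_le_of_tendsto hμ (isOpen_closeUpTo n 0 (ε / 2) x)
      (Eventually.of_forall fun k => ?_)
    change avgMeasure g.m k {y | CloseUpTo n (ε / 2) x y} ≤ _
    rw [avgMeasure_apply _ _ (A := {y | CloseUpTo n (ε / 2) x y})
      (isOpen_closeUpTo n 0 (ε / 2) x).measurableSet]
    refine le_trans ?_ (inv_mul_sum_const k _).le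
    gcongr with j
    exact g.ball_le j n x hx

/-- The word entropies of a measure with the upper Gibbs bound grow at the maximal rate. -/
theorem SpecSystem.exists_le_partEntropy_word (h : SpecSystem Y f ε) (hf : Measurable f)
    {μ : Measure (ℕ → X)} [IsProbabilityMeasure μ] (hμ : MeasurePreserving shiftSeq μ μ)
    (hμY : μ Yᶜ = 0) {K : ℝ} (hK : 0 < K) (hball : ∀ n, ∀ x ∈ Y,
      μ {y | CloseUpTo n (ε / 2) x y} ≤ ENNReal.ofReal (K * Real.exp (seqSum f n x - n * P)))
    {k : ℕ} {p : X → Fin k} (hp : FinMeas p) (hpd : ∀ x y, p x = p y → dist x y < ε / 2) :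
    ∃ C, ∀ n : ℕ, n * (P - ∫ y, f (y 0, y 1) ∂μ) - C ≤ partEntropy μ (word p (n + 1)) := by
  obtain ⟨C0, hC0⟩ := h.distortion
  obtain ⟨Bf, hBf⟩ := h.bounded
  obtain ⟨x0, hx0⟩ := h.nonempty
  have hε := h.pos
  refine ⟨C0 + Real.log K, fun n => ?_⟩
  have hw : FinMeas (word p (n + 1)) :=
    FinMeas.pi fun i => hp.comp_measurable (measurable_pi_apply (i : ℕ))
  have hrep : ∀ w : Fin (n + 1) → Fin k, ∃ x ∈ Y, (∃ y ∈ Y, word p (n + 1) y = w) →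
      word p (n + 1) x = w := fun w => by
    by_cases hex : ∃ y ∈ Y, word p (n + 1) y = w
    · obtain ⟨y, hy, hyw⟩ := hex
      exact ⟨y, hy, fun _ => hyw⟩
    · exact ⟨x0, hx0, fun h => (hex h).elim⟩
  choose r hrY hr using hrep
  have hclose : ∀ y ∈ Y, CloseUpTo n (ε / 2) (r (word p (n + 1) y)) y := fun y hy i hi => by
    have := congrFun (hr (word p (n + 1) y) ⟨y, hy, rfl⟩) ⟨i, by omega⟩
    exact hpd _ _ this
  have hae : ∀ᵐ y ∂μ, y ∈ Y := measure_eq_zero_iff_ae_notMem.1 hμY |>.mono fun y hy => by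
    simpa using hy
  set F : (Fin (n + 1) → Fin k) → ℝ := fun w => n * P - Real.log K - seqSum f n (r w) with hF
  have hs : Integrable (seqSum f n) μ := Integrable.of_bound
      (measurable_seqSum hf n).aestronglyMeasurable (n * Bf)
      (ae_of_all _ fun y => abs_seqSum_le hBf n y)
  have h1 : ∫ y, F (word p (n + 1) y) ∂μ ≤ partEntropy μ (word p (n + 1)) := by
    rw [hw.integral_eq_sum, partEntropy]
    refine Finset.sum_le_sum fun w _ => ?_
    set t := (μ (word p (n + 1) ⁻¹' {w})).toReal with ht
    rcases (ENNReal.toReal_nonneg : 0 ≤ t).eq_or_lt with h0 | h0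
    · rw [show t = 0 from h0.symm]
      simp
    · have hle : t ≤ K * Real.exp (seqSum f n (r w) - n * P) := by
        refine ENNReal.toReal_le_of_le_ofReal (by positivity) ?_
        refine le_trans (measure_mono (t := {y | CloseUpTo n (ε / 2) (r w) y} ∪ Yᶜ)
          fun y hy => ?_) ((measure_union_le _ _).trans ?_)
        · by_cases hyY : y ∈ Y
          · left
            have := hclose y hyY
            rw [show word p (n + 1) y = w from hy] at this
            exact this
          · exact Or.inr hyY
        · rw [hμY, add_zero]
          exact hball n _ (hrY w)
      have hlog := Real.log_le_log h0 hle
      rw [Real.log_mul hK.ne' (Real.exp_pos _).ne', Real.log_exp] at hlog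
      rw [Real.negMulLog, neg_mul_comm]
      refine mul_le_mul_of_nonneg_left ?_ h0.le
      simp only [hF]
      linarith
  refine le_trans ?_ h1
  have hsub : Integrable (fun y => n * P - Real.log K - C0 - seqSum f n y) μ :=
    (integrable_const _).sub hs
  calc _ = ∫ y, (n * P - Real.log K - C0 - seqSum f n y) ∂μ := by
        rw [integral_sub (integrable_const _) hs, integral_seqSum hf hBf hμ]
        simp
        ring
    _ ≤ _ := by
        refine integral_mono_ae hsub (hw.integrable μ F) ?_
        filter_upwards [hae] with y hy
        have h2 := abs_le.1 (hC0 n _ (hrY (word p (n + 1) y)) y hy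
          ((hclose y hy).mono (by linarith)))
        simp only [hF]
        linarith

end Invariant

section Markov

variable {X : Type*} [MeasurableSpace X]

theorem measurable_snoc (n : ℕ) :
    Measurable fun q : (Fin n → X) × X => (Fin.snoc q.1 q.2 : Fin (n + 1) → X) := by
  refine measurable_pi_iff.2 fun i => ?_
  induction i using Fin.lastCases with
  | last => simpa only [Fin.snoc_last] using measurable_snd
  | cast i =>
    simp only [Fin.snoc_castSucc]
    exact (measurable_pi_apply i).comp measurable_fst

theorem measurable_cons (n : ℕ) :
    Measurable fun q : X × (Fin n → X) => (Fin.cons q.1 q.2 : Fin (n + 1) → X) := by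
  refine measurable_pi_iff.2 fun i => ?_
  induction i using Fin.cases with
  | zero => simpa only [Fin.cons_zero] using measurable_fst
  | succ i =>
    simp only [Fin.cons_succ]
    exact (measurable_pi_apply i).comp measurable_snd

variable {Q : X → Measure X} {μ : Measure X}

theorem IsTransKernel.measurable_map {A B : Type*} [MeasurableSpace A] [MeasurableSpace B]
    (hQ : IsTransKernel Q) {l : A → X} (hl : Measurable l) {s : A × X → B} (hs : Measurable s) :
    Measurable fun x => (Q (l x)).map fun y => s (x, y) := by
  have : ∀ x, IsProbabilityMeasure (Q x) := hQ.2
  let κ : ProbabilityTheory.Kernel A X := ⟨fun x => Q (l x), hQ.1.comp hl⟩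
  have hκ : ProbabilityTheory.IsMarkovKernel κ := ⟨fun x => hQ.2 (l x)⟩
  have h2 := ((ProbabilityTheory.Kernel.prod ProbabilityTheory.Kernel.id κ).map s).measurable
  convert h2 using 2 with x
  rw [ProbabilityTheory.Kernel.map_apply _ hs, ProbabilityTheory.Kernel.prod_apply,
    ProbabilityTheory.Kernel.id_apply, Measure.dirac_prod, Measure.map_map hs
    measurable_prodMk_left]
  rfl

theorem IsTransKernel.measurable_lintegral {A : Type*} [MeasurableSpace A]
    (hQ : IsTransKernel Q) {l : A → X} (hl : Measurable l) {F : A × X → ℝ≥0∞} (hF : Measurable F) :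
    Measurable fun x => ∫⁻ y, F (x, y) ∂Q (l x) := by
  let κ : ProbabilityTheory.Kernel A X := ⟨fun x => Q (l x), hQ.1.comp hl⟩
  have hκ : ProbabilityTheory.IsMarkovKernel κ := ⟨fun x => hQ.2 (l x)⟩
  exact hF.lintegral_kernel_prod_right' (κ := κ)

theorem IsTransKernel.measurable_lintegral_snoc (hQ : IsTransKernel Q) (n : ℕ)
    {F : (Fin (n + 2) → X) → ℝ≥0∞} (hF : Measurable F) :
    Measurable fun x : Fin (n + 1) → X => ∫⁻ y, F (Fin.snoc x y) ∂(Q (x (Fin.last n))) :=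
  hQ.measurable_lintegral (measurable_pi_apply (Fin.last n)) (hF.comp (measurable_snoc (n + 1)))

theorem IsTransKernel.measurable_lintegral_cons (hQ : IsTransKernel Q) (n : ℕ)
    {F : (Fin (n + 2) → X) → ℝ≥0∞} (hF : Measurable F) :
    Measurable fun x : Fin (n + 1) → X => ∫⁻ y, F (Fin.cons y x) ∂(Q (x 0)) :=
  hQ.measurable_lintegral (measurable_pi_apply 0)
    (hF.comp ((measurable_cons (n + 1)).comp measurable_swap))

theorem lintegral_markovLaw_succ (hQ : IsTransKernel Q) (n : ℕ) {F : (Fin (n + 2) → X) → ℝ≥0∞}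
    (hF : Measurable F) :
    ∫⁻ x, F x ∂(markovLaw μ Q (n + 1)) =
      ∫⁻ x, ∫⁻ y, F (Fin.snoc x y) ∂(Q (x (Fin.last n))) ∂(markovLaw μ Q n) := by
  rw [markovLaw, Measure.lintegral_bind (hQ.measurable_map (measurable_pi_apply (Fin.last n))
    (measurable_snoc (n + 1))).aemeasurable hF.aemeasurable]
  refine lintegral_congr fun x => ?_
  have hs : Measurable fun y : X => (Fin.snoc x y : Fin (n + 2) → X) :=
    (measurable_snoc (n + 1)).comp measurable_prodMk_left
  rw [lintegral_map hF hs]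

theorem lintegral_markovLaw_zero {F : (Fin 1 → X) → ℝ≥0∞} (hF : Measurable F) :
    ∫⁻ x, F x ∂(markovLaw μ Q 0) = ∫⁻ x, F (fun _ => x) ∂μ := by
  rw [markovLaw, lintegral_map hF (by fun_prop)]

theorem isProbabilityMeasure_markovLaw [IsProbabilityMeasure μ] (hQ : IsTransKernel Q) (n : ℕ) :
    IsProbabilityMeasure (markovLaw μ Q n) := by
  have : ∀ x, IsProbabilityMeasure (Q x) := hQ.2
  induction n with
  | zero => exact Measure.isProbabilityMeasure_map (by fun_prop)
  | succ n ih =>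
    constructor
    have h1 := lintegral_markovLaw_succ (μ := μ) hQ n (F := fun _ => 1) measurable_const
    simpa using h1

theorem map_init_markovLaw (hQ : IsTransKernel Q) (n : ℕ) :
    (markovLaw μ Q (n + 1)).map (fun x (i : Fin (n + 1)) => x i.castSucc) = markovLaw μ Q n := by
  have : ∀ x, IsProbabilityMeasure (Q x) := hQ.2
  refine Measure.ext_of_lintegral _ fun F hF => ?_
  rw [lintegral_map hF (by fun_prop), lintegral_markovLaw_succ hQ n
    (F := fun x => F fun i : Fin (n + 1) => x i.castSucc) (hF.comp (by fun_prop))]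
  simp

/-- The marginals of a Markov chain on an initial segment of times. -/
theorem map_castLE_markovLaw (hQ : IsTransKernel Q) {k n : ℕ} (hkn : k ≤ n) :
    (markovLaw μ Q n).map (fun x (i : Fin (k + 1)) => x (Fin.castLE (by omega) i))
      = markovLaw μ Q k := by
  induction n, hkn using Nat.le_induction with
  | base => simp
  | succ n hkn ih =>
    rw [← ih, ← map_init_markovLaw hQ n, Measure.map_map (by fun_prop) (by fun_prop)]
    rfl

theorem map_tail_markovLaw (hQ : IsTransKernel Q) (hinv : μ.bind Q = μ) (n : ℕ) :
    (markovLaw μ Q (n + 1)).map (fun x (i : Fin (n + 1)) => x i.succ) = markovLaw μ Q n := by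
  induction n with
  | zero =>
    refine Measure.ext_of_lintegral _ fun F hF => ?_
    have hF' : Measurable fun y : X => F fun _ => y := hF.comp (by fun_prop)
    rw [lintegral_map hF (by fun_prop), lintegral_markovLaw_succ hQ 0
      (F := fun x => F fun i : Fin 1 => x i.succ) (hF.comp (by fun_prop)),
      lintegral_markovLaw_zero, lintegral_markovLaw_zero hF]
    · conv_rhs => rw [← hinv, Measure.lintegral_bind hQ.1.aemeasurable hF'.aemeasurable]
      refine lintegral_congr fun x => lintegral_congr fun y => ?_
      congr 1
    · exact hQ.measurable_lintegral_snoc 0 (F := fun x => F fun i : Fin 1 => x i.succ)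
        (hF.comp (by fun_prop))
  | succ n ih =>
    refine Measure.ext_of_lintegral _ fun F hF => ?_
    have hm := hQ.measurable_lintegral_snoc n hF
    rw [lintegral_map hF (by fun_prop), lintegral_markovLaw_succ hQ (n + 1)
      (F := fun x => F fun i : Fin (n + 2) => x i.succ) (hF.comp (by fun_prop)),
      lintegral_markovLaw_succ hQ n hF]
    conv_rhs => rw [← ih, lintegral_map hm (by fun_prop)]
    refine lintegral_congr fun x => lintegral_congr fun y => ?_
    congr 1
    funext i
    induction i using Fin.lastCases with
    | last => simp [Fin.succ_last]
    | cast i => simp [← Fin.castSucc_succ]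

/-- Time reversal: if `R` is a backward kernel for the two-step law, then a Markov trajectory is
obtained by prepending a letter sampled from `R`. -/
theorem lintegral_markovLaw_succ_eq_cons {R : X → Measure X} (hQ : IsTransKernel Q)
    (hR : IsTransKernel R) (hrev : ∀ F : X → X → ℝ≥0∞, Measurable (Function.uncurry F) →
      ∫⁻ x, (∫⁻ y, F x y ∂(Q x)) ∂μ = ∫⁻ y, (∫⁻ x, F x y ∂(R y)) ∂μ) (n : ℕ)
    {F : (Fin (n + 2) → X) → ℝ≥0∞} (hF : Measurable F) :
    ∫⁻ x, F x ∂(markovLaw μ Q (n + 1)) =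
      ∫⁻ z, ∫⁻ x, F (Fin.cons x z) ∂(R (z 0)) ∂(markovLaw μ Q n) := by
  have hQp : ∀ x, IsProbabilityMeasure (Q x) := hQ.2
  have hRp : ∀ x, IsProbabilityMeasure (R x) := hR.2
  induction n with
  | zero =>
    rw [lintegral_markovLaw_succ hQ 0 hF, lintegral_markovLaw_zero
      (hQ.measurable_lintegral_snoc 0 hF), lintegral_markovLaw_zero
      (hR.measurable_lintegral_cons 0 hF)]
    have h1 : ∀ x y : X, (Fin.snoc (fun _ : Fin 1 => x) y : Fin 2 → X) =
        Fin.cons x (fun _ : Fin 1 => y) := fun x y => by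
      funext i
      fin_cases i <;> rfl
    simp only [h1]
    refine hrev (fun x y => F (Fin.cons x fun _ : Fin 1 => y)) (hF.comp ?_)
    exact (measurable_cons 1).comp (measurable_fst.prodMk (by fun_prop))
  | succ n ih =>
    have hm1 := hQ.measurable_lintegral_snoc (n + 1) hF
    have hm2 := hR.measurable_lintegral_cons (n + 1) hF
    rw [lintegral_markovLaw_succ hQ (n + 1) hF]
    refine (ih hm1).trans ?_
    refine Eq.trans ?_ (lintegral_markovLaw_succ hQ n hm2).symm
    refine lintegral_congr fun z => ?_
    have hl : ∀ x : X, (Fin.cons x z : Fin (n + 2) → X) (Fin.last (n + 1)) = z (Fin.last n) :=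
      fun x => by rw [← Fin.succ_last, Fin.cons_succ]
    have h0 : ∀ y : X, (Fin.snoc z y : Fin (n + 2) → X) 0 = z 0 := fun y => by
      rw [← Fin.castSucc_zero, Fin.snoc_castSucc]
    simp only [hl, h0]
    rw [lintegral_lintegral_swap]
    · refine lintegral_congr fun y => lintegral_congr fun x => ?_
      rw [Fin.cons_snoc_eq_snoc_cons]
    · refine Measurable.aemeasurable (hF.comp ?_)
      have h1 : Measurable fun a : X × X => (Fin.cons a.1 z : Fin (n + 2) → X) :=
        (measurable_cons (n + 1)).comp (measurable_fst.prodMk measurable_const)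
      exact (measurable_snoc (n + 2)).comp (h1.prodMk measurable_snd)

theorem map_zero_markovLaw (hQ : IsTransKernel Q) (n : ℕ) :
    (markovLaw μ Q n).map (fun x => x 0) = μ := by
  have := map_castLE_markovLaw (μ := μ) hQ (Nat.zero_le n)
  rw [markovLaw] at this
  have h2 := congrArg (fun ν => Measure.map (fun x : Fin 1 → X => x 0) ν) this
  rw [Measure.map_map (by fun_prop) (by fun_prop), Measure.map_map (by fun_prop) (by fun_prop)]
    at h2
  simpa [Function.comp_def] using h2

end Markov

section Trajectory

variable {X : Type*}

theorem measure_seq_ext [MeasurableSpace X] {ν ν' : Measure (ℕ → X)} [IsFiniteMeasure ν]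
    [IsFiniteMeasure ν']
    (h : ∀ n : ℕ, ν.map (fun x (i : Fin (n + 1)) => x i.val) =
      ν'.map (fun x (i : Fin (n + 1)) => x i.val)) : ν = ν' := by
  have h1 : IsProjectiveLimit ν' (fun I : Finset ℕ => ν'.map I.restrict) := fun I => rfl
  refine IsProjectiveLimit.unique (P := fun I : Finset ℕ => ν'.map I.restrict) (fun I => ?_) h1
  have hI : ∀ i ∈ I, i < I.sup id + 1 := fun i hi =>
    Nat.lt_succ_of_le (Finset.le_sup (f := id) hi)
  have h2 : (I.restrict : (ℕ → X) → (I → X)) = (fun y (i : I) => y ⟨i.1, hI i.1 i.2⟩) ∘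
      (fun x (i : Fin (I.sup id + 1)) => x i.val) := rfl
  simp only [h2]
  rw [← Measure.map_map (by fun_prop) (by fun_prop), h, Measure.map_map (by fun_prop) (by fun_prop)]

variable [MetricSpace X] [CompactSpace X] [MeasurableSpace X] [BorelSpace X]
  {Q : X → Measure X} {μ : Measure X}

theorem exists_isTrajLaw [IsProbabilityMeasure μ] (hQ : IsTransKernel Q) :
    ∃ ν, IsTrajLaw μ Q ν := by
  have hp := fun n => isProbabilityMeasure_markovLaw (μ := μ) hQ n
  let e : ∀ N : ℕ, (Fin (N + 1) → X) → ℕ → X := fun N x i => x ⟨min i N, by omega⟩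
  have he : ∀ N, Measurable (e N) := fun N =>
    measurable_pi_iff.2 fun i => measurable_pi_apply _
  let m : ℕ → ProbabilityMeasure (ℕ → X) := fun N =>
    ⟨(markovLaw μ Q N).map (e N), Measure.isProbabilityMeasure_map (he N).aemeasurable⟩
  obtain ⟨𝒰, ν, h𝒰, hν⟩ := exists_ultrafilter_tendsto m
  refine ⟨ν, inferInstance, fun n => ?_⟩
  have hc : Continuous fun (x : ℕ → X) (i : Fin (n + 1)) => x i.val := by fun_prop
  have h1 := ProbabilityMeasure.tendsto_map_of_tendsto_of_continuous _ _ hν hc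
  let m' : ProbabilityMeasure (Fin (n + 1) → X) := ⟨markovLaw μ Q n, hp n⟩
  have h2 : Tendsto (fun N => (m N).map hc.measurable.aemeasurable) 𝒰 (𝓝 m') := by
    refine tendsto_const_nhds.congr' ?_
    filter_upwards [h𝒰 (eventually_ge_atTop n)] with N hN
    apply Subtype.ext
    change markovLaw μ Q n = ((markovLaw μ Q N).map (e N)).map _
    rw [← map_castLE_markovLaw hQ hN, Measure.map_map hc.measurable (he N)]
    congr 1
    funext x i
    have : min i.val N = i.val := by omega
    simp only [Function.comp, e, this]
    rfl
  have h3 := tendsto_nhds_unique h1 h2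
  exact congrArg Subtype.val h3

variable {ν : Measure (ℕ → X)}

theorem IsTrajLaw.measurePreserving (h : IsTrajLaw μ Q ν) (hQ : IsTransKernel Q)
    (hinv : μ.bind Q = μ) : MeasurePreserving shiftSeq ν ν := by
  have := h.1
  have hs : Measurable (shiftSeq : (ℕ → X) → ℕ → X) := continuous_shiftSeq.measurable
  refine ⟨hs, ?_⟩
  have : IsProbabilityMeasure (ν.map shiftSeq) := Measure.isProbabilityMeasure_map hs.aemeasurable
  refine measure_seq_ext fun n => ?_
  rw [h.2, Measure.map_map (by fun_prop) hs, ← map_tail_markovLaw hQ hinv n, ← h.2,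
    Measure.map_map (by fun_prop) (by fun_prop)]
  rfl

theorem IsTrajLaw.lintegral_pair (h : IsTrajLaw μ Q ν) (hQ : IsTransKernel Q)
    {F : X × X → ℝ≥0∞} (hF : Measurable F) :
    ∫⁻ y, F (y 0, y 1) ∂ν = ∫⁻ x, (∫⁻ y, F (x, y) ∂(Q x)) ∂μ := by
  have h1 : ∫⁻ y, F (y 0, y 1) ∂ν = ∫⁻ x : Fin 2 → X, F (x 0, x 1) ∂(markovLaw μ Q 1) := by
    rw [← h.2 1, lintegral_map (by fun_prop) (by fun_prop)]
    rfl
  rw [h1, lintegral_markovLaw_succ hQ 0 (F := fun x => F (x 0, x 1)) (by fun_prop),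
    lintegral_markovLaw_zero (hQ.measurable_lintegral_snoc 0 (F := fun x => F (x 0, x 1))
      (by fun_prop))]
  rfl

theorem IsTrajLaw.partEntropy_word (h : IsTrajLaw μ Q ν) {k : ℕ} {p : X → Fin k}
    (hp : Measurable p) (n : ℕ) :
    partEntropy (markovLaw μ Q n) (fun x => p ∘ x) = partEntropy ν (word p (n + 1)) := by
  unfold partEntropy
  refine Finset.sum_congr rfl fun w _ => ?_
  rw [← h.2 n, Measure.map_apply (by fun_prop)]
  · rfl
  · have : Measurable fun x : Fin (n + 1) → X => p ∘ x :=
      measurable_pi_iff.2 fun i => hp.comp (measurable_pi_apply i)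
    exact this (measurableSet_singleton w)

theorem IsTrajLaw.map_zero (h : IsTrajLaw μ Q ν) : ν.map (fun y => y 0) = μ := by
  have h1 : (ν.map (fun x (i : Fin 1) => x i.val)).map (fun x => x 0) =
    (markovLaw μ Q 0).map (fun x => x 0) := congrArg _ (h.2 0)
  rw [markovLaw, Measure.map_map (by fun_prop) (by fun_prop),
    Measure.map_map (by fun_prop) (by fun_prop)] at h1
  simpa [Function.comp_def] using h1

variable {T : X → Set X}

theorem IsTrajLaw.measure_compl_orbitSpace (h : IsTrajLaw μ Q ν) (hQ : IsTransKernel Q)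
    (hinv : μ.bind Q = μ) (hT : IsCorrespondence T) (hs : SupportedBy T Q) :
    ν (orbitSpace T)ᶜ = 0 := by
  have hQp : ∀ x, IsProbabilityMeasure (Q x) := hQ.2
  have hG : MeasurableSet {p : X × X | p.2 ∉ T p.1} := hT.2.2.measurableSet.compl
  have h0 : ν {y | y 1 ∉ T (y 0)} = 0 := by
    have h1 := h.lintegral_pair hQ (F := {p : X × X | p.2 ∉ T p.1}.indicator 1)
      (measurable_one.indicator hG)
    have h2 : ∀ x, ∫⁻ y, {p : X × X | p.2 ∉ T p.1}.indicator 1 (x, y) ∂(Q x) = 0 := fun x => by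
      have h3 : (fun y => {p : X × X | p.2 ∉ T p.1}.indicator (1 : X × X → ℝ≥0∞) (x, y)) =
          (T x)ᶜ.indicator 1 := rfl
      rw [h3, lintegral_indicator_one (hT.2.1 x).measurableSet.compl]
      exact (prob_compl_eq_zero_iff (hT.2.1 x).measurableSet).2 (hs x)
    simp only [h2, lintegral_zero] at h1
    have h4 : (fun y : ℕ → X => {p : X × X | p.2 ∉ T p.1}.indicator (1 : X × X → ℝ≥0∞)
      (y 0, y 1)) = {y : ℕ → X | y 1 ∉ T (y 0)}.indicator 1 := rfl
    rwa [h4, lintegral_indicator_one] at h1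
    exact (by fun_prop : Measurable fun y : ℕ → X => (y 0, y 1)) hG
  have hmp := h.measurePreserving hQ hinv
  have h5 : (orbitSpace T)ᶜ ⊆ ⋃ k, shiftSeq^[k] ⁻¹' {y | y 1 ∉ T (y 0)} := fun y hy => by
    simp only [orbitSpace, mem_compl_iff, mem_ofPred_eq, not_forall] at hy
    obtain ⟨k, hk⟩ := hy
    refine mem_iUnion.2 ⟨k, ?_⟩
    simpa [shiftSeq_iterate, add_comm 1] using hk
  refine measure_mono_null h5 (measure_iUnion_null fun k => ?_)
  exact (hmp.iterate k).quasiMeasurePreserving.preimage_null h0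

theorem IsTrajLaw.map_pair [SFinite μ] (h : IsTrajLaw μ Q ν) (hQ : IsTransKernel Q) :
    ν.map (fun y => (y 0, y 1)) = μ.compProd ⟨Q, hQ.1⟩ := by
  have : ProbabilityTheory.IsMarkovKernel (⟨Q, hQ.1⟩ : ProbabilityTheory.Kernel X X) := ⟨hQ.2⟩
  refine Measure.ext_of_lintegral _ fun F hF => ?_
  rw [lintegral_map hF (by fun_prop), h.lintegral_pair hQ hF, Measure.lintegral_compProd hF]
  rfl

theorem IsTrajLaw.integral_eq_energyInt [IsProbabilityMeasure μ] (h : IsTrajLaw μ Q ν)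
    (hQ : IsTransKernel Q) (hT : IsCorrespondence T) (hs : SupportedBy T Q)
    {φ : ↥(graph2 T) → ℝ} (hf : Measurable (ext2 T φ)) {B : ℝ} (hB : ∀ p, |ext2 T φ p| ≤ B) :
    ∫ y, ext2 T φ (y 0, y 1) ∂ν = energyInt T φ Q μ := by
  have hQp : ∀ x, IsProbabilityMeasure (Q x) := hQ.2
  have : ProbabilityTheory.IsMarkovKernel (⟨Q, hQ.1⟩ : ProbabilityTheory.Kernel X X) := ⟨hQ.2⟩
  have h1 : ∀ x, (Q x).restrict (T x) = Q x := fun x =>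
    Measure.restrict_eq_self_of_ae_mem ((prob_compl_eq_zero_iff (hT.2.1 x).measurableSet).2 (hs x))
  unfold energyInt
  simp only [h1]
  have h2 : ∫ p, ext2 T φ p ∂(ν.map fun y => (y 0, y 1)) = ∫ y, ext2 T φ (y 0, y 1) ∂ν :=
    integral_map (by fun_prop) hf.aestronglyMeasurable
  rw [← h2, h.map_pair hQ, Measure.integral_compProd]
  · rfl
  · exact Integrable.of_bound hf.aestronglyMeasurable B (ae_of_all _ fun y => hB _)

end Trajectory

section KernelEntropy

theorem partEntropy_nonneg {Ω : Type*} [MeasurableSpace Ω] (ν : Measure Ω) [IsProbabilityMeasure ν]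
    {I : Type*} [Fintype I] (p : Ω → I) : 0 ≤ partEntropy ν p :=
  Finset.sum_nonneg fun _ _ => Real.negMulLog_nonneg ENNReal.toReal_nonneg
    (ENNReal.toReal_le_of_le_ofReal zero_le_one (by simpa using prob_le_one))

theorem tendsto_affine_div (a C : ℝ) :
    Tendsto (fun n : ℕ => (n : ℝ)⁻¹ * (n * a + C)) atTop (𝓝 a) := by
  have h1 : Tendsto (fun n : ℕ => a + C * (n : ℝ)⁻¹) atTop (𝓝 (a + C * 0)) :=
    (tendsto_inv_atTop_nhds_zero_nat.const_mul C).const_add a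
  rw [mul_zero, add_zero] at h1
  refine h1.congr' ?_
  filter_upwards [eventually_gt_atTop 0] with n hn
  have : (n : ℝ) ≠ 0 := by exact_mod_cast hn.ne'
  field_simp

variable {X : Type*} [MetricSpace X] [CompactSpace X] [MeasurableSpace X] [BorelSpace X]
  {Y : Set (ℕ → X)} {f : X × X → ℝ} {ε P : ℝ} {μ : Measure X} {Q : X → Measure X}
  {ν : Measure (ℕ → X)}

namespace GibbsCells

theorem exists_word_le (g : GibbsCells Y f ε P) (h : SpecSystem Y f ε) (hf : Measurable f)
    [IsProbabilityMeasure ν]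
    (hν : MeasurePreserving shiftSeq ν ν) (hνY : ν Yᶜ = 0) {m : ℕ} {p : X → Fin m}
    (hp : FinMeas p) {η : ℝ} (hη : 0 < η) :
    ∃ C, ∀ N : ℕ, partEntropy ν (word p N) ≤ N * (P - ∫ y, f (y 0, y 1) ∂ν + η) + C := by
  obtain ⟨C', hC'⟩ := g.exists_partEntropy_word_le h hf
  obtain ⟨n, hn⟩ := exists_nat_gt (C' / (η / 2))
  have hn0 : (0 : ℝ) < (n + 1 : ℕ) := by positivity
  obtain ⟨C, hC⟩ := hC' ν hν hνY (n + 1) (by omega) ∅ 1 one_pos (by simp) p hp (η / 2) (by linarith)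
  refine ⟨C, fun N => (hC N).trans ?_⟩
  have h1 : (C' + ν.real (g.cell (n + 1) ⁻¹' ((∅ : Finset (Fin (g.card (n + 1)))) : Set _)) *
      Real.log 1) / (n + 1 : ℕ) ≤ η / 2 := by
    rw [Real.log_one, mul_zero, add_zero, div_le_iff₀ hn0]
    rw [div_lt_iff₀ (by linarith)] at hn
    push_cast
    nlinarith
  refine add_le_add (mul_le_mul_of_nonneg_left ?_ N.cast_nonneg) le_rfl
  linarith

section Traj

variable (g : GibbsCells Y f ε P) (h : SpecSystem Y f ε) (hf : Measurable f) (hQ : IsTransKernel Q)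
  (hinv : μ.bind Q = μ) (hν : IsTrajLaw μ Q ν) (hνY : ν Yᶜ = 0)

include g h hf hQ hinv hν hνY

theorem entropyRate_bounds {m : ℕ} {p : X → Fin m} (hp : Measurable p) {η : ℝ} (hη : 0 < η) :
    ∃ C, ∀ n : ℕ, 1 ≤ n → (n : ℝ)⁻¹ * partEntropy (markovLaw μ Q (n - 1)) (fun x => p ∘ x) ≤
      (n : ℝ)⁻¹ * (n * (P - ∫ y, f (y 0, y 1) ∂ν + η) + C) := by
  have := hν.1
  obtain ⟨C, hC⟩ := g.exists_word_le h hf (hν.measurePreserving hQ hinv) hνY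
    (fun x => hp (measurableSet_singleton x)) hη (p := p)
  refine ⟨C, fun n hn => ?_⟩
  rw [hν.partEntropy_word hp, Nat.sub_add_cancel hn]
  exact mul_le_mul_of_nonneg_left (hC n) (by positivity)

omit g h hf hinv hνY in
theorem entropyRate_nonneg {m : ℕ} {p : X → Fin m} (hp : Measurable p) (n : ℕ) :
    0 ≤ (n : ℝ)⁻¹ * partEntropy (markovLaw μ Q (n - 1)) (fun x => p ∘ x) := by
  have := hν.1
  rw [hν.partEntropy_word hp]
  exact mul_nonneg (by positivity) (partEntropy_nonneg _ _)

theorem isBoundedUnder_entropyRate {m : ℕ} {p : X → Fin m} (hp : Measurable p) :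
    IsBoundedUnder (· ≤ ·) atTop fun n : ℕ =>
      (n : ℝ)⁻¹ * partEntropy (markovLaw μ Q (n - 1)) (fun x => p ∘ x) := by
  obtain ⟨C, hC⟩ := g.entropyRate_bounds h hf hQ hinv hν hνY hp one_pos
  refine (tendsto_affine_div (P - ∫ y, f (y 0, y 1) ∂ν + 1) C).isBoundedUnder_le.mono_le ?_
  filter_upwards [eventually_ge_atTop 1] with n hn using hC n hn

omit g h hf hinv hνY in
theorem isCoboundedUnder_entropyRate {m : ℕ} {p : X → Fin m} (hp : Measurable p) :
    IsCoboundedUnder (· ≤ ·) atTop fun n : ℕ =>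
      (n : ℝ)⁻¹ * partEntropy (markovLaw μ Q (n - 1)) (fun x => p ∘ x) :=
  isCoboundedUnder_le_of_le atTop fun n => entropyRate_nonneg hQ hν hp n

theorem kernelEntropy_le : kernelEntropy μ Q ≤ ((P - ∫ y, f (y 0, y 1) ∂ν : ℝ) : EReal) := by
  refine iSup_le fun m => iSup_le fun p => iSup_le fun hp => ?_
  rw [EReal.coe_le_coe_iff]
  refine le_of_forall_pos_le_add fun η hη => ?_
  obtain ⟨C, hC⟩ := g.entropyRate_bounds h hf hQ hinv hν hνY hp hη
  rw [← (tendsto_affine_div (P - ∫ y, f (y 0, y 1) ∂ν + η) C).limsup_eq]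
  refine limsup_le_limsup ?_ (isCoboundedUnder_entropyRate hQ hν hp)
    (tendsto_affine_div _ C).isBoundedUnder_le
  filter_upwards [eventually_ge_atTop 1] with n hn using hC n hn

theorem le_kernelEntropy {m : ℕ} {p : X → Fin m} (hp : Measurable p) {a C : ℝ}
    (ha : ∀ n : ℕ, n * a - C ≤ partEntropy (markovLaw μ Q n) (fun x => p ∘ x)) :
    (a : EReal) ≤ kernelEntropy μ Q := by
  refine le_iSup_of_le m (le_iSup_of_le p (le_iSup_of_le hp ?_))
  rw [EReal.coe_le_coe_iff, ← (tendsto_affine_div a (-a - C)).limsup_eq]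
  refine limsup_le_limsup ?_ (tendsto_affine_div a (-a - C)).isCoboundedUnder_le
    (g.isBoundedUnder_entropyRate h hf hQ hinv hν hνY hp)
  filter_upwards [eventually_ge_atTop 1] with n hn
  refine mul_le_mul_of_nonneg_left ?_ (by positivity)
  have := ha (n - 1)
  rw [Nat.cast_sub hn] at this
  push_cast at this
  linarith

/-- A stationary Markov chain realizing the pressure has a trajectory law absolutely continuous
with respect to the Gibbs measure. -/
theorem absolutelyContinuous_of_le_kernelEntropy
    (heq : ((P - ∫ y, f (y 0, y 1) ∂ν : ℝ) : EReal) ≤ kernelEntropy μ Q) : ν ≪ g.m := by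
  have := hν.1
  refine g.absolutelyContinuous_of_frequently h hf ν (hν.measurePreserving hQ hinv) hνY
    fun η hη => ?_
  have h1 : ((P - ∫ y, f (y 0, y 1) ∂ν - η : ℝ) : EReal) < kernelEntropy μ Q :=
    lt_of_lt_of_le (EReal.coe_lt_coe_iff.2 (by linarith)) heq
  obtain ⟨m, h1⟩ := lt_iSup_iff.1 h1
  obtain ⟨p, h1⟩ := lt_iSup_iff.1 h1
  obtain ⟨hp, h1⟩ := lt_iSup_iff.1 h1
  rw [EReal.coe_lt_coe_iff] at h1
  refine ⟨m, p, fun x => hp (measurableSet_singleton x), ?_⟩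
  refine ((frequently_lt_of_lt_limsup (isCoboundedUnder_entropyRate hQ hν hp) h1).and_eventually
    (eventually_ge_atTop 1)).mono fun n hn => ?_
  have hn0 : (0 : ℝ) < n := by exact_mod_cast hn.2
  have h2 := hn.1
  rw [hν.partEntropy_word hp, Nat.sub_add_cancel hn.2, inv_mul_eq_div, lt_div_iff₀ hn0] at h2
  linarith

end Traj

end GibbsCells

end KernelEntropy

section Selection

/-- A closed-valued correspondence with closed graph on a compact metric space has a Borel
selection. -/
theorem exists_measurable_selection {X : Type*} [MetricSpace X] [CompactSpace X]
    [MeasurableSpace X] [BorelSpace X] {T : X → Set X} (hT : IsCorrespondence T) :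
    ∃ s : X → X, Measurable s ∧ ∀ x, s x ∈ T x := by
  cases isEmpty_or_nonempty X with
  | inl hX => exact ⟨id, measurable_id, fun x => (hX.false x).elim⟩
  | inr hX =>
  obtain ⟨π', hπ'c, hπ's⟩ := exists_nat_bool_continuous_surjective_of_compact X
  let π : cantorSet → X := π' ∘ cantorSetHomeomorphNatToBool
  have hπc : Continuous π := hπ'c.comp cantorSetHomeomorphNatToBool.continuous
  have hπs : Function.Surjective π := hπ's.comp cantorSetHomeomorphNatToBool.surjective
  have hK : CompactSpace cantorSet := isCompact_iff_compactSpace.1 isCompact_cantorSet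
  have hex : ∀ x, ∃ k : cantorSet, π k ∈ T x ∧ ∀ j, π j ∈ T x → (k : ℝ) ≤ j := fun x => by
    have h1 : IsCompact (π ⁻¹' T x) := ((hT.2.1 x).preimage hπc).isCompact
    obtain ⟨y, hy⟩ := hT.1 x
    obtain ⟨k, rfl⟩ := hπs y
    obtain ⟨k, hk, hk'⟩ := h1.exists_isMinOn ⟨k, hy⟩ continuous_subtype_val.continuousOn
    exact ⟨k, hk, fun j hj => hk' hj⟩
  choose m hm hmin using hex
  have hmm : Measurable m := by
    suffices hmr : Measurable fun x => (m x : ℝ) from hmr.subtype_mk (h := fun x => (m x).2)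
    refine measurable_of_Iic fun c => ?_
    have h1 : (fun x => (m x : ℝ)) ⁻¹' Iic c =
        Prod.fst '' {q : X × cantorSet | π q.2 ∈ T q.1 ∧ (q.2 : ℝ) ≤ c} := by
      ext x
      refine ⟨fun hx => ⟨(x, m x), ⟨hm x, hx⟩, rfl⟩, ?_⟩
      rintro ⟨⟨x, k⟩, ⟨hk, hkc⟩, rfl⟩
      exact (hmin x k hk).trans hkc
    rw [h1]
    have h2 : IsClosed {q : X × cantorSet | π q.2 ∈ T q.1 ∧ (q.2 : ℝ) ≤ c} := by
      refine IsClosed.inter ?_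
        (isClosed_le (continuous_subtype_val.comp continuous_snd) continuous_const)
      exact hT.2.2.preimage (continuous_fst.prodMk (hπc.comp continuous_snd))
    exact (h2.isCompact.image continuous_fst).isClosed.measurableSet
  exact ⟨fun x => π (m x), hπc.measurable.comp hmm, hm⟩

variable {X : Type*} [MetricSpace X] [CompactSpace X] [MeasurableSpace X] [BorelSpace X]

theorem exists_transKernel_eq_compProd (ρ : Measure (X × X)) [IsProbabilityMeasure ρ] :
    ∃ (R : X → Measure X) (hR : IsTransKernel R), ρ = ρ.fst.compProd ⟨R, hR.1⟩ := by
  obtain ⟨x⟩ : Nonempty (X × X) := nonempty_of_isProbabilityMeasure ρ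
  have : Nonempty X := ⟨x.1⟩
  exact ⟨fun x => ρ.condKernel x, ⟨ρ.condKernel.measurable, fun x => inferInstance⟩,
    (ρ.disintegrate ρ.condKernel).symm⟩

/-- Disintegration along kernels supported by a correspondence. -/
theorem exists_supportedBy_eq_compProd {T : X → Set X} (hT : IsCorrespondence T)
    (ρ : Measure (X × X)) [IsProbabilityMeasure ρ] (hρ : ρ (graph2 T)ᶜ = 0) :
    ∃ (Q : X → Measure X) (hQ : IsTransKernel Q), SupportedBy T Q ∧
      ρ = ρ.fst.compProd ⟨Q, hQ.1⟩ := by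
  obtain ⟨R, hR, hρR⟩ := exists_transKernel_eq_compProd ρ
  have hRp := hR.2
  have : ProbabilityTheory.IsMarkovKernel (⟨R, hR.1⟩ : ProbabilityTheory.Kernel X X) := ⟨hR.2⟩
  obtain ⟨s, hs, hsT⟩ := exists_measurable_selection hT
  have hG : MeasurableSet (graph2 T)ᶜ := hT.2.2.measurableSet.compl
  have hm : Measurable fun x => R x (T x)ᶜ :=
    ProbabilityTheory.Kernel.measurable_kernel_prodMk_left
      (κ := (⟨R, hR.1⟩ : ProbabilityTheory.Kernel X X)) hG
  have h0 : ∀ᵐ x ∂ρ.fst, R x (T x)ᶜ = 0 := by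
    rw [hρR, Measure.compProd_apply hG] at hρ
    exact (lintegral_eq_zero_iff hm).1 hρ
  let Q : X → Measure X := fun x => if R x (T x)ᶜ = 0 then R x else Measure.dirac (s x)
  have hQ : IsTransKernel Q := by
    refine ⟨Measurable.ite (hm (measurableSet_singleton 0)) hR.1
      (Measure.measurable_dirac.comp hs), fun x => ?_⟩
    simp only [Q]
    split_ifs
    · exact hRp x
    · infer_instance
  have : ProbabilityTheory.IsMarkovKernel (⟨Q, hQ.1⟩ : ProbabilityTheory.Kernel X X) := ⟨hQ.2⟩
  refine ⟨Q, hQ, fun x => ?_, ?_⟩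
  · simp only [Q]
    split_ifs with hx
    · exact (prob_compl_eq_zero_iff (hT.2.1 x).measurableSet).1 hx
    · exact Measure.dirac_apply_of_mem (hsT x)
  · conv_lhs => rw [hρR]
    refine Measure.compProd_congr ?_
    filter_upwards [h0] with x hx
    change R x = Q x
    simp only [Q]
    rw [if_pos hx]

end Selection

section EntropyGain

theorem negMulLog_le_one {x : ℝ} (hx : 0 ≤ x) : Real.negMulLog x ≤ 1 := by
  rcases hx.eq_or_lt with rfl | hx
  · simp
  have h1 := Real.one_sub_inv_le_log_of_pos hx
  have h2 := mul_le_mul_of_nonneg_left h1 hx.le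
  rw [mul_sub, mul_inv_cancel₀ hx.ne'] at h2
  rw [Real.negMulLog]
  linarith

theorem integrable_negMulLog {Z : Type*} [MeasurableSpace Z] (M : Measure Z) [IsFiniteMeasure M]
    {r : Z → ℝ} (hr : Measurable r) (h0 : ∀ z, 0 ≤ r z) (h1 : ∀ z, r z ≤ 1) :
    Integrable (fun z => Real.negMulLog (r z)) M :=
  Integrable.of_bound (Real.continuous_negMulLog.measurable.comp hr).aestronglyMeasurable 1
    (ae_of_all _ fun z => by
      rw [Real.norm_of_nonneg (Real.negMulLog_nonneg (h0 z) (h1 z))]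
      exact negMulLog_le_one (h0 z))

theorem negMulLog_add_setIntegral_le {Z A : Type*} [MeasurableSpace Z] [Fintype A] (M : Measure Z)
    [IsFiniteMeasure M] {r : A → Z → ℝ} (hr : ∀ a, Measurable (r a)) (h0 : ∀ a z, 0 ≤ r a z)
    (hsum : ∀ z, ∑ a, r a z = 1) (s : Set Z) :
    Real.negMulLog (M.real s) + ∫ z in s, ∑ a, Real.negMulLog (r a z) ∂M ≤
      ∑ a, Real.negMulLog (∫ z in s, r a z ∂M) := by
  have h1 : ∀ a z, r a z ≤ 1 := fun a z => by
    rw [← hsum z]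
    exact Finset.single_le_sum (fun a _ => h0 a z) (Finset.mem_univ a)
  by_cases hs : M s = 0
  · simp [Measure.restrict_eq_zero.2 hs, measureReal_def, hs]
  have hm : M.real s ≠ 0 := (measureReal_ne_zero_iff (measure_ne_top M s)).2 hs
  have hInt : ∀ a, IntegrableOn (r a) s M := fun a =>
    (Integrable.of_bound (hr a).aestronglyMeasurable 1
      (ae_of_all _ fun z => by rw [Real.norm_of_nonneg (h0 a z)]; exact h1 a z)).integrableOn
  have hInt' : ∀ a, IntegrableOn (fun z => Real.negMulLog (r a z)) s M := fun a =>
    (integrable_negMulLog M (hr a) (h0 a) (h1 a)).integrableOn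
  set q : A → ℝ := fun a => ⨍ z in s, r a z ∂M
  have hq' : ∀ a, ∫ z in s, r a z ∂M = M.real s * q a := fun a => by
    rw [show q a = ⨍ z in s, r a z ∂M from rfl, setAverage_eq, smul_eq_mul,
      mul_inv_cancel_left₀ hm]
  have hqs : ∑ a, q a = 1 := by
    have : M.real s * ∑ a, q a = M.real s := by
      rw [Finset.mul_sum, ← Finset.sum_congr rfl fun a _ => hq' a,
        ← integral_finsetSum _ fun a _ => hInt a]
      simp [hsum]
    exact mul_left_cancel₀ hm (by rw [this, mul_one])
  have hJ : ∀ a, ∫ z in s, Real.negMulLog (r a z) ∂M ≤ M.real s * Real.negMulLog (q a) :=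
    fun a => by
    have := Real.concaveOn_negMulLog.le_map_set_average
      Real.continuous_negMulLog.continuousOn isClosed_Ici hs (measure_ne_top M s)
      (ae_of_all _ fun z => h0 a z) (hInt a) (hInt' a)
    rw [setAverage_eq, smul_eq_mul] at this
    have h3 := mul_le_mul_of_nonneg_left this (measureReal_nonneg (μ := M) (s := s))
    rwa [mul_inv_cancel_left₀ hm] at h3
  rw [integral_finsetSum _ fun a _ => hInt' a]
  simp_rw [hq', Real.negMulLog_mul]
  rw [Finset.sum_add_distrib, ← Finset.sum_mul, hqs, one_mul]
  exact add_le_add le_rfl (Finset.sum_le_sum fun a _ => hJ a)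

/-- Refining a finite partition by a random choice of letters raises the entropy at least by the
mean conditional entropy of the letters. -/
theorem partEntropy_add_integral_le {Z W A : Type*} [MeasurableSpace Z] [Fintype A] [Fintype W]
    (M : Measure Z) [IsFiniteMeasure M] {q : Z → W} (hq : FinMeas q) {r : A → Z → ℝ}
    (hr : ∀ a, Measurable (r a)) (h0 : ∀ a z, 0 ≤ r a z) (hsum : ∀ z, ∑ a, r a z = 1) :
    partEntropy M q + ∫ z, ∑ a, Real.negMulLog (r a z) ∂M ≤
      ∑ w, ∑ a, Real.negMulLog (∫ z in q ⁻¹' {w}, r a z ∂M) := by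
  have h1 : ∀ a z, r a z ≤ 1 := fun a z => by
    rw [← hsum z]
    exact Finset.single_le_sum (fun a _ => h0 a z) (Finset.mem_univ a)
  have hInt : Integrable (fun z => ∑ a, Real.negMulLog (r a z)) M :=
    integrable_finsetSum _ fun a _ => integrable_negMulLog M (hr a) (h0 a) (h1 a)
  have hU : (⋃ w, q ⁻¹' {w}) = univ := by ext; simp
  have h2 : ∫ z, ∑ a, Real.negMulLog (r a z) ∂M =
      ∑ w, ∫ z in q ⁻¹' {w}, ∑ a, Real.negMulLog (r a z) ∂M := by
    rw [← setIntegral_univ, ← hU, integral_iUnion_fintype hq _ fun w => hInt.integrableOn]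
    intro w w' hne
    exact Disjoint.preimage q (by simpa using hne)
  rw [partEntropy, h2, ← Finset.sum_add_distrib]
  exact Finset.sum_le_sum fun w _ => negMulLog_add_setIntegral_le M hr h0 hsum _

end EntropyGain

section MarkovEntropy

variable {X : Type*} [MeasurableSpace X] {μ : Measure X} {Q R : X → Measure X}

/-- The entropy of a finite partition under the values of a kernel. -/
noncomputable def stepEntropy (μ : Measure X) (R : X → Measure X) {k : ℕ} (p : X → Fin k) : ℝ :=
  ∫ y, ∑ a, Real.negMulLog ((R y (p ⁻¹' {a})).toReal) ∂μ

theorem IsTransKernel.measurable_toReal (hR : IsTransKernel R) {s : Set X} (hs : MeasurableSet s) :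
    Measurable fun y => (R y s).toReal :=
  ((Measure.measurable_coe hs).comp hR.1).ennreal_toReal

theorem IsTransKernel.sum_toReal (hR : IsTransKernel R) {k : ℕ} {p : X → Fin k} (hp : FinMeas p)
    (y : X) : ∑ a, (R y (p ⁻¹' {a})).toReal = 1 := by
  have := hR.2 y
  have h := hp.integral_eq_sum (R y) (fun _ => 1)
  simpa using h.symm

theorem partEntropy_markovLaw_succ [IsProbabilityMeasure μ] (hQ : IsTransKernel Q)
    (hR : IsTransKernel R) (hrev : ∀ F : X → X → ℝ≥0∞, Measurable (Function.uncurry F) →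
      ∫⁻ x, (∫⁻ y, F x y ∂(Q x)) ∂μ = ∫⁻ y, (∫⁻ x, F x y ∂(R y)) ∂μ)
    {k : ℕ} {p : X → Fin k} (hp : Measurable p) (n : ℕ) :
    partEntropy (markovLaw μ Q n) (fun x => p ∘ x) + stepEntropy μ R p ≤
      partEntropy (markovLaw μ Q (n + 1)) (fun x => p ∘ x) := by
  have hRp : ∀ x, IsProbabilityMeasure (R x) := hR.2
  have hM := isProbabilityMeasure_markovLaw (μ := μ) hQ n
  have hpf : FinMeas p := fun a => hp (measurableSet_singleton a)
  have hword : ∀ m : ℕ, FinMeas fun x : Fin m → X => p ∘ x := fun m =>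
    FinMeas.pi fun i => hpf.comp_measurable (measurable_pi_apply i)
  have h1 := partEntropy_add_integral_le (markovLaw μ Q n) (hword (n + 1))
    (r := fun a z => (R (z 0) (p ⁻¹' {a})).toReal)
    (fun a => (hR.measurable_toReal (hpf a)).comp (measurable_pi_apply 0))
    (fun a z => ENNReal.toReal_nonneg) (fun z => hR.sum_toReal hpf (z 0))
  have h2 : ∫ z, ∑ a, Real.negMulLog ((R (z 0) (p ⁻¹' {a})).toReal) ∂(markovLaw μ Q n) =
      stepEntropy μ R p := by
    have hm : Measurable fun y => ∑ a, Real.negMulLog ((R y (p ⁻¹' {a})).toReal) :=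
      Finset.measurable_sum _ fun a _ =>
        Real.continuous_negMulLog.measurable.comp (hR.measurable_toReal (hpf a))
    rw [stepEntropy]
    conv_rhs => rw [← map_zero_markovLaw (μ := μ) hQ n]
    rw [integral_map (measurable_pi_apply 0).aemeasurable hm.aestronglyMeasurable]
  rw [h2] at h1
  refine h1.trans (le_of_eq ?_)
  rw [partEntropy, ← Equiv.sum_comp (Fin.consEquiv fun _ : Fin (n + 2) => Fin k),
    Fintype.sum_prod_type_right]
  refine Finset.sum_congr rfl fun w _ => Finset.sum_congr rfl fun a _ => ?_
  congr 1
  have h3 : markovLaw μ Q (n + 1) ((fun x => p ∘ x) ⁻¹' {Fin.cons a w}) =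
      ∫⁻ z in (fun x => p ∘ x) ⁻¹' {w}, R (z 0) (p ⁻¹' {a}) ∂(markovLaw μ Q n) := by
    rw [← lintegral_indicator_one (hword (n + 2) _), lintegral_markovLaw_succ_eq_cons hQ hR hrev n
      (measurable_one.indicator (hword (n + 2) _)), ← lintegral_indicator (hword (n + 1) _)]
    refine lintegral_congr fun z => ?_
    have h4 : ∀ x : X, ((fun x => p ∘ x) ⁻¹' {(Fin.cons a w : Fin (n + 2) → Fin k)}).indicator
        (1 : (Fin (n + 2) → X) → ℝ≥0∞) (Fin.cons x z) =
        ((fun x => p ∘ x) ⁻¹' {w}).indicator (fun _ => (p ⁻¹' {a}).indicator 1 x) z := fun x => by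
      have : (p ∘ (Fin.cons x z : Fin (n + 2) → X)) = Fin.cons (p x) (p ∘ z) := by
        funext i; refine Fin.cases ?_ (fun i => ?_) i <;> simp
      simp only [indicator, mem_preimage, this, mem_singleton_iff, Fin.cons_inj, Pi.one_apply]
      by_cases h5 : p x = a <;> by_cases h6 : p ∘ z = w <;> simp [h5, h6]
    simp_rw [h4]
    by_cases h6 : p ∘ z = w
    · rw [indicator_of_mem (by simpa using h6)]
      simp_rw [indicator_of_mem (show z ∈ (fun x => p ∘ x) ⁻¹' {w} by simpa using h6)]
      exact lintegral_indicator_one (hpf a)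
    · rw [indicator_of_notMem (by simpa using h6)]
      simp_rw [indicator_of_notMem (show z ∉ (fun x => p ∘ x) ⁻¹' {w} by simpa using h6)]
      simp
  have h5 := integral_toReal (μ := (markovLaw μ Q n).restrict ((fun x => p ∘ x) ⁻¹' {w}))
    (f := fun z => R (z 0) (p ⁻¹' {a}))
    (((Measure.measurable_coe (hpf a)).comp hR.1).comp (measurable_pi_apply 0)).aemeasurable
    (ae_of_all _ fun z => measure_lt_top _ _)
  rw [h5, ← h3]
  rfl

theorem nsmul_stepEntropy_le [IsProbabilityMeasure μ] (hQ : IsTransKernel Q)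
    (hR : IsTransKernel R) (hrev : ∀ F : X → X → ℝ≥0∞, Measurable (Function.uncurry F) →
      ∫⁻ x, (∫⁻ y, F x y ∂(Q x)) ∂μ = ∫⁻ y, (∫⁻ x, F x y ∂(R y)) ∂μ)
    {k : ℕ} {p : X → Fin k} (hp : Measurable p) (n : ℕ) :
    n * stepEntropy μ R p ≤ partEntropy (markovLaw μ Q n) (fun x => p ∘ x) := by
  have := fun n => isProbabilityMeasure_markovLaw (μ := μ) hQ n
  induction n with
  | zero => simpa using partEntropy_nonneg _ _
  | succ n ih =>
    have := partEntropy_markovLaw_succ hQ hR hrev hp n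
    push_cast
    linarith

end MarkovEntropy

section Existence

/-- A smoothed quantization of a probability vector loses little cross entropy. -/
theorem sum_mul_neg_log_quantize_le {k L : ℕ} (hL : 0 < L) {r : Fin k → ℝ} (h0 : ∀ a, 0 ≤ r a)
    (hsum : ∑ a, r a = 1) {b : Fin k → ℕ} (hb1 : ∀ a, L * r a ≤ b a + 1)
    (hb2 : ∀ a, b a ≤ L * r a) :
    ∑ a, r a * -Real.log (((b a : ℝ) + 1) / ∑ a', ((b a' : ℝ) + 1)) ≤
      ∑ a, Real.negMulLog (r a) + k / L := by
  have hL' : (0 : ℝ) < L := by exact_mod_cast hL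
  have hS : ∑ a', ((b a' : ℝ) + 1) ≤ L + k := by
    rw [Finset.sum_add_distrib]
    refine add_le_add ((Finset.sum_le_sum fun a _ => hb2 a).trans ?_) (by simp)
    rw [← Finset.mul_sum, hsum, mul_one]
  have hkey : ∀ a, r a * -Real.log (((b a : ℝ) + 1) / ∑ a', ((b a' : ℝ) + 1)) ≤
      Real.negMulLog (r a) + r a * (k / L) := fun a => by
    rcases (h0 a).eq_or_lt with ha | ha
    · simp [← ha]
    have hb0 : (0 : ℝ) < (b a : ℝ) + 1 := by positivity
    have hS0 : 0 < ∑ a', ((b a' : ℝ) + 1) :=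
      Finset.sum_pos (fun a _ => by positivity) ⟨a, Finset.mem_univ a⟩
    have h1 : L * r a / (L + k) ≤ ((b a : ℝ) + 1) / ∑ a', ((b a' : ℝ) + 1) :=
      div_le_div₀ hb0.le (hb1 a) hS0 hS
    have h2 := Real.log_le_log (by positivity) h1
    have h3 : Real.log (L * r a / (L + k)) = Real.log (r a) - Real.log (1 + k / L) := by
      rw [← Real.log_div ha.ne' (by positivity)]
      congr 1
      field_simp
    have h4 := Real.log_le_sub_one_of_pos (show (0 : ℝ) < 1 + k / L by positivity)
    rw [Real.negMulLog, neg_mul, ← mul_neg, ← mul_add]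
    exact mul_le_mul_of_nonneg_left (by linarith) ha.le
  refine (Finset.sum_le_sum fun a _ => hkey a).trans (le_of_eq ?_)
  rw [Finset.sum_add_distrib, ← Finset.sum_mul, hsum, one_mul]

theorem le_of_forall_nat_mul_le {a b C : ℝ} (h : ∀ n : ℕ, n * a - C ≤ n * b) : a ≤ b := by
  by_contra! hlt
  obtain ⟨n, hn⟩ := exists_nat_gt (C / (a - b))
  rw [div_lt_iff₀ (by linarith)] at hn
  linarith [h n]

variable {X : Type*} [MetricSpace X] [CompactSpace X] [MeasurableSpace X] [BorelSpace X]

theorem SpecSystem.le_stepEntropy {Y : Set (ℕ → X)} {f : X × X → ℝ} {ε : ℝ}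
    (h : SpecSystem Y f ε) {ν : Measure (ℕ → X)} [IsProbabilityMeasure ν]
    (hν : MeasurePreserving shiftSeq ν ν) (hνY : ν Yᶜ = 0) {μ : Measure X}
    [IsProbabilityMeasure μ] {R : X → Measure X} (hR : IsTransKernel R)
    (hback : ν.map (fun y => (y 1, y 0)) = μ.compProd ⟨R, hR.1⟩) {k : ℕ} {p : X → Fin k}
    (hp : Measurable p) (hpd : ∀ x y, p x = p y → dist x y < ε) {a C : ℝ}
    (ha : ∀ n : ℕ, n * a - C ≤ partEntropy ν (word p (n + 1))) : a ≤ stepEntropy μ R p := by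
  have hRp : ∀ x, IsProbabilityMeasure (R x) := hR.2
  have : ProbabilityTheory.IsMarkovKernel (⟨R, hR.1⟩ : ProbabilityTheory.Kernel X X) := ⟨hR.2⟩
  have hpf : FinMeas p := fun a => hp (measurableSet_singleton a)
  refine le_of_forall_pos_le_add fun η hη => ?_
  obtain ⟨L, hL⟩ := exists_nat_gt (k / (η / 2))
  have hL' : (0 : ℝ) < L := lt_of_le_of_lt (by positivity) hL
  have hL0 : 0 < L := by exact_mod_cast hL'
  have hkL : (k : ℝ) / L ≤ η / 2 := by
    rw [div_lt_iff₀ (by linarith)] at hL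
    rw [div_le_iff₀ hL']
    linarith
  set r : Fin k → X → ℝ := fun a x => (R x (p ⁻¹' {a})).toReal
  have hr : ∀ a, Measurable (r a) := fun a => hR.measurable_toReal (hpf a)
  have hr0 : ∀ a x, 0 ≤ r a x := fun a x => ENNReal.toReal_nonneg
  have hrs : ∀ x, ∑ a, r a x = 1 := hR.sum_toReal hpf
  have hr1 : ∀ a x, r a x ≤ 1 := fun a x => by
    rw [← hrs x]
    exact Finset.single_le_sum (fun a _ => hr0 a x) (Finset.mem_univ a)
  have hfl : ∀ a x, ⌊L * r a x⌋₊ < L + 1 := fun a x => by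
    rw [Nat.lt_succ_iff, ← Nat.floor_natCast (R := ℝ) L]
    refine Nat.floor_mono ?_
    rw [Nat.floor_natCast]
    exact mul_le_of_le_one_right hL'.le (hr1 a x)
  set g : X → Fin k → Fin (L + 1) := fun x a => ⟨⌊L * r a x⌋₊, hfl a x⟩ with hg
  have hgm : FinMeas g := FinMeas.pi fun a => by
    have : Measurable fun x => ⌊L * r a x⌋₊ := ((hr a).const_mul _).nat_floor
    intro i
    have h2 : (fun x => (⟨⌊L * r a x⌋₊, hfl a x⟩ : Fin (L + 1))) ⁻¹' {i} =
        (fun x => ⌊L * r a x⌋₊) ⁻¹' {(i : ℕ)} := by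
      ext x
      simp [Fin.ext_iff]
    rw [h2]
    exact this (measurableSet_singleton _)
  set ρ : (Fin k → Fin (L + 1)) → Fin k → ℝ := fun b a =>
    (((b a : ℕ) : ℝ) + 1) / ∑ a', (((b a' : ℕ) : ℝ) + 1) with hρ
  have hρpos : ∀ b a, 0 < ρ b a := fun b a =>
    div_pos (by positivity) (Finset.sum_pos (fun a _ => by positivity) ⟨a, Finset.mem_univ a⟩)
  have hρ1 : ∀ b, ∑ a, ρ b a ≤ 1 := fun b => by
    rw [hρ]
    simp only
    rw [← Finset.sum_div]
    exact div_self_le_one _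
  obtain ⟨C', hC'⟩ := exists_partEntropy_le_of_generating h.isClosed h.shift_mem h.expansive ν hνY
    le_rfl (by simpa using hν) (u := fun y => p (y 0)) (v := fun y => g (y 0))
    (hpf.comp_measurable (measurable_pi_apply 0)) (hgm.comp_measurable (measurable_pi_apply 0))
    (fun y _ y' _ hy i hi => by
      obtain rfl : i = 0 := by omega
      exact (hpd _ _ hy).le)
    ρ (fun b a => (hρpos b a).le) (fun y => hρpos _ _) hρ1 (half_pos hη)
  set I := ∫ y, -Real.log (ρ (g (y 1)) (p (y 0))) ∂ν with hI
  have hIle : I ≤ stepEntropy μ R p + k / L := by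
    have hFm : FinMeas fun z : X × X => (g z.1, p z.2) :=
      (hgm.comp_measurable measurable_fst).prodMk (hpf.comp_measurable measurable_snd)
    have hF := hFm.measurable_real fun c => -Real.log (ρ c.1 c.2)
    have h1 : I = ∫ z, -Real.log (ρ (g z.1) (p z.2)) ∂(μ.compProd ⟨R, hR.1⟩) := by
      rw [← hback, integral_map (by fun_prop) hF.aestronglyMeasurable]
    rw [h1, Measure.integral_compProd (hFm.integrable _ fun c => -Real.log (ρ c.1 c.2))]
    have h2 : ∀ x, ∫ x', -Real.log (ρ (g x) (p x')) ∂(R x) =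
        ∑ a, r a x * -Real.log (ρ (g x) a) := fun x =>
      hpf.integral_eq_sum (R x) fun a => -Real.log (ρ (g x) a)
    have hInt : Integrable (fun x => ∑ a, Real.negMulLog (r a x)) μ :=
      integrable_finsetSum _ fun a _ => integrable_negMulLog μ (hr a) (hr0 a) (hr1 a)
    calc _ = ∫ x, ∑ a, r a x * -Real.log (ρ (g x) a) ∂μ := integral_congr_ae (ae_of_all _ h2)
      _ ≤ ∫ x, (∑ a, Real.negMulLog (r a x) + k / L) ∂μ := by
        refine integral_mono_of_nonneg (ae_of_all _ fun x => ?_)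
          (hInt.add (integrable_const _)) (ae_of_all _ fun x => ?_)
        · refine Finset.sum_nonneg fun a _ => mul_nonneg (hr0 a x) (neg_nonneg.2
            (Real.log_nonpos (hρpos _ _).le ((Finset.single_le_sum (fun a _ => (hρpos _ a).le)
              (Finset.mem_univ a)).trans (hρ1 _))))
        · exact sum_mul_neg_log_quantize_le hL0 (fun a => hr0 a x) (hrs x)
            (fun a => (Nat.lt_floor_add_one _).le)
            (fun a => Nat.floor_le (mul_nonneg hL'.le (hr0 a x)))
      _ = _ := by
        rw [integral_add hInt (integrable_const _)]
        simp [stepEntropy, r]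
  have h3 : a ≤ I + η / 2 := by
    refine le_of_forall_nat_mul_le (C := C + C') fun n => ?_
    have h4 := hC' n (word p (n + 1)) fun y y' hu _ => by
      funext i
      have := hu i (by omega)
      simpa only [Function.iterate_one, shiftSeq_iterate, zero_add, word] using this
    have h5 := (ha n).trans h4
    simp only [Function.iterate_one] at h5
    change _ ≤ n * (I + η / 2) + C' at h5
    linarith
  linarith

/-- A Gibbs measure yields a transition kernel and a stationary measure attaining at least the
exponential growth rate. -/
theorem exists_le_kernelEntropy_add_energyInt {T : X → Set X} (hT : IsCorrespondence T)
    {φ : ↥(graph2 T) → ℝ} (hf : Measurable (ext2 T φ)) {ε : ℝ}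
    (h : SpecSystem (orbitSpace T) (ext2 T φ) ε) :
    ∃ (μ : Measure X) (Q : X → Measure X), IsTransKernel Q ∧ SupportedBy T Q ∧
      IsProbabilityMeasure μ ∧ μ.bind Q = μ ∧
      (h.rate : EReal) ≤ kernelEntropy μ Q + ((energyInt T φ Q μ : ℝ) : EReal) := by
  obtain ⟨g⟩ := h.nonempty_gibbsCells
  obtain ⟨ν, hνp, hν, hνY, hball⟩ := g.exists_invariant h
  obtain ⟨B, hB⟩ := h.bounded
  have hX : Nonempty X := ⟨h.nonempty.some 0⟩
  obtain ⟨k, p, hpf, hpd⟩ := exists_finMeas_code (X := X) (half_pos h.pos)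
  have hp : Measurable p := fun s _ => hpf.measurableSet_preimage s
  have hμ1 : ν.map (fun y => y 1) = ν.map fun y => y 0 := by
    conv_rhs => rw [← hν.map_eq, Measure.map_map (by fun_prop) hν.measurable]
    rfl
  set μ := ν.map fun y => y 0 with hμ
  have hμp : IsProbabilityMeasure μ :=
    Measure.isProbabilityMeasure_map (measurable_pi_apply 0).aemeasurable
  have hρp : IsProbabilityMeasure (ν.map fun y => (y 0, y 1)) :=
    Measure.isProbabilityMeasure_map (by fun_prop)
  have hρp' : IsProbabilityMeasure (ν.map fun y => (y 1, y 0)) :=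
    Measure.isProbabilityMeasure_map (by fun_prop)
  have hG : MeasurableSet (graph2 T) := hT.2.2.measurableSet
  obtain ⟨Q, hQ, hQs, hρQ⟩ := exists_supportedBy_eq_compProd hT (ν.map fun y => (y 0, y 1)) (by
    rw [Measure.map_apply (by fun_prop) hG.compl]
    exact measure_mono_null (fun y hy (hy' : y ∈ orbitSpace T) => hy (hy' 0)) hνY)
  obtain ⟨R, hR, hρR⟩ := exists_transKernel_eq_compProd (ν.map fun y => (y 1, y 0))
  have hfst : (ν.map fun y => (y 0, y 1)).fst = μ := by
    rw [Measure.fst, Measure.map_map (by fun_prop) (by fun_prop)]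
    rfl
  have hfst' : (ν.map fun y => (y 1, y 0)).fst = μ := by
    rw [Measure.fst, Measure.map_map (by fun_prop) (by fun_prop), ← hμ1]
    rfl
  rw [hfst] at hρQ
  rw [hfst'] at hρR
  have hQk : ProbabilityTheory.IsMarkovKernel (⟨Q, hQ.1⟩ : ProbabilityTheory.Kernel X X) := ⟨hQ.2⟩
  have hRk : ProbabilityTheory.IsMarkovKernel (⟨R, hR.1⟩ : ProbabilityTheory.Kernel X X) := ⟨hR.2⟩
  have hinv : μ.bind Q = μ := by
    have h1 := congrArg Measure.snd hρQ
    rw [Measure.snd_compProd, Measure.snd, Measure.map_map (by fun_prop) (by fun_prop)] at h1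
    exact h1.symm.trans hμ1
  have hrev : ∀ F : X → X → ℝ≥0∞, Measurable (Function.uncurry F) →
      ∫⁻ x, (∫⁻ y, F x y ∂(Q x)) ∂μ = ∫⁻ y, (∫⁻ x, F x y ∂(R y)) ∂μ := fun F hF => by
    have h1 := Measure.lintegral_compProd (μ := μ) (κ := ⟨Q, hQ.1⟩) hF
    have h2 := Measure.lintegral_compProd (μ := μ) (κ := ⟨R, hR.1⟩) (hF.comp measurable_swap)
    rw [← hρQ, lintegral_map hF (by fun_prop)] at h1
    rw [← hρR, lintegral_map (hF.comp measurable_swap) (by fun_prop)] at h2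
    exact h1.symm.trans h2
  obtain ⟨ν', hν'⟩ := exists_isTrajLaw (μ := μ) hQ
  have hpair := hν'.map_pair hQ
  have hI : ∫ y, ext2 T φ (y 0, y 1) ∂ν = energyInt T φ Q μ := by
    rw [← hν'.integral_eq_energyInt hQ hT hQs hf hB]
    have h1 := integral_map (μ := ν) (φ := fun y => (y 0, y 1)) (by fun_prop)
      (f := ext2 T φ) hf.aestronglyMeasurable
    have h2 := integral_map (μ := ν') (φ := fun y => (y 0, y 1)) (by fun_prop)
      (f := ext2 T φ) hf.aestronglyMeasurable
    rw [← h1, ← h2, hpair, hρQ]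
  refine ⟨μ, Q, hQ, hQs, hμp, hinv, ?_⟩
  obtain ⟨C, hC⟩ := h.exists_le_partEntropy_word hf hν hνY g.K_pos hball hpf hpd
  have h3 := h.le_stepEntropy hν hνY hR hρR hp
    (fun x y hxy => (hpd x y hxy).trans (half_lt_self h.pos)) hC
  have h4 := g.le_kernelEntropy h hf hQ hinv hν' (hν'.measure_compl_orbitSpace hQ hinv hT hQs) hp
    (a := stepEntropy μ R p) (C := 0)
    fun n => by simpa using nsmul_stepEntropy_le hQ hR hrev hp n
  rw [hI] at h3
  calc (h.rate : EReal) ≤ ((stepEntropy μ R p + energyInt T φ Q μ : ℝ) : EReal) :=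
        EReal.coe_le_coe_iff.2 (by linarith)
    _ = (stepEntropy μ R p : EReal) + ((energyInt T φ Q μ : ℝ) : EReal) := EReal.coe_add _ _
    _ ≤ _ := add_le_add h4 le_rfl

end Existence

section Correspondence

variable {X : Type*} [MetricSpace X] {T : X → Set X} {φ : ↥(graph2 T) → ℝ} {ε : ℝ}

theorem isFinOrbit_restrict {y : ℕ → X} (hy : y ∈ orbitSpace T) (n : ℕ) :
    IsFinOrbit T fun i : Fin (n + 1) => y i := fun i => hy i

theorem birkhoff_restrict (φ : ↥(graph2 T) → ℝ) (y : ℕ → X) (n : ℕ) :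
    birkhoff T φ (fun i : Fin (n + 1) => y i) = seqSum (ext2 T φ) n y := by
  simp [birkhoff, seqSum, Finset.sum_range]

theorem isClosed_orbitSpace (hT : IsCorrespondence T) : IsClosed (orbitSpace T) := by
  rw [orbitSpace, ofPred_forall]
  refine isClosed_iInter fun k => ?_
  have hc : Continuous fun x : ℕ → X => (x k, x (k + 1)) := by fun_prop
  exact hT.2.2.preimage hc

theorem exists_extend_finOrbit (hT : IsCorrespondence T) {n : ℕ} {x : Fin (n + 1) → X}
    (hx : IsFinOrbit T x) : ∃ y ∈ orbitSpace T, ∀ i : Fin (n + 1), y i = x i := by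
  choose t ht using hT.1
  refine ⟨fun k => t^[k - n] (x ⟨min k n, by omega⟩), fun k => ?_, fun i => ?_⟩
  · rcases lt_or_ge k n with hk | hk
    · have h1 := hx ⟨k, hk⟩
      simp only [show k + 1 - n = 0 by omega, show k - n = 0 by omega, Function.iterate_zero, id,
        show min (k + 1) n = k + 1 by omega, show min k n = k by omega]
      exact h1
    · simp only [show k + 1 - n = (k - n) + 1 by omega, show min (k + 1) n = min k n by omega,
        Function.iterate_succ_apply']
      exact ht _
  · have hi : (i : ℕ) ≤ n := by omega
    simp [Nat.sub_eq_zero_of_le hi, hi]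

theorem exists_abs_ext2_le [CompactSpace X] (hT : IsCorrespondence T) (hφ : Continuous φ) :
    ∃ B : ℝ, ∀ p, |ext2 T φ p| ≤ B := by
  have : CompactSpace ↥(graph2 T) := isCompact_iff_compactSpace.1 hT.2.2.isCompact
  obtain ⟨B, hB⟩ := isCompact_univ.exists_bound_of_continuousOn hφ.continuousOn
  refine ⟨max B 0, fun p => ?_⟩
  unfold ext2
  split_ifs with hp
  · exact (hB ⟨p, hp⟩ (mem_univ _)).trans (le_max_left _ _)
  · simp

theorem measurable_ext2 [CompactSpace X] [MeasurableSpace X] [BorelSpace X]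
    (hT : IsCorrespondence T) (hφ : Continuous φ) : Measurable (ext2 T φ) :=
  Measurable.dite hφ.measurable (g := fun _ => 0) measurable_const hT.2.2.measurableSet

theorem exists_glue_of_hasSpecification (hspec : HasSpecification T) {τ : ℝ} (hτ : 0 < τ) :
    ∃ L : ℕ, ∀ n k l : ℕ, ∀ x ∈ orbitSpace T, ∀ y ∈ orbitSpace T, ∀ w ∈ orbitSpace T,
      ∃ z ∈ orbitSpace T, CloseUpTo n τ z x ∧ CloseUpTo k τ (shiftSeq^[n + L] z) y ∧
        CloseUpTo l τ (shiftSeq^[n + L + k + L] z) w := by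
  obtain ⟨M, hM⟩ := hspec τ hτ
  refine ⟨M + 2, fun n k l x hx y hy w hw => ?_⟩
  obtain ⟨z, hz, hzd⟩ := hM 3 ![n + 1, k + 1, l + 1] (fun _ => M + 1) ![x, y, w]
    (fun j => by fin_cases j <;> simp) (fun j => by simp)
    (fun j i _ => by fin_cases j <;> [exact hx i; exact hy i; exact hw i])
  refine ⟨z, hz, fun i hi => ?_, fun i hi => ?_, fun i hi => ?_⟩
  · have := hzd 0 i (by simp; omega)
    simpa [specShift] using this
  · have := hzd 1 i (by simp; omega)
    rw [shiftSeq_iterate]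
    convert this using 3
    · simp [specShift]
      omega
    · rfl
  · have := hzd 2 i (by simp; omega)
    rw [shiftSeq_iterate]
    convert this using 3
    · simp [specShift, Fin.sum_univ_three]
      omega
    · rfl

theorem specSystem_orbitSpace [CompactSpace X] (hT : IsCorrespondence T)
    (hexp : IsFwdExpansiveWith T ε) (hspec : HasSpecification T) (hφ : Continuous φ)
    (hBowen : BowenSummableWith T φ ε) : SpecSystem (orbitSpace T) (ext2 T φ) ε where
  pos := hexp.1
  isClosed := isClosed_orbitSpace hT
  nonempty := by
    obtain ⟨M, hM⟩ := hspec 1 one_pos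
    obtain ⟨z, hz, -⟩ := hM 0 Fin.elim0 Fin.elim0 Fin.elim0 (fun j => j.elim0)
      (fun j => j.elim0) (fun j => j.elim0)
    exact ⟨z, hz⟩
  shift_mem := fun y hy k => hy (k + 1)
  bounded := exists_abs_ext2_le hT hφ
  expansive := fun x hx y hy hxy => by
    by_contra hne
    obtain ⟨n, hn⟩ := hexp.2 x hx y hy hne
    exact (hxy n).not_gt hn
  distortion := by
    obtain ⟨C, hC⟩ := hBowen
    refine ⟨C, fun n x hx y hy hxy => ?_⟩
    rw [← birkhoff_restrict, ← birkhoff_restrict]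
    exact hC n _ _ (isFinOrbit_restrict hx n) (isFinOrbit_restrict hy n)
      fun k => hxy k (by omega)
  glue := fun τ hτ => exists_glue_of_hasSpecification hspec hτ

theorem elog_bounds {x : ℝ≥0∞} {a b : ℝ} (ha : 0 < a) (h1 : ENNReal.ofReal a ≤ x)
    (h2 : x ≤ ENNReal.ofReal b) :
    ((Real.log a : ℝ) : EReal) ≤ elog x ∧ elog x ≤ ((Real.log b : ℝ) : EReal) := by
  have hx0 : x ≠ 0 := ((ENNReal.ofReal_pos.2 ha).trans_le h1).ne'
  have hxt : x ≠ ⊤ := (h2.trans_lt ENNReal.ofReal_lt_top).ne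
  have h3 : a ≤ x.toReal := (ENNReal.ofReal_le_iff_le_toReal hxt).1 h1
  have hb : 0 ≤ b := by
    by_contra! hb
    rw [ENNReal.ofReal_of_nonpos hb.le] at h2
    exact hx0 (le_zero_iff.1 h2)
  have h4 : x.toReal ≤ b := ENNReal.toReal_le_of_le_ofReal hb h2
  rw [elog, if_neg hx0, if_neg hxt, EReal.coe_le_coe_iff, EReal.coe_le_coe_iff]
  exact ⟨Real.log_le_log ha h3, Real.log_le_log (ha.trans_le h3) h4⟩

variable [CompactSpace X]

theorem SpecSystem.exists_sepSup_le (h : SpecSystem (orbitSpace T) (ext2 T φ) ε)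
    (hT : IsCorrespondence T) {s : ℝ} (hs : 0 < s) :
    ∃ K : ℝ, 0 < K ∧ ∀ n : ℕ, sepSup T φ n s ≤ ENNReal.ofReal (K * Real.exp (n * h.rate)) := by
  obtain ⟨K, hK, hE⟩ := h.exists_sep_le hs
  refine ⟨K, hK, fun n => iSup_le fun E => iSup_le fun hEo => iSup_le fun hEs => ?_⟩
  choose e he hex using fun x : E => exists_extend_finOrbit hT (hEo x.2)
  rw [orbSum, ENNReal.tsum_eq_iSup_sum]
  refine iSup_le fun F => ?_
  have hinj : ∀ x ∈ F, ∀ y ∈ F, CloseUpTo n s (e x) (e y) → x = y := fun x _ y _ hxy => by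
    by_contra hne
    refine (hEs x x.2 y y.2 fun h => hne (Subtype.ext h)).not_gt ?_
    rw [dist_pi_lt_iff hs]
    intro i
    have := hxy i (by omega)
    rwa [hex x, hex y] at this
  have hsep : IsSepIn (orbitSpace T) n s (F.image e) := by
    refine ⟨fun y hy => ?_, fun y hy y' hy' hyy => ?_⟩
    · obtain ⟨x, -, rfl⟩ := Finset.mem_image.1 (Finset.mem_coe.1 hy)
      exact he x
    · obtain ⟨x, hx, rfl⟩ := Finset.mem_image.1 hy
      obtain ⟨x', hx', rfl⟩ := Finset.mem_image.1 hy'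
      rw [hinj x hx x' hx' hyy]
  have h1 := hE n _ hsep
  rw [expSum, Finset.sum_image fun x hx y hy hxy => hinj x hx y hy (by
    rw [hxy]
    exact CloseUpTo.refl n hs _)] at h1
  rw [← ENNReal.ofReal_sum_of_nonneg fun _ _ => (Real.exp_pos _).le]
  refine ENNReal.ofReal_le_ofReal (le_trans (le_of_eq ?_) h1)
  refine Finset.sum_congr rfl fun x _ => ?_
  rw [← birkhoff_restrict]
  congr 2
  funext i
  exact (hex x i).symm

theorem SpecSystem.exists_le_sepSup (h : SpecSystem (orbitSpace T) (ext2 T φ) ε) {s : ℝ}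
    (hs : s ≤ ε / 2) :
    ∃ K : ℝ, 0 < K ∧ ∀ n : ℕ, ENNReal.ofReal (K * Real.exp (n * h.rate)) ≤ sepSup T φ n s := by
  obtain ⟨K, hK, hE⟩ := h.exists_le_span
  refine ⟨K⁻¹, inv_pos.2 hK, fun n => ?_⟩
  set r : (ℕ → X) → Fin (n + 1) → X := fun y i => y i
  have hsep := h.base_sep n
  have hfar : ∀ x ∈ h.base n, ∀ y ∈ h.base n, dist (r x) (r y) < ε / 2 → x = y :=
    fun x hx y hy hxy => hsep.2 x hx y hy fun i hi =>
      (dist_pi_lt_iff (half_pos h.pos)).1 hxy ⟨i, by omega⟩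
  have hsum : orbSum T φ n ((h.base n).image r : Finset (Fin (n + 1) → X)) =
      ENNReal.ofReal (expSum (ext2 T φ) n (h.base n)) := by
    rw [orbSum, Finset.tsum_subtype' ((h.base n).image r)
      fun x => ENNReal.ofReal (Real.exp (birkhoff T φ x)),
      Finset.sum_image fun x hx y hy hxy => hfar x hx y hy (by
        rw [hxy, dist_self]; exact half_pos h.pos),
      expSum, ENNReal.ofReal_sum_of_nonneg fun _ _ => (Real.exp_pos _).le]
    exact Finset.sum_congr rfl fun x _ => by rw [birkhoff_restrict]
  have h1 := hE n _ (h.base_span n)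
  calc ENNReal.ofReal (K⁻¹ * Real.exp (n * h.rate))
      ≤ ENNReal.ofReal (expSum (ext2 T φ) n (h.base n)) := by
        refine ENNReal.ofReal_le_ofReal ?_
        rwa [inv_mul_le_iff₀ hK]
    _ = orbSum T φ n ((h.base n).image r : Finset (Fin (n + 1) → X)) := hsum.symm
    _ ≤ sepSup T φ n s := by
        refine le_iSup_of_le _ (le_iSup_of_le ?_ (le_iSup_of_le ?_ le_rfl))
        · intro x hx
          obtain ⟨y, hy, rfl⟩ := Finset.mem_image.1 (Finset.mem_coe.1 hx)
          exact isFinOrbit_restrict (hsep.1 hy) n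
        · intro x hx y hy hne
          obtain ⟨x, hx', rfl⟩ := Finset.mem_image.1 (Finset.mem_coe.1 hx)
          obtain ⟨y, hy', rfl⟩ := Finset.mem_image.1 (Finset.mem_coe.1 hy)
          by_contra! hlt
          exact hne (congrArg r (hfar x hx' y hy' (hlt.trans_le hs)))

theorem SpecSystem.pressSepEps_eq (h : SpecSystem (orbitSpace T) (ext2 T φ) ε)
    (hT : IsCorrespondence T) {s : ℝ} (hs : 0 < s) (hs' : s ≤ ε / 2) :
    pressSepEps T φ s = h.rate := by
  obtain ⟨K, hK, hl⟩ := h.exists_le_sepSup hs'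
  obtain ⟨K', hK', hu⟩ := h.exists_sepSup_le hT hs
  have hlim : ∀ C : ℝ, Tendsto
      (fun n : ℕ => (((n : ℝ)⁻¹ : ℝ) : EReal) * ((n * h.rate + C : ℝ) : EReal)) atTop
      (𝓝 (h.rate : EReal)) := fun C => by
    simp_rw [← EReal.coe_mul]
    exact (continuous_coe_real_ereal.tendsto _).comp (tendsto_affine_div h.rate C)
  have hlog : ∀ {C : ℝ}, 0 < C → ∀ n : ℕ,
      Real.log (C * Real.exp (n * h.rate)) = n * h.rate + Real.log C := fun hC n => by
    rw [Real.log_mul hC.ne' (Real.exp_pos _).ne', Real.log_exp, add_comm]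
  have hb := fun n => elog_bounds (mul_pos hK (Real.exp_pos _)) (hl n) (hu n)
  refine (tendsto_of_tendsto_of_tendsto_of_le_of_le (hlim (Real.log K)) (hlim (Real.log K'))
    (fun n => ?_) fun n => ?_).limsup_eq
  · rw [← hlog hK]
    exact mul_le_mul_of_nonneg_left (hb n).1 (EReal.coe_nonneg.2 (by positivity))
  · rw [← hlog hK']
    exact mul_le_mul_of_nonneg_left (hb n).2 (EReal.coe_nonneg.2 (by positivity))

theorem SpecSystem.pressure_eq (h : SpecSystem (orbitSpace T) (ext2 T φ) ε)
    (hT : IsCorrespondence T) : pressure T φ = h.rate := by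
  have : (fun s => pressSepEps T φ s) =ᶠ[𝓝[>] (0 : ℝ)] fun _ => (h.rate : EReal) := by
    filter_upwards [Ioc_mem_nhdsGT (half_pos h.pos)] with s hs
    exact h.pressSepEps_eq hT hs.1 hs.2
  rw [pressure, limsup_congr this, limsup_const]

variable [MeasurableSpace X] [BorelSpace X] {μ : Measure X} {Q : X → Measure X}

theorem SpecSystem.kernelEntropy_add_energyInt_le
    (h : SpecSystem (orbitSpace T) (ext2 T φ) ε) (hT : IsCorrespondence T)
    (hf : Measurable (ext2 T φ)) [IsProbabilityMeasure μ] (hQ : IsTransKernel Q)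
    (hQs : SupportedBy T Q) (hinv : μ.bind Q = μ) :
    kernelEntropy μ Q + ((energyInt T φ Q μ : ℝ) : EReal) ≤ h.rate := by
  obtain ⟨g⟩ := h.nonempty_gibbsCells
  obtain ⟨B, hB⟩ := h.bounded
  obtain ⟨ν, hν⟩ := exists_isTrajLaw (μ := μ) hQ
  have h1 := g.kernelEntropy_le h hf hQ hinv hν (hν.measure_compl_orbitSpace hQ hinv hT hQs)
  rw [hν.integral_eq_energyInt hQ hT hQs hf hB] at h1
  refine (add_le_add h1 le_rfl).trans (le_of_eq ?_)
  rw [← EReal.coe_add, sub_add_cancel]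

/-- The trajectory law of an equilibrium state is absolutely continuous with respect to the Gibbs
measure. -/
theorem IsEquilibrium.exists_isTrajLaw_absolutelyContinuous
    (heq : IsEquilibrium T φ μ Q) (h : SpecSystem (orbitSpace T) (ext2 T φ) ε)
    (hT : IsCorrespondence T) (hf : Measurable (ext2 T φ))
    (g : GibbsCells (orbitSpace T) (ext2 T φ) ε h.rate) :
    ∃ ν, IsTrajLaw μ Q ν ∧ MeasurePreserving shiftSeq ν ν ∧ ν ≪ g.m := by
  obtain ⟨hQ, hQs, hμ, hinv, hP⟩ := heq
  obtain ⟨B, hB⟩ := h.bounded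
  obtain ⟨ν, hν⟩ := exists_isTrajLaw (μ := μ) hQ
  refine ⟨ν, hν, hν.measurePreserving hQ hinv, g.absolutelyContinuous_of_le_kernelEntropy h hf hQ
    hinv hν (hν.measure_compl_orbitSpace hQ hinv hT hQs) ?_⟩
  rw [hν.integral_eq_energyInt hQ hT hQs hf hB, EReal.coe_sub]
  rw [h.pressure_eq hT] at hP
  exact EReal.sub_le_of_le_add hP.le

theorem ae_eq_of_compProd_eq {Q' : X → Measure X} [IsProbabilityMeasure μ] (hQ : IsTransKernel Q)
    (hQ' : IsTransKernel Q') (h : μ.compProd ⟨Q, hQ.1⟩ = μ.compProd ⟨Q', hQ'.1⟩) :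
    ∀ᵐ x ∂μ, Q x = Q' x := by
  have hk : ProbabilityTheory.IsMarkovKernel (⟨Q, hQ.1⟩ : ProbabilityTheory.Kernel X X) := ⟨hQ.2⟩
  have hk' : ProbabilityTheory.IsMarkovKernel (⟨Q', hQ'.1⟩ : ProbabilityTheory.Kernel X X) :=
    ⟨hQ'.2⟩
  obtain ⟨x0⟩ : Nonempty X := nonempty_of_isProbabilityMeasure μ
  have : Nonempty X := ⟨x0⟩
  have h1 := ProbabilityTheory.eq_condKernel_of_measure_eq_compProd (ρ := μ.compProd ⟨Q, hQ.1⟩)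
    ⟨Q, hQ.1⟩ (by rw [Measure.fst_compProd])
  have h2 := ProbabilityTheory.eq_condKernel_of_measure_eq_compProd (ρ := μ.compProd ⟨Q, hQ.1⟩)
    ⟨Q', hQ'.1⟩ (by rw [Measure.fst_compProd, h])
  rw [Measure.fst_compProd] at h1 h2
  filter_upwards [h1, h2] with x hx hx'
  exact hx.trans hx'.symm

end Correspondence

/-- **Theorem B (main part).** For a forward expansive correspondence `T` with the
specification property and a Bowen summable continuous potential `φ`, the Variational
Principle holds, an equilibrium state `(μ_φ, Q)` exists, and it is unique in the sense
that the measure is unique, and the kernels of any two equilibrium states with this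
measure agree at `μ_φ`-almost every point. -/
theorem thermodynamic_formalism_specification
    {X : Type*} [MetricSpace X] [CompactSpace X] [MeasurableSpace X] [BorelSpace X]
    (T : X → Set X) (hT : IsCorrespondence T) {ε : ℝ} (hexp : IsFwdExpansiveWith T ε)
    (hspec : HasSpecification T) (φ : ↥(graph2 T) → ℝ) (hφ : Continuous φ)
    (hBowen : BowenSummableWith T φ ε) :
    pressure T φ = varSup T φ ∧
      (∃ (μ : Measure X) (Q : X → Measure X), IsEquilibrium T φ μ Q) ∧
      ∀ (μ μ' : Measure X) (Q Q' : X → Measure X),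
        IsEquilibrium T φ μ Q → IsEquilibrium T φ μ' Q' →
          μ = μ' ∧ ∀ᵐ x ∂μ, Q x = Q' x := by
  have h := specSystem_orbitSpace hT hexp hspec hφ hBowen
  have hf := measurable_ext2 hT hφ
  have hP := h.pressure_eq hT
  obtain ⟨μ, Q, hQ, hQs, hμ, hinv, hle⟩ := exists_le_kernelEntropy_add_energyInt hT hf h
  refine ⟨le_antisymm ?_ ?_, ⟨μ, Q, hQ, hQs, hμ, hinv, ?_⟩, ?_⟩
  · rw [hP, varSup]
    exact hle.trans (le_iSup_of_le Q <| le_iSup_of_le hQ <| le_iSup_of_le hQs <|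
      le_iSup_of_le μ <| le_iSup_of_le hμ <| le_iSup_of_le hinv le_rfl)
  · rw [hP, varSup]
    exact iSup_le fun Q => iSup_le fun hQ => iSup_le fun hQs => iSup_le fun μ => iSup_le fun hμ =>
      iSup_le fun hinv => h.kernelEntropy_add_energyInt_le hT hf hQ hQs hinv
  · rw [hP]
    exact le_antisymm hle (h.kernelEntropy_add_energyInt_le hT hf hQ hQs hinv)
  · intro μ μ' Q Q' heq heq'
    obtain ⟨g⟩ := h.nonempty_gibbsCells
    obtain ⟨ν, hν, hνs, hνac⟩ := heq.exists_isTrajLaw_absolutelyContinuous h hT hf g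
    obtain ⟨ν', hν', hνs', hνac'⟩ := heq'.exists_isTrajLaw_absolutelyContinuous h hT hf g
    have := hν.1
    have := hν'.1
    have hμ := heq.2.2.1
    obtain rfl : ν = ν' := g.eq_of_absolutelyContinuous h hνs hνs' hνac hνac'
    obtain rfl : μ = μ' := hν.map_zero.symm.trans hν'.map_zero
    exact ⟨rfl, ae_eq_of_compProd_eq heq.1 heq'.1
      ((hν.map_pair heq.1).symm.trans (hν'.map_pair heq'.1))⟩

end Corr
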